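/- Let K be a field, q ∈ K nonzero, and n > t positive integers. The preimage under μ*_q : O_q(M_n^{≤t}) → O_q(V) of the ideal ⟨d_Y ⊗ d_Z⟩ of O_q(V) equals the ideal ⟨d_x⟩ of O_q(M_n^{≤t}); that is, (μ*_q)^{−1}(⟨d_Y ⊗ d_Z⟩) = ⟨d_x⟩. -/

import Mathlib

open scoped TensorProduct

noncomputable section

/-- The four defining relations of the quantized coordinate ring `O_q(M_{u,v})`, as a relation
on the free algebra on generators `X_{ij}`, `(i,j) ∈ Fin u × Fin v`. -/
inductive QMRel (K : Type) [Field K] (q : K) (u v : ℕ) :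
    FreeAlgebra K (Fin u × Fin v) → FreeAlgebra K (Fin u × Fin v) → Prop
  | row {i : Fin u} {j k : Fin v} (h : j < k) :
      QMRel K q u v (FreeAlgebra.ι K (i, j) * FreeAlgebra.ι K (i, k))
        (q • (FreeAlgebra.ι K (i, k) * FreeAlgebra.ι K (i, j)))
  | col {i k : Fin u} {j : Fin v} (h : i < k) :
      QMRel K q u v (FreeAlgebra.ι K (i, j) * FreeAlgebra.ι K (k, j))
        (q • (FreeAlgebra.ι K (k, j) * FreeAlgebra.ι K (i, j)))
  | comm {i k : Fin u} {j l : Fin v} (h1 : i < k) (h2 : l < j) :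
      QMRel K q u v (FreeAlgebra.ι K (i, j) * FreeAlgebra.ι K (k, l))
        (FreeAlgebra.ι K (k, l) * FreeAlgebra.ι K (i, j))
  | quantum {i k : Fin u} {j l : Fin v} (h1 : i < k) (h2 : j < l) :
      QMRel K q u v (FreeAlgebra.ι K (i, j) * FreeAlgebra.ι K (k, l))
        (FreeAlgebra.ι K (k, l) * FreeAlgebra.ι K (i, j) +
          (q - q⁻¹) • (FreeAlgebra.ι K (i, l) * FreeAlgebra.ι K (k, j)))

/-- The quantized coordinate ring `O_q(M_{u,v})` of `u × v` matrices. -/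
abbrev OqM (K : Type) [Field K] (q : K) (u v : ℕ) :=
  RingQuot (QMRel K q u v)

/-- The canonical generators `X_{ij}` of `O_q(M_{u,v})`. -/
def Xg (K : Type) [Field K] (q : K) {u v : ℕ} (i : Fin u) (j : Fin v) : OqM K q u v :=
  RingQuot.mkAlgHom K (QMRel K q u v) (FreeAlgebra.ι K (i, j))

/-- The number of inversions (the length) of a permutation of `Fin l`. -/
def invCount {l : ℕ} (σ : Equiv.Perm (Fin l)) : ℕ :=
  (Finset.univ.filter fun p : Fin l × Fin l => p.1 < p.2 ∧ σ p.2 < σ p.1).card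

/-- The `l × l` quantum minor of `O_q(M_{u,v})` with rows `R 0, …, R (l-1)` and columns
`C 0, …, C (l-1)`:  `[R|C] = Σ_σ (-q)^{ℓ(σ)} X_{R 0, C (σ 0)} ⋯ X_{R (l-1), C (σ (l-1))}`. -/
def qMinor (K : Type) [Field K] (q : K) {u v l : ℕ} (R : Fin l → Fin u) (C : Fin l → Fin v) :
    OqM K q u v :=
  ∑ σ : Equiv.Perm (Fin l),
    ((-q) ^ invCount σ) • (List.ofFn fun i : Fin l => Xg K q (R i) (C (σ i))).prod

/-- The relations killing all `(t+1) × (t+1)` quantum minors of `O_q(M_{m,n})`. -/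
inductive DetRel (K : Type) [Field K] (q : K) (m n t : ℕ) :
    OqM K q m n → OqM K q m n → Prop
  | minor (R : Fin (t + 1) → Fin m) (C : Fin (t + 1) → Fin n)
      (hR : StrictMono R) (hC : StrictMono C) :
      DetRel K q m n t (qMinor K q R C) 0

/-- `O_q(M_{m,n}^{≤ t}) = O_q(M_{m,n}) / I_{t+1}`, the quotient by the ideal generated by all
`(t+1) × (t+1)` quantum minors. -/
abbrev OqMle (K : Type) [Field K] (q : K) (m n t : ℕ) :=
  RingQuot (DetRel K q m n t)

/-- The quotient map `O_q(M_{m,n}) → O_q(M_{m,n}^{≤ t})`. -/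
def mkle (K : Type) [Field K] (q : K) (m n t : ℕ) :
    OqM K q m n →ₐ[K] OqMle K q m n t :=
  RingQuot.mkAlgHom K (DetRel K q m n t)

/-- The two-sided ideal of a `K`-algebra `R` generated by a subset `S`, as a set. -/
def tsSpan (K : Type) [Field K] (R : Type) [Ring R] [Algebra K R] (S : Set R) : Set R :=
  (Submodule.span K {x : R | ∃ a b : R, ∃ s ∈ S, x = a * s * b} : Submodule K R)

/-- The rows `{n-t+1, …, n}` (the lowest `t` rows). -/
def rowTop (n t : ℕ) (h : t ≤ n) : Fin t → Fin n :=
  fun i => ⟨n - t + i.1, by have := i.2; omega⟩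

/-- The columns `{1, …, t}` (the leftmost `t` columns). -/
def colLeft (n t : ℕ) (h : t ≤ n) : Fin t → Fin n :=
  fun i => ⟨i.1, by have := i.2; omega⟩

/-- `d_Y = [n,…,n-t+1 | 1,…,t] ∈ O_q(M_{n,t})`. -/
def dY (K : Type) [Field K] (q : K) (n t : ℕ) (h : t ≤ n) : OqM K q n t :=
  qMinor K q (rowTop n t h) (id : Fin t → Fin t)

/-- `d_Z = [t,…,1 | 1,…,t] ∈ O_q(M_{t,n})`. -/
def dZ (K : Type) [Field K] (q : K) (n t : ℕ) (h : t ≤ n) : OqM K q t n :=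
  qMinor K q (id : Fin t → Fin t) (colLeft n t h)

/-- `d_X = [n,…,n-t+1 | 1,…,t] ∈ O_q(M_n)`. -/
def dX (K : Type) [Field K] (q : K) (n t : ℕ) (h : t ≤ n) : OqM K q n n :=
  qMinor K q (rowTop n t h) (colLeft n t h)

/-- `d_x = d_X + I_{t+1} ∈ O_q(M_n^{≤ t})`. -/
def dx (K : Type) [Field K] (q : K) (n t : ℕ) (h : t ≤ n) : OqMle K q n n t :=
  mkle K q n n t (dX K q n t h)

set_option linter.unusedSimpArgs false
set_option linter.unusedSectionVars false

section Words

variable {K R I : Type*} [Field K] [Ring R] [Algebra K R]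

/-- The product of the elements `x i` along a word in the letters `i`. -/
def wordProd (x : I → R) (l : List I) : R := (l.map x).prod

/-- The weight of a multiset of letters. -/
def wordWt (w : I → ℕ) (s : Multiset I) : ℕ := (s.map w).sum

variable (K) in
/-- The span of the words of length `N` and weight less than `d`. -/
def lowSpan (x : I → R) (w : I → ℕ) (N d : ℕ) : Submodule K R :=
  Submodule.span K {y | ∃ l : List I, l.length = N ∧ wordWt w l < d ∧ wordProd x l = y}

variable (K) in
/-- The letters commute up to nonzero scalars and words of smaller weight. -/
def QComm (x : I → R) (w : I → ℕ) : Prop :=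
  ∀ i j, ∃ c : K, c ≠ 0 ∧ x i * x j - c • (x j * x i) ∈ lowSpan K x w 2 (w i + w j)

variable (K) in
/-- The leading part of `f` is a nonzero multiple of a word with content `a`. -/
def HasLead (x : I → R) (w : I → ℕ) (f : R) (a : Multiset I) : Prop :=
  ∃ c : K, c ≠ 0 ∧ ∃ l : List I, (l : Multiset I) = a ∧
    f - c • wordProd x l ∈ lowSpan K x w a.card (wordWt w a)

variable {x : I → R} {w : I → ℕ}

@[simp] lemma wordProd_nil : wordProd x [] = 1 := rfl

@[simp] lemma wordProd_cons (i : I) (l : List I) : wordProd x (i :: l) = x i * wordProd x l := by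
  simp [wordProd]

@[simp] lemma wordProd_append (l l' : List I) :
    wordProd x (l ++ l') = wordProd x l * wordProd x l' := by
  simp [wordProd]

lemma wordProd_singleton (i : I) : wordProd x [i] = x i := by simp

@[simp] lemma wordWt_zero : wordWt w 0 = 0 := rfl

@[simp] lemma wordWt_add (s s' : Multiset I) : wordWt w (s + s') = wordWt w s + wordWt w s' := by
  simp [wordWt]

@[simp] lemma wordWt_cons (i : I) (s : Multiset I) : wordWt w (i ::ₘ s) = w i + wordWt w s := by
  simp [wordWt]

lemma wordWt_append (l l' : List I) :
    wordWt w ((l ++ l' : List I) : Multiset I) = wordWt w l + wordWt w l' := by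
  rw [← Multiset.coe_add, wordWt_add]

lemma wordWt_list_cons (i : I) (l : List I) :
    wordWt w ((i :: l : List I) : Multiset I) = w i + wordWt w l := by
  rw [← Multiset.cons_coe, wordWt_cons]

lemma wordProd_mem_lowSpan {l : List I} {N d : ℕ} (h : l.length = N) (hd : wordWt w l < d) :
    wordProd x l ∈ lowSpan K x w N d :=
  Submodule.subset_span ⟨l, h, hd, rfl⟩

lemma lowSpan_mono {N d d' : ℕ} (h : d ≤ d') : lowSpan K x w N d ≤ lowSpan K x w N d' :=
  Submodule.span_mono fun _ ⟨l, h1, h2, h3⟩ => ⟨l, h1, h2.trans_le h, h3⟩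

lemma mul_mem_lowSpan {N N' d d' : ℕ} {f g : R} (hf : f ∈ lowSpan K x w N (d + 1))
    (hg : g ∈ lowSpan K x w N' d') : f * g ∈ lowSpan K x w (N + N') (d + d') := by
  induction hf using Submodule.span_induction with
  | zero => simp
  | add a b _ _ ha hb => rw [add_mul]; exact add_mem ha hb
  | smul c a _ ha => rw [smul_mul_assoc]; exact Submodule.smul_mem _ _ ha
  | mem a ha =>
    obtain ⟨l, h1, h2, rfl⟩ := ha
    induction hg using Submodule.span_induction with
    | zero => simp
    | add a b _ _ ha hb => rw [mul_add]; exact add_mem ha hb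
    | smul c a _ ha => rw [mul_smul_comm]; exact Submodule.smul_mem _ _ ha
    | mem b hb =>
      obtain ⟨l', h1', h2', rfl⟩ := hb
      rw [← wordProd_append]
      refine wordProd_mem_lowSpan (by simp [h1, h1']) ?_
      rw [wordWt_append]; omega

lemma mul_mem_lowSpan' {N N' d d' : ℕ} {f g : R} (hf : f ∈ lowSpan K x w N d)
    (hg : g ∈ lowSpan K x w N' (d' + 1)) : f * g ∈ lowSpan K x w (N + N') (d + d') := by
  cases d with
  | zero =>
    have : f = 0 := by
      simpa [lowSpan] using hf
    simp [this]
  | succ d =>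
    rw [show d + 1 + d' = d + (d' + 1) by ring]
    exact mul_mem_lowSpan hf hg

lemma wordProd_perm (hx : QComm K x w) {l l' : List I} (h : l.Perm l') :
    ∃ c : K, c ≠ 0 ∧ wordProd x l - c • wordProd x l' ∈ lowSpan K x w l.length (wordWt w l) := by
  induction h with
  | nil => exact ⟨1, one_ne_zero, by simp⟩
  | @cons i l l' h ih =>
    obtain ⟨c, hc, ih⟩ := ih
    refine ⟨c, hc, ?_⟩
    have h1 : x i ∈ lowSpan K x w 1 (w i + 1) := by
      rw [← wordProd_singleton (x := x) i]
      exact wordProd_mem_lowSpan rfl (by simp [wordWt])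
    have := mul_mem_lowSpan h1 ih
    rw [wordWt_list_cons, List.length_cons, add_comm l.length, wordProd_cons, wordProd_cons]
    convert this using 1
    rw [mul_sub, mul_smul_comm]
  | swap i j l =>
    obtain ⟨c, hc, h⟩ := hx j i
    refine ⟨c, hc, ?_⟩
    have h1 : wordProd x l ∈ lowSpan K x w l.length (wordWt w l + 1) :=
      wordProd_mem_lowSpan rfl (by simp)
    have := mul_mem_lowSpan' h h1
    simp only [wordWt_list_cons, List.length_cons, wordProd_cons]
    rw [show l.length + 1 + 1 = 2 + l.length by ring, ← add_assoc]
    convert this using 1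
    rw [sub_mul, smul_mul_assoc, mul_assoc, mul_assoc]
  | @trans l1 l2 l3 h1 h2 ih1 ih2 =>
    obtain ⟨c, hc, ih1⟩ := ih1
    obtain ⟨c', hc', ih2⟩ := ih2
    refine ⟨c * c', mul_ne_zero hc hc', ?_⟩
    have e : wordWt w (l2 : Multiset I) = wordWt w l1 := by
      rw [Multiset.coe_eq_coe.mpr h1]
    rw [e, ← h1.length_eq] at ih2
    convert add_mem ih1 (Submodule.smul_mem _ c ih2) using 1
    rw [smul_sub, smul_smul]; abel

lemma HasLead.word (hx : QComm K x w) {f : R} {a : Multiset I} (h : HasLead K x w f a)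
    {l : List I} (hl : (l : Multiset I) = a) :
    ∃ c : K, c ≠ 0 ∧ f - c • wordProd x l ∈ lowSpan K x w a.card (wordWt w a) := by
  obtain ⟨c, hc, l', hl', h⟩ := h
  obtain ⟨c', hc', h'⟩ := wordProd_perm hx (Multiset.coe_eq_coe.mp (hl'.trans hl.symm))
  refine ⟨c * c', mul_ne_zero hc hc', ?_⟩
  rw [hl', ← Multiset.coe_card, hl'] at h'
  convert add_mem h (Submodule.smul_mem _ c h') using 1
  rw [smul_sub, smul_smul]; abel

lemma hasLead_wordProd (l : List I) : HasLead K x w (wordProd x l) l :=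
  ⟨1, one_ne_zero, l, rfl, by simp⟩

lemma HasLead.mul {f g : R} {a b : Multiset I} (hf : HasLead K x w f a)
    (hg : HasLead K x w g b) : HasLead K x w (f * g) (a + b) := by
  obtain ⟨c, hc, l, hl, hf⟩ := hf
  obtain ⟨c', hc', l', hl', hg⟩ := hg
  refine ⟨c * c', mul_ne_zero hc hc', l ++ l', by rw [← hl, ← hl', Multiset.coe_add], ?_⟩
  have h1 : c • wordProd x l ∈ lowSpan K x w a.card (wordWt w a + 1) :=
    Submodule.smul_mem _ _ (wordProd_mem_lowSpan (by rw [← hl, Multiset.coe_card])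
      (by rw [hl]; simp))
  have h2 : c' • wordProd x l' ∈ lowSpan K x w b.card (wordWt w b + 1) :=
    Submodule.smul_mem _ _
      (wordProd_mem_lowSpan (by rw [← hl', Multiset.coe_card]) (by rw [hl']; simp))
  rw [Multiset.card_add, wordWt_add]
  have hg' := add_mem (lowSpan_mono (Nat.le_succ _) hg) h2
  rw [sub_add_cancel] at hg'
  convert add_mem (mul_mem_lowSpan' hf hg') (mul_mem_lowSpan h1 hg) using 1
  rw [wordProd_append, sub_mul, mul_sub, smul_mul_smul_comm]
  abel

lemma span_words_eq_top (h : Algebra.adjoin K (Set.range x) = ⊤) :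
    Submodule.span K (Set.range (wordProd x)) = ⊤ := by
  rw [eq_top_iff, ← Algebra.top_toSubmodule, ← h, Algebra.adjoin_eq_span]
  refine Submodule.span_mono fun y hy => ?_
  induction hy using Submonoid.closure_induction with
  | mem y hy => obtain ⟨i, rfl⟩ := hy; exact ⟨[i], by simp⟩
  | one => exact ⟨[], rfl⟩
  | mul y z _ _ hy hz =>
    obtain ⟨l, rfl⟩ := hy
    obtain ⟨l', rfl⟩ := hz
    exact ⟨l ++ l', by simp⟩

/-- Words in a fixed order span as soon as all words do. -/
lemma span_rep_eq_top (hx : QComm K x w) (h : Algebra.adjoin K (Set.range x) = ⊤)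
    (rep : Multiset I → List I) (hrep : ∀ s, (rep s : Multiset I) = s) :
    Submodule.span K (Set.range fun s => wordProd x (rep s)) = ⊤ := by
  rw [eq_top_iff, ← span_words_eq_top h, Submodule.span_le]
  rintro _ ⟨l, rfl⟩
  suffices ∀ d, ∀ l : List I, wordWt w l < d →
      wordProd x l ∈ Submodule.span K (Set.range fun s => wordProd x (rep s)) from
    this _ l (Nat.lt_succ_self _)
  intro d
  induction d with
  | zero => intro l hl; simp at hl
  | succ d ih =>
    intro l hl
    obtain ⟨c, -, hc⟩ := wordProd_perm hx
      (Multiset.coe_eq_coe.mp (hrep (l : Multiset I)).symm)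
    have h1 : lowSpan K x w l.length (wordWt w l) ≤
        Submodule.span K (Set.range fun s => wordProd x (rep s)) := by
      refine Submodule.span_le.mpr ?_
      rintro _ ⟨l', -, h2, rfl⟩
      exact ih l' (by omega)
    have h2 : wordProd x (rep l) ∈ Submodule.span K (Set.range fun s => wordProd x (rep s)) :=
      Submodule.subset_span ⟨_, rfl⟩
    have := add_mem (h1 hc) (Submodule.smul_mem _ c h2)
    rwa [sub_add_cancel] at this

variable {b : Module.Basis (Multiset I) K R}

/-- The basis `b` consists of words, one for each content. -/
def IsWordBasis (x : I → R) (b : Module.Basis (Multiset I) K R) : Prop :=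
  ∀ s, ∃ l : List I, (l : Multiset I) = s ∧ b s = wordProd x l

lemma repr_lowSpan (hx : QComm K x w) (hb : IsWordBasis x b) {N d : ℕ} {f : R}
    (hf : f ∈ lowSpan K x w N d) {s : Multiset I} (hs : d ≤ wordWt w s) : b.repr f s = 0 := by
  induction d using Nat.strong_induction_on generalizing N f s with
  | _ d ih =>
  induction hf using Submodule.span_induction with
  | zero => simp
  | add a b _ _ ha hb => simp [ha, hb]
  | smul c a _ ha => simp [ha]
  | mem y hy =>
    obtain ⟨l, -, hd, rfl⟩ := hy
    obtain ⟨l', hl', hbl⟩ := hb (l : Multiset I)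
    obtain ⟨c, -, hc⟩ := wordProd_perm hx (Multiset.coe_eq_coe.mp hl'.symm)
    have := ih _ hd hc (s := s) (by omega)
    have hne : (l : Multiset I) ≠ s := by rintro rfl; omega
    rw [← hbl, map_sub, map_smul, Finsupp.sub_apply, Finsupp.smul_apply, b.repr_self,
      Finsupp.single_eq_of_ne hne.symm, smul_zero, sub_zero] at this
    exact this

lemma HasLead.repr_eq_zero (hx : QComm K x w) (hb : IsWordBasis x b) {f : R} {a s : Multiset I}
    (hf : HasLead K x w f a) (hs : s ≠ a) (hw : wordWt w a ≤ wordWt w s) : b.repr f s = 0 := by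
  obtain ⟨l, hl, hbl⟩ := hb a
  obtain ⟨c, hc, h⟩ := hf.word hx hl
  have := repr_lowSpan hx hb h hw
  rwa [← hbl, map_sub, map_smul, Finsupp.sub_apply, Finsupp.smul_apply, b.repr_self,
      Finsupp.single_eq_of_ne hs, smul_zero, sub_zero] at this

lemma HasLead.repr_ne_zero (hx : QComm K x w) (hb : IsWordBasis x b) {f : R} {a : Multiset I}
    (hf : HasLead K x w f a) : b.repr f a ≠ 0 := by
  obtain ⟨l, hl, hbl⟩ := hb a
  obtain ⟨c, hc, h⟩ := hf.word hx hl
  have := repr_lowSpan hx hb h le_rfl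
  rw [← hbl, map_sub, map_smul, Finsupp.sub_apply, Finsupp.smul_apply, b.repr_self,
      Finsupp.single_eq_same, sub_eq_zero] at this
  rw [this]; simpa using hc

section Families

variable {ι : Type*} {f : ι → R} {e : ι → Multiset I}

/-- The coefficient of a linear combination at the leading content of a summand of maximal
weight does not vanish. -/
lemma repr_linearCombination_ne_zero (hx : QComm K x w) (hb : IsWordBasis x b)
    (he : Function.Injective e) (hf : ∀ i, HasLead K x w (f i) (e i)) (c : ι →₀ K) {i : ι}
    (hi : c i ≠ 0) (hmax : ∀ j, c j ≠ 0 → wordWt w (e j) ≤ wordWt w (e i)) :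
    b.repr (Finsupp.linearCombination K f c) (e i) ≠ 0 := by
  rw [Finsupp.linearCombination_apply, Finsupp.sum, map_sum, Finsupp.finsetSum_apply,
    Finset.sum_eq_single i]
  · simpa [hi] using (hf i).repr_ne_zero hx hb
  · intro j hj hji
    have := (hf j).repr_eq_zero hx hb (s := e i) (fun h => hji (he h).symm)
      (hmax j (by simpa using hj))
    simp [this]
  · intro h; simp at h; exact absurd h hi

lemma exists_max_weight (c : ι →₀ K) (hc : c ≠ 0) (e : ι → Multiset I) :
    ∃ i, c i ≠ 0 ∧ ∀ j, c j ≠ 0 → wordWt w (e j) ≤ wordWt w (e i) := by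
  obtain ⟨i, hi, h⟩ := c.support.exists_max_image (fun i => wordWt w (e i))
    (Finsupp.support_nonempty_iff.mpr hc)
  exact ⟨i, by simpa using hi, fun j hj => h j (by simpa using hj)⟩

lemma linearIndependent_of_hasLead (hx : QComm K x w) (hb : IsWordBasis x b)
    (he : Function.Injective e) (hf : ∀ i, HasLead K x w (f i) (e i)) :
    LinearIndependent K f := by
  rw [linearIndependent_iff]
  intro c hc
  by_contra hne
  obtain ⟨i, hi, hmax⟩ := exists_max_weight (w := w) c hne e
  exact repr_linearCombination_ne_zero hx hb he hf c hi hmax (by simp [hc])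

/-- The contents of top weight occurring in a linear combination of elements with distinct leading
contents are among these leading contents. -/
lemma exists_eq_of_repr_ne_zero (hx : QComm K x w) (hb : IsWordBasis x b)
    (he : Function.Injective e) (hf : ∀ i, HasLead K x w (f i) (e i)) {z : R}
    (hz : z ∈ Submodule.span K (Set.range f)) {s : Multiset I}
    (hs : ∀ s', wordWt w s < wordWt w s' → b.repr z s' = 0) (hzs : b.repr z s ≠ 0) :
    ∃ i, e i = s := by
  obtain ⟨c, rfl⟩ := (Finsupp.mem_span_range_iff_exists_finsupp).mp hz
  change ∀ s', _ → b.repr (Finsupp.linearCombination K f c) s' = 0 at hs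
  change b.repr (Finsupp.linearCombination K f c) s ≠ 0 at hzs
  have hne : c ≠ 0 := by rintro rfl; simp at hzs
  obtain ⟨i, hi, hmax⟩ := exists_max_weight (w := w) c hne e
  have hle : wordWt w (e i) ≤ wordWt w s := by
    by_contra! h
    exact repr_linearCombination_ne_zero hx hb he hf c hi hmax (hs _ h)
  by_contra! hall
  apply hzs
  rw [Finsupp.linearCombination_apply, Finsupp.sum, map_sum, Finsupp.finsetSum_apply]
  refine Finset.sum_eq_zero fun j hj => ?_
  have := (hf j).repr_eq_zero hx hb (s := s) (hall j).symm
    ((hmax j (by simpa using hj)).trans hle)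
  simp [this]

end Families

end Words

section PBW

variable (K : Type) [Field K] (q : K)

/-- The quantum matrix relations among the cells satisfying `S`. -/
inductive CellRel (S : ℕ → ℕ → Prop) :
    FreeAlgebra K (ℕ × ℕ) → FreeAlgebra K (ℕ × ℕ) → Prop
  | row {i j k : ℕ} (h : j < k) (h1 : S i j) (h2 : S i k) :
      CellRel S (FreeAlgebra.ι K (i, j) * FreeAlgebra.ι K (i, k))
        (q • (FreeAlgebra.ι K (i, k) * FreeAlgebra.ι K (i, j)))
  | col {i k j : ℕ} (h : i < k) (h1 : S i j) (h2 : S k j) :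
      CellRel S (FreeAlgebra.ι K (i, j) * FreeAlgebra.ι K (k, j))
        (q • (FreeAlgebra.ι K (k, j) * FreeAlgebra.ι K (i, j)))
  | comm {i k j l : ℕ} (h1 : i < k) (h2 : l < j) (h3 : S i j) (h4 : S k l) :
      CellRel S (FreeAlgebra.ι K (i, j) * FreeAlgebra.ι K (k, l))
        (FreeAlgebra.ι K (k, l) * FreeAlgebra.ι K (i, j))
  | quantum {i k j l : ℕ} (h1 : i < k) (h2 : j < l) (h3 : S i j) (h4 : S k l) (h5 : S i l)
      (h6 : S k j) :
      CellRel S (FreeAlgebra.ι K (i, j) * FreeAlgebra.ι K (k, l))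
        (FreeAlgebra.ι K (k, l) * FreeAlgebra.ι K (i, j) +
          (q - q⁻¹) • (FreeAlgebra.ι K (i, l) * FreeAlgebra.ι K (k, j)))

/-- The algebra with the quantum matrix relations among the cells satisfying `S`. -/
abbrev CellAlg (S : ℕ → ℕ → Prop) := RingQuot (CellRel K q S)

/-- The generators of `CellAlg`. -/
def cellGen (S : ℕ → ℕ → Prop) (i j : ℕ) : CellAlg K q S :=
  RingQuot.mkAlgHom K (CellRel K q S) (FreeAlgebra.ι K (i, j))

/-- The cells of the first `v` columns preceding the cell `(k, l)` in row-major order. -/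
def cellsBefore (v k l : ℕ) (i j : ℕ) : Prop := j < v ∧ (i < k ∨ i = k ∧ j < l)

variable {K q}

section rules

variable {S : ℕ → ℕ → Prop}

lemma cellGen_row {i j k : ℕ} (hq : q ≠ 0) (h : j < k) (h1 : S i j) (h2 : S i k) :
    cellGen K q S i k * cellGen K q S i j = q⁻¹ • (cellGen K q S i j * cellGen K q S i k) := by
  have := RingQuot.mkAlgHom_rel K (CellRel.row (q := q) h h1 h2)
  simp only [map_mul, map_smul] at this
  simp only [cellGen, this, smul_smul, inv_mul_cancel₀ hq, one_smul]

lemma cellGen_col {i k j : ℕ} (hq : q ≠ 0) (h : i < k) (h1 : S i j) (h2 : S k j) :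
    cellGen K q S k j * cellGen K q S i j = q⁻¹ • (cellGen K q S i j * cellGen K q S k j) := by
  have := RingQuot.mkAlgHom_rel K (CellRel.col (q := q) h h1 h2)
  simp only [map_mul, map_smul] at this
  simp only [cellGen, this, smul_smul, inv_mul_cancel₀ hq, one_smul]

lemma cellGen_comm {i k j l : ℕ} (h1 : i < k) (h2 : l < j) (h3 : S i j) (h4 : S k l) :
    cellGen K q S k l * cellGen K q S i j =
      (1 : K) • (cellGen K q S i j * cellGen K q S k l) := by
  rw [one_smul]
  have := RingQuot.mkAlgHom_rel K (CellRel.comm (q := q) h1 h2 h3 h4)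
  simp only [map_mul] at this
  exact this.symm

lemma cellGen_quantum {i k j l : ℕ} (h1 : i < k) (h2 : j < l) (h3 : S i j) (h4 : S k l)
    (h5 : S i l) (h6 : S k j) :
    cellGen K q S k l * cellGen K q S i j = cellGen K q S i j * cellGen K q S k l +
      (q⁻¹ - q) • (cellGen K q S i l * cellGen K q S k j) := by
  have := RingQuot.mkAlgHom_rel K (CellRel.quantum (q := q) h1 h2 h3 h4 h5 h6)
  simp only [map_mul, map_add, map_smul] at this
  simp only [cellGen, this, add_assoc, ← add_smul, sub_add_sub_cancel, sub_self, zero_smul,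
    add_zero]

lemma cellGen_row' {i j k : ℕ} (hq : q ≠ 0) (h : j < k) (h1 : S i j) (h2 : S i k)
    (z : CellAlg K q S) :
    cellGen K q S i k * (cellGen K q S i j * z) =
      q⁻¹ • (cellGen K q S i j * (cellGen K q S i k * z)) := by
  rw [← mul_assoc, cellGen_row hq h h1 h2, smul_mul_assoc, mul_assoc]

lemma cellGen_col' {i k j : ℕ} (hq : q ≠ 0) (h : i < k) (h1 : S i j) (h2 : S k j)
    (z : CellAlg K q S) :
    cellGen K q S k j * (cellGen K q S i j * z) =
      q⁻¹ • (cellGen K q S i j * (cellGen K q S k j * z)) := by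
  rw [← mul_assoc, cellGen_col hq h h1 h2, smul_mul_assoc, mul_assoc]

lemma cellGen_comm' {i k j l : ℕ} (h1 : i < k) (h2 : l < j) (h3 : S i j) (h4 : S k l)
    (z : CellAlg K q S) :
    cellGen K q S k l * (cellGen K q S i j * z) =
      (1 : K) • (cellGen K q S i j * (cellGen K q S k l * z)) := by
  rw [← mul_assoc, cellGen_comm h1 h2 h3 h4, smul_mul_assoc, mul_assoc]

lemma cellGen_quantum' {i k j l : ℕ} (h1 : i < k) (h2 : j < l) (h3 : S i j) (h4 : S k l)
    (h5 : S i l) (h6 : S k j) (z : CellAlg K q S) :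
    cellGen K q S k l * (cellGen K q S i j * z) = cellGen K q S i j * (cellGen K q S k l * z) +
      (q⁻¹ - q) • (cellGen K q S i l * (cellGen K q S k j * z)) := by
  rw [← mul_assoc, cellGen_quantum h1 h2 h3 h4 h5 h6, add_mul, smul_mul_assoc, mul_assoc, mul_assoc]

end rules

variable (v k l : ℕ)

variable (q) in
/-- The scalar by which the cell `(k, l)` skew-commutes with the cell `(i, j)`. -/
def skewCoeff (k l i j : ℕ) : K := if i = k ∨ j = l then q⁻¹ else 1

lemma skewCoeff_row (j : ℕ) : skewCoeff q k l k j = q⁻¹ := by simp [skewCoeff]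

lemma skewCoeff_col (i : ℕ) : skewCoeff q k l i l = q⁻¹ := by simp [skewCoeff]

lemma skewCoeff_ne {i j : ℕ} (hi : i ≠ k) (hj : j ≠ l) : skewCoeff q k l i j = 1 := by
  simp [skewCoeff, hi, hj]

variable (K q) in
/-- The skew derivation attached to the cell `(k, l)`, on generators. -/
def skewDer (i j : ℕ) : CellAlg K q (cellsBefore v k l) :=
  if i < k ∧ j < l then (q⁻¹ - q) • (cellGen K q _ i l * cellGen K q _ k j) else 0

lemma skewDer_pos {i j : ℕ} (hi : i < k) (hj : j < l) : skewDer K q v k l i j =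
    (q⁻¹ - q) • (cellGen K q _ i l * cellGen K q _ k j) := by
  simp [skewDer, hi, hj]

lemma skewDer_neg {i j : ℕ} (h : k ≤ i ∨ l ≤ j) : skewDer K q v k l i j = 0 := by
  rw [skewDer, if_neg (by omega)]

variable (K q) in
/-- The upper triangular matrix recording the skew derivation, on the free algebra. -/
def skewFree : FreeAlgebra K (ℕ × ℕ) →ₐ[K]
    Matrix (Fin 2) (Fin 2) (CellAlg K q (cellsBefore v k l)) :=
  FreeAlgebra.lift K fun c => !![skewCoeff q k l c.1 c.2 • cellGen K q _ c.1 c.2,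
    skewDer K q v k l c.1 c.2; 0, cellGen K q _ c.1 c.2]

variable {v l}

lemma skewFree_rel (hq : q ≠ 0) (hl : l < v) {a b : FreeAlgebra K (ℕ × ℕ)}
    (h : CellRel K q (cellsBefore v k l) a b) :
    skewFree K q v k l a = skewFree K q v k l b := by
  have e : ∀ {a b c d e f g h : CellAlg K q (cellsBefore v k l)}, a = e → b = f → c = g → d = h →
    !![a, b; c, d] = !![e, f; g, h] := by rintro _ _ _ _ _ _ _ _ rfl rfl rfl rfl; rfl
  cases h with
  | @row i j j' h h1 h2 =>
    simp only [map_mul, map_smul, skewFree, FreeAlgebra.lift_ι_apply, Matrix.mul_fin_two,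
      Matrix.smul_of, Matrix.smul_cons, Matrix.smul_empty]
    unfold cellsBefore at h1 h2
    obtain hi | rfl : i < k ∨ k = i := by omega
    all_goals
      rcases lt_trichotomy l j with hj | rfl | hj <;>
      rcases lt_trichotomy l j' with hj' | rfl | hj' <;>
      first
      | (exfalso; omega)
      | (apply e <;>
          simp (disch := first | assumption | (unfold cellsBefore; omega) | omega) only
            [skewCoeff_row, skewCoeff_col, skewCoeff_ne, skewDer_pos, skewDer_neg,
            mul_add, add_mul, smul_add, one_smul, zero_add, add_zero, smul_mul_assoc,
            mul_smul_comm, mul_assoc, cellGen_row, cellGen_col,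
            cellGen_comm, cellGen_quantum, cellGen_row', cellGen_col', cellGen_comm',
            cellGen_quantum', mul_zero, zero_mul, smul_zero] <;>
          (try match_scalars) <;> (try field_simp) <;> (try ring))
  | @col i i' j h h1 h2 =>
    simp only [map_mul, map_add, map_smul, skewFree, FreeAlgebra.lift_ι_apply, Matrix.mul_fin_two,
      Matrix.smul_of, Matrix.smul_cons, Matrix.smul_empty, Matrix.of_add_of, Matrix.add_cons,
      Matrix.cons_add_cons, Matrix.empty_add_empty, Matrix.head_cons, Matrix.tail_cons]
    unfold cellsBefore at h1 h2
    have hi : i < k := by omega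
    obtain hi' | rfl : i' < k ∨ k = i' := by omega
    all_goals
      rcases lt_trichotomy l j with hj | rfl | hj <;>
      first
      | (exfalso; omega)
      | (apply e <;>
          simp (disch := first | assumption | (unfold cellsBefore; omega) | omega) only
            [skewCoeff_row, skewCoeff_col, skewCoeff_ne, skewDer_pos, skewDer_neg,
            mul_add, add_mul, smul_add, one_smul, zero_add, add_zero, smul_mul_assoc,
            mul_smul_comm, mul_assoc, cellGen_row, cellGen_col,
            cellGen_comm, cellGen_quantum, cellGen_row', cellGen_col', cellGen_comm',
            cellGen_quantum', mul_zero, zero_mul, smul_zero] <;>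
          (try match_scalars) <;> (try field_simp) <;> (try ring))
  | @comm i i' j j' h h' h1 h2 =>
    simp only [map_mul, map_add, map_smul, skewFree, FreeAlgebra.lift_ι_apply, Matrix.mul_fin_two,
      Matrix.smul_of, Matrix.smul_cons, Matrix.smul_empty, Matrix.of_add_of, Matrix.add_cons,
      Matrix.cons_add_cons, Matrix.empty_add_empty, Matrix.head_cons, Matrix.tail_cons]
    unfold cellsBefore at h1 h2
    have hi : i < k := by omega
    obtain hi' | rfl : i' < k ∨ k = i' := by omega
    all_goals
      rcases lt_trichotomy l j with hj | rfl | hj <;>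
      rcases lt_trichotomy l j' with hj' | rfl | hj' <;>
      first
      | (exfalso; omega)
      | (apply e <;>
          simp (disch := first | assumption | (unfold cellsBefore; omega) | omega) only
            [skewCoeff_row, skewCoeff_col, skewCoeff_ne, skewDer_pos, skewDer_neg,
            mul_add, add_mul, smul_add, one_smul, zero_add, add_zero, smul_mul_assoc,
            mul_smul_comm, mul_assoc, cellGen_row, cellGen_col,
            cellGen_comm, cellGen_quantum, cellGen_row', cellGen_col', cellGen_comm',
            cellGen_quantum', mul_zero, zero_mul, smul_zero] <;>
          (try match_scalars) <;> (try field_simp))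
  | @quantum i i' j j' h h' h1 h2 h3 h4 =>
    simp only [map_mul, map_add, map_smul, skewFree, FreeAlgebra.lift_ι_apply, Matrix.mul_fin_two,
      Matrix.smul_of, Matrix.smul_cons, Matrix.smul_empty, Matrix.of_add_of, Matrix.add_cons,
      Matrix.cons_add_cons, Matrix.empty_add_empty, Matrix.head_cons, Matrix.tail_cons]
    unfold cellsBefore at h1 h2 h3 h4
    have hi : i < k := by omega
    obtain hi' | rfl : i' < k ∨ k = i' := by omega
    all_goals
      rcases lt_trichotomy l j with hj | rfl | hj <;>
      rcases lt_trichotomy l j' with hj' | rfl | hj' <;>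
      first
      | (exfalso; omega)
      | (apply e <;>
          simp (disch := first | assumption | (unfold cellsBefore; omega) | omega) only
            [skewCoeff_row, skewCoeff_col, skewCoeff_ne, skewDer_pos, skewDer_neg,
            mul_add, add_mul, smul_add, one_smul, zero_add, add_zero, smul_mul_assoc,
            mul_smul_comm, mul_assoc, cellGen_row, cellGen_col,
            cellGen_comm, cellGen_quantum, cellGen_row', cellGen_col', cellGen_comm',
            cellGen_quantum', mul_zero, zero_mul, smul_zero] <;>
          (try match_scalars) <;> (try field_simp) <;> (try ring))

end PBW

section PBW

variable {K : Type} [Field K] {q : K} {v k l : ℕ}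

/-- The upper triangular matrix recording the skew derivation. -/
def skewHom (hq : q ≠ 0) (hl : l < v) : CellAlg K q (cellsBefore v k l) →ₐ[K]
    Matrix (Fin 2) (Fin 2) (CellAlg K q (cellsBefore v k l)) :=
  RingQuot.liftAlgHom K ⟨skewFree K q v k l, fun _ _ h => skewFree_rel k hq hl h⟩

lemma skewHom_gen (hq : q ≠ 0) (hl : l < v) (i j : ℕ) :
    skewHom hq hl (cellGen K q (cellsBefore v k l) i j) =
      !![skewCoeff q k l i j • cellGen K q _ i j, skewDer K q v k l i j;
        0, cellGen K q _ i j] := by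
  rw [skewHom, cellGen, RingQuot.liftAlgHom_mkAlgHom_apply]
  simp [skewFree, cellGen]

lemma skewHom_lower (hq : q ≠ 0) (hl : l < v) (b : CellAlg K q (cellsBefore v k l)) :
    skewHom hq hl b 1 0 = 0 ∧ skewHom hq hl b 1 1 = b := by
  obtain ⟨b, rfl⟩ := RingQuot.mkAlgHom_surjective K _ b
  induction b using FreeAlgebra.induction with
  | grade0 r => simp [Matrix.algebraMap_matrix_apply]
  | grade1 c =>
    have := skewHom_gen (K := K) (k := k) hq hl c.1 c.2
    rw [cellGen, Prod.mk.eta] at this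
    rw [this]
    simp
  | mul a b ha hb =>
    simp [Matrix.mul_apply, ha, hb]
  | add a b ha hb => simp [ha, hb]

/-- An entry of the matrix `skewHom` as a linear map. -/
def skewEntry (hq : q ≠ 0) (hl : l < v) (a b : Fin 2) :
    CellAlg K q (cellsBefore v k l) →ₗ[K] CellAlg K q (cellsBefore v k l) :=
  LinearMap.proj b ∘ₗ LinearMap.proj a ∘ₗ (Matrix.ofLinearEquiv K).symm.toLinearMap ∘ₗ
    (skewHom hq hl).toLinearMap

/-- Multiplication by the new variable on an Ore extension. -/
def oreVar (hq : q ≠ 0) (hl : l < v) :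
    Module.End K (ℕ →₀ CellAlg K q (cellsBefore v k l)) :=
  Finsupp.lsum K fun p => Finsupp.lsingle (p + 1) ∘ₗ skewEntry hq hl 0 0 +
    Finsupp.lsingle p ∘ₗ skewEntry hq hl 0 1

/-- Left multiplication by coefficients on an Ore extension. -/
def oreCoeff (a : CellAlg K q (cellsBefore v k l)) :
    Module.End K (ℕ →₀ CellAlg K q (cellsBefore v k l)) :=
  Finsupp.mapRange.linearMap (LinearMap.mulLeft K a)

lemma oreCoeff_single (a b : CellAlg K q (cellsBefore v k l)) (p : ℕ) :
    oreCoeff a (Finsupp.single p b) = Finsupp.single p (a * b) := by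
  simp [oreCoeff]

lemma oreVar_single (hq : q ≠ 0) (hl : l < v) (b : CellAlg K q (cellsBefore v k l)) (p : ℕ) :
    oreVar hq hl (Finsupp.single p b) =
      Finsupp.single (p + 1) (skewHom hq hl b 0 0) + Finsupp.single p (skewHom hq hl b 0 1) := by
  simp [oreVar, skewEntry]

variable (K q v k l) in
/-- The action of the generators on an Ore extension. -/
def oreFree (hq : q ≠ 0) (hl : l < v) : FreeAlgebra K (ℕ × ℕ) →ₐ[K]
    Module.End K (ℕ →₀ CellAlg K q (cellsBefore v k l)) :=
  FreeAlgebra.lift K fun c => if c = (k, l) then oreVar hq hl else oreCoeff (cellGen K q _ c.1 c.2)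

lemma oreVar_mul_oreCoeff (hq : q ≠ 0) (hl : l < v) (i j : ℕ) :
    oreVar hq hl * oreCoeff (cellGen K q (cellsBefore v k l) i j) =
      skewCoeff q k l i j • (oreCoeff (cellGen K q _ i j) * oreVar hq hl) +
      oreCoeff (skewDer K q v k l i j) := by
  refine Finsupp.lhom_ext fun p b => ?_
  simp only [Module.End.mul_apply, LinearMap.add_apply, LinearMap.smul_apply, oreCoeff_single,
    oreVar_single, map_mul, skewHom_gen, map_add, Matrix.mul_apply, Fin.sum_univ_two,
      skewHom_lower, Finsupp.smul_single,
    smul_add, Matrix.of_apply, Matrix.cons_val_zero, Matrix.cons_val_one, Finsupp.single_add,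
    mul_zero, add_zero, add_assoc, smul_mul_assoc]

lemma oreCoeff_mul (a b : CellAlg K q (cellsBefore v k l)) :
    oreCoeff (a * b) = oreCoeff a * oreCoeff b := by
  refine Finsupp.lhom_ext fun p c => ?_
  simp only [Module.End.mul_apply, oreCoeff_single, mul_assoc]

lemma oreCoeff_smul (c : K) (a : CellAlg K q (cellsBefore v k l)) :
    oreCoeff (c • a) = c • oreCoeff a := by
  refine Finsupp.lhom_ext fun p b => ?_
  rw [LinearMap.smul_apply, oreCoeff_single, oreCoeff_single, Finsupp.smul_single, smul_mul_assoc]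

lemma oreCoeff_zero : oreCoeff (0 : CellAlg K q (cellsBefore v k l)) = 0 := by
  simpa using oreCoeff_smul (0 : K) (0 : CellAlg K q (cellsBefore v k l))

lemma oreCoeff_add (a b : CellAlg K q (cellsBefore v k l)) :
    oreCoeff (a + b) = oreCoeff a + oreCoeff b := by
  refine Finsupp.lhom_ext fun p c => ?_
  simp [oreCoeff_single, add_mul]

lemma oreFree_rel (hq : q ≠ 0) (hl : l < v) {a b : FreeAlgebra K (ℕ × ℕ)}
    (h : CellRel K q (cellsBefore v k (l + 1)) a b) :
    oreFree K q v k l hq hl a = oreFree K q v k l hq hl b := by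
  cases h with
  | @row i j j' h h1 h2 =>
    unfold cellsBefore at h1 h2
    have e1 : ¬ ((i, j) = (k, l)) := by simp only [Prod.mk.injEq]; omega
    simp only [map_mul, map_smul, oreFree, FreeAlgebra.lift_ι_apply, if_neg e1]
    by_cases e2 : (i, j') = (k, l)
    · obtain ⟨rfl, rfl⟩ := Prod.mk.inj e2
      rw [if_pos rfl, oreVar_mul_oreCoeff, skewCoeff_row, skewDer_neg _ _ _ (by omega), smul_add,
        smul_smul, mul_inv_cancel₀ hq, one_smul, oreCoeff_zero, smul_zero, add_zero]
    · simp only [Prod.mk.injEq] at e1 e2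
      simp only [Prod.mk.injEq, if_neg e2]
      rw [← oreCoeff_mul, ← oreCoeff_mul, cellGen_row hq h ?_ ?_, ← oreCoeff_smul, smul_smul,
        mul_inv_cancel₀ hq, one_smul] <;>
      · unfold cellsBefore; omega
  | @col i i' j h h1 h2 =>
    unfold cellsBefore at h1 h2
    have e1 : ¬ ((i, j) = (k, l)) := by simp only [Prod.mk.injEq]; omega
    simp only [map_mul, map_smul, oreFree, FreeAlgebra.lift_ι_apply, if_neg e1]
    by_cases e2 : (i', j) = (k, l)
    · obtain ⟨rfl, rfl⟩ := Prod.mk.inj e2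
      rw [if_pos rfl, oreVar_mul_oreCoeff, skewCoeff_col, skewDer_neg _ _ _ (by omega), smul_add,
        smul_smul, mul_inv_cancel₀ hq, one_smul, oreCoeff_zero, smul_zero, add_zero]
    · simp only [Prod.mk.injEq] at e1 e2
      simp only [Prod.mk.injEq, if_neg e2]
      rw [← oreCoeff_mul, ← oreCoeff_mul, cellGen_col hq h ?_ ?_, ← oreCoeff_smul, smul_smul,
        mul_inv_cancel₀ hq, one_smul] <;>
      · unfold cellsBefore; omega
  | @comm i i' j j' h h' h1 h2 =>
    unfold cellsBefore at h1 h2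
    have e1 : ¬ ((i, j) = (k, l)) := by simp only [Prod.mk.injEq]; omega
    simp only [map_mul, oreFree, FreeAlgebra.lift_ι_apply, if_neg e1]
    by_cases e2 : (i', j') = (k, l)
    · obtain ⟨rfl, rfl⟩ := Prod.mk.inj e2
      rw [if_pos rfl, oreVar_mul_oreCoeff, skewCoeff_ne _ _ (by omega) (by omega),
        skewDer_neg _ _ _ (by omega), one_smul, oreCoeff_zero, add_zero]
    · simp only [Prod.mk.injEq] at e1 e2
      simp only [Prod.mk.injEq, if_neg e2]
      rw [← oreCoeff_mul, ← oreCoeff_mul, cellGen_comm h h' ?_ ?_, one_smul] <;>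
      · unfold cellsBefore; omega
  | @quantum i i' j j' h h' h1 h2 h3 h4 =>
    unfold cellsBefore at h1 h2 h3 h4
    have e1 : ¬ ((i, j) = (k, l)) := by simp only [Prod.mk.injEq]; omega
    have e3 : ¬ ((i, j') = (k, l)) := by simp only [Prod.mk.injEq]; omega
    have e4 : ¬ ((i', j) = (k, l)) := by simp only [Prod.mk.injEq]; omega
    simp only [map_mul, map_add, map_smul, oreFree, FreeAlgebra.lift_ι_apply, if_neg e1,
      if_neg e3, if_neg e4]
    by_cases e2 : (i', j') = (k, l)
    · obtain ⟨rfl, rfl⟩ := Prod.mk.inj e2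
      rw [if_pos rfl, oreVar_mul_oreCoeff, skewCoeff_ne _ _ (by omega) (by omega),
        skewDer_pos _ _ _ (by omega) (by omega), one_smul, oreCoeff_smul, ← oreCoeff_mul,
        add_assoc, ← add_smul, sub_add_sub_cancel, sub_self, zero_smul, add_zero]
    · simp only [Prod.mk.injEq] at e1 e2
      simp only [Prod.mk.injEq, if_neg e2]
      rw [← oreCoeff_mul, ← oreCoeff_mul, ← oreCoeff_mul, cellGen_quantum h h' ?_ ?_ ?_ ?_,
        ← oreCoeff_smul, ← oreCoeff_add, add_assoc, ← add_smul, sub_add_sub_cancel, sub_self,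
        zero_smul, add_zero] <;>
      · unfold cellsBefore; omega

/-- The action of the bigger cell algebra on an Ore extension of the smaller one. -/
def oreHom (hq : q ≠ 0) (hl : l < v) : CellAlg K q (cellsBefore v k (l + 1)) →ₐ[K]
    Module.End K (ℕ →₀ CellAlg K q (cellsBefore v k l)) :=
  RingQuot.liftAlgHom K ⟨oreFree K q v k l hq hl, fun _ _ h => oreFree_rel hq hl h⟩

lemma oreHom_gen (hq : q ≠ 0) (hl : l < v) (i j : ℕ) :
    oreHom hq hl (cellGen K q (cellsBefore v k (l + 1)) i j) =
      if (i, j) = (k, l) then oreVar hq hl else oreCoeff (cellGen K q _ i j) := by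
  rw [oreHom, cellGen, RingQuot.liftAlgHom_mkAlgHom_apply]
  simp [oreFree]

lemma oreHom_wordProd (hq : q ≠ 0) (hl : l < v) {L : List (ℕ × ℕ)} (h : (k, l) ∉ L) (p : ℕ)
    (b : CellAlg K q (cellsBefore v k l)) :
    oreHom hq hl (wordProd (fun c => cellGen K q (cellsBefore v k (l + 1)) c.1 c.2) L)
      (Finsupp.single p b) =
      Finsupp.single p (wordProd (fun c => cellGen K q (cellsBefore v k l) c.1 c.2) L * b) := by
  induction L with
  | nil => simp
  | cons c L ih =>
    simp only [List.mem_cons, not_or] at h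
    rw [wordProd_cons, map_mul, Module.End.mul_apply, ih h.2, oreHom_gen,
      if_neg (fun e => h.1 e.symm),
      oreCoeff_single, wordProd_cons, mul_assoc]

lemma oreHom_pow (hq : q ≠ 0) (hl : l < v) (p : ℕ) :
    oreHom hq hl (cellGen K q (cellsBefore v k (l + 1)) k l ^ p) (Finsupp.single 0 1) =
      Finsupp.single p 1 := by
  induction p with
  | zero => simp
  | succ p ih =>
    rw [pow_succ', map_mul, Module.End.mul_apply, ih, oreHom_gen, if_pos rfl, oreVar_single,
      map_one]
    simp

/-- The action of the bigger cell algebra on the unit of the Ore extension. -/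
def oreEval (hq : q ≠ 0) (hl : l < v) : CellAlg K q (cellsBefore v k (l + 1)) →ₗ[K]
    ℕ →₀ CellAlg K q (cellsBefore v k l) where
  toFun a := oreHom hq hl a (Finsupp.single 0 1)
  map_add' a b := by rw [map_add, LinearMap.add_apply]
  map_smul' c a := by rw [map_smul, LinearMap.smul_apply, RingHom.id_apply]

variable (K q) in
/-- The words on the cells satisfying `S`, one for each content, are linearly independent. -/
def CellPBW (S : ℕ → ℕ → Prop) : Prop :=
  ∃ rep : Multiset (ℕ × ℕ) → List (ℕ × ℕ), (∀ s, (rep s : Multiset (ℕ × ℕ)) = s) ∧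
    LinearIndependent K fun s : {s : Multiset (ℕ × ℕ) // ∀ c ∈ s, S c.1 c.2} =>
      wordProd (fun c => cellGen K q S c.1 c.2) (rep s)

lemma linearIndependent_single_nat {M ι : Type*} [AddCommMonoid M] [Module K M] {f : ι → M}
    (hf : LinearIndependent K f) :
    LinearIndependent K fun p : (Σ _ : ℕ, ι) => Finsupp.single p.1 (f p.2) :=
  Finsupp.linearIndependent_single (fun _ => f) fun _ => hf

lemma linearIndependent_of_apply_eq {M M' ι : Type*} [AddCommMonoid M] [Module K M]
    [AddCommMonoid M'] [Module K M'] (f : M →ₗ[K] M') {v : ι → M} {w : ι → M'}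
    (hw : LinearIndependent K w) (h : ∀ i, f (v i) = w i) : LinearIndependent K v :=
  LinearIndependent.of_comp f (by rwa [show f ∘ v = w from funext h])

lemma CellPBW.step (hq : q ≠ 0) (hl : l < v) (h : CellPBW K q (cellsBefore v k l)) :
    CellPBW K q (cellsBefore v k (l + 1)) := by
  obtain ⟨rep, hrep, h⟩ := h
  refine ⟨fun s => rep (s.filter (· ≠ (k, l))) ++ List.replicate (s.count (k, l)) (k, l),
    fun s => ?_, ?_⟩
  · rw [← Multiset.coe_add, hrep, Multiset.coe_replicate, add_comm, ← Multiset.filter_eq',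
      Multiset.filter_add_not]
  · have key := linearIndependent_single_nat h
    have hmem : ∀ s : {s : Multiset (ℕ × ℕ) // ∀ c ∈ s, cellsBefore v k (l + 1) c.1 c.2},
        ∀ c ∈ s.1.filter (· ≠ (k, l)), cellsBefore v k l c.1 c.2 := by
      rintro ⟨s, hs⟩ ⟨i, j⟩ hc
      simp only [Multiset.mem_filter, ne_eq, Prod.mk.injEq] at hc
      have := hs _ hc.1
      unfold cellsBefore at this ⊢
      omega
    have key' := key.comp (fun s : {s : Multiset (ℕ × ℕ) // ∀ c ∈ s,
      cellsBefore v k (l + 1) c.1 c.2} =>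
      ⟨s.1.count (k, l), s.1.filter (· ≠ (k, l)), hmem s⟩) (by
        rintro ⟨s, hs⟩ ⟨s', hs'⟩ h
        simp only [Sigma.mk.injEq, heq_eq_eq, Subtype.mk.injEq] at h
        rw [Subtype.mk.injEq, ← Multiset.filter_add_not (· = (k, l)) s,
          ← Multiset.filter_add_not (· = (k, l)) s', Multiset.filter_eq', Multiset.filter_eq', h.1,
          h.2])
    refine linearIndependent_of_apply_eq (oreEval (k := k) hq hl) key' fun s => ?_
    have hnot : (k, l) ∉ rep (s.1.filter (· ≠ (k, l))) := by
      rw [← Multiset.mem_coe, hrep]; simp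
    have hpow : wordProd (fun c => cellGen K q (cellsBefore v k (l + 1)) c.1 c.2)
        (List.replicate (s.1.count (k, l)) (k, l)) =
          cellGen K q (cellsBefore v k (l + 1)) k l ^ s.1.count (k, l) := by
      simp [wordProd]
    simp only [Function.comp_apply, oreEval, LinearMap.coe_mk, AddHom.coe_mk, wordProd_append,
      map_mul, Module.End.mul_apply, hpow,
      oreHom_pow, oreHom_wordProd hq hl hnot, mul_one]

lemma cellPBW_cellsBefore (hq : q ≠ 0) (v k : ℕ) : CellPBW K q (cellsBefore v k 0) := by
  induction k with
  | zero =>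
    refine ⟨Multiset.toList, Multiset.coe_toList, ?_⟩
    have h0 : ∀ s : {s : Multiset (ℕ × ℕ) // ∀ c ∈ s, cellsBefore v 0 0 c.1 c.2}, s.1 = 0 := by
      rintro ⟨s, hs⟩
      refine Multiset.eq_zero_of_forall_notMem fun c hc => ?_
      have := hs c hc
      unfold cellsBefore at this
      omega
    have : Unique {s : Multiset (ℕ × ℕ) // ∀ c ∈ s, cellsBefore v 0 0 c.1 c.2} :=
      ⟨⟨⟨0, by simp⟩⟩, fun s => Subtype.ext (h0 s)⟩
    let ε : CellAlg K q (cellsBefore v 0 0) →ₐ[K] K :=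
      RingQuot.liftAlgHom K ⟨FreeAlgebra.lift K fun _ => 0, fun a b h => by cases h <;> simp⟩
    have : Nontrivial (CellAlg K q (cellsBefore v 0 0)) := ε.toRingHom.domain_nontrivial
    rw [linearIndependent_unique_iff, h0]
    simp
  | succ k ih =>
    have : ∀ l ≤ v, CellPBW K q (cellsBefore v k l) := by
      intro l
      induction l with
      | zero => exact fun _ => ih
      | succ l ihl => exact fun h => (ihl (by omega)).step hq (by omega)
    have e : cellsBefore v (k + 1) 0 = cellsBefore v k v := by
      ext i j
      unfold cellsBefore
      omega
    rw [e]
    exact this v le_rfl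

/-- The comparison map from the quantum matrix algebra to the cell algebra. -/
def toCellAlg (K : Type) [Field K] (q : K) (u v : ℕ) :
    OqM K q u v →ₐ[K] CellAlg K q (cellsBefore v u 0) :=
  RingQuot.liftAlgHom K ⟨FreeAlgebra.lift K fun c => cellGen K q _ c.1 c.2, fun a b h => by
    have hS : ∀ (i : Fin u) (j : Fin v), cellsBefore v u 0 i j := fun i j => by
      unfold cellsBefore; omega
    cases h with
    | row h =>
      simpa [cellGen] using RingQuot.mkAlgHom_rel K (CellRel.row (q := q) h (hS _ _) (hS _ _))
    | col h =>
      simpa [cellGen] using RingQuot.mkAlgHom_rel K (CellRel.col (q := q) h (hS _ _) (hS _ _))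
    | comm h h' =>
      simpa [cellGen] using RingQuot.mkAlgHom_rel K (CellRel.comm (q := q) h h' (hS _ _) (hS _ _))
    | quantum h h' =>
      simpa [cellGen] using RingQuot.mkAlgHom_rel K
        (CellRel.quantum (q := q) h h' (hS _ _) (hS _ _) (hS _ _) (hS _ _))⟩

lemma toCellAlg_Xg {u v : ℕ} (i : Fin u) (j : Fin v) :
    toCellAlg K q u v (Xg K q i j) = cellGen K q _ i j := by
  rw [toCellAlg, Xg, RingQuot.liftAlgHom_mkAlgHom_apply]
  simp

/-- One ordered monomial for each content gives a linearly independent family of the quantum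
matrix algebra. -/
lemma exists_linearIndependent_wordProd_Xg (hq : q ≠ 0) (u v : ℕ) :
    ∃ rep : Multiset (Fin u × Fin v) → List (Fin u × Fin v), (∀ s, (rep s : Multiset _) = s) ∧
      LinearIndependent K fun s => wordProd (fun c => Xg K q c.1 c.2) (rep s) := by
  obtain ⟨rep, hrep, h⟩ := cellPBW_cellsBefore (K := K) hq v u
  let f : Fin u × Fin v → ℕ × ℕ := Prod.map Fin.val Fin.val
  have hf : Function.Injective f := Fin.val_injective.prodMap Fin.val_injective
  have hr : ∀ s : Multiset (Fin u × Fin v), ∃ l : List (Fin u × Fin v),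
    l.map f = rep (s.map f) := by
    intro s
    have : ∀ c ∈ rep (s.map f), ∃ a, f a = c := by
      intro c hc
      rw [← Multiset.mem_coe, hrep] at hc
      obtain ⟨a, -, ha⟩ := Multiset.mem_map.mp hc
      exact ⟨a, ha⟩
    have h2 : rep (s.map f) ∈ Set.range (List.map f) := by
      rw [Set.range_list_map]; exact this
    exact h2
  choose r hr using hr
  refine ⟨r, fun s => ?_, ?_⟩
  · refine Multiset.map_injective hf ?_
    rw [Multiset.map_coe, hr, hrep]
  · have hmem : ∀ s : Multiset (Fin u × Fin v), ∀ c ∈ s.map f, cellsBefore v u 0 c.1 c.2 := by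
      intro s c hc
      obtain ⟨⟨i, j⟩, -, rfl⟩ := Multiset.mem_map.mp hc
      simp only [cellsBefore, f, Prod.map]
      omega
    have key := h.comp (fun s : Multiset (Fin u × Fin v) => ⟨s.map f, hmem s⟩)
      fun s s' e => Multiset.map_injective hf (congrArg Subtype.val e)
    refine linearIndependent_of_apply_eq (toCellAlg K q u v).toLinearMap key fun s => ?_
    simp only [Function.comp_apply, AlgHom.toLinearMap_apply, wordProd, ← hr, map_list_prod,
      List.map_map]
    congr 2
    ext c
    simp [toCellAlg_Xg, f]

end PBW

section WordMap

variable {K R R' I I' : Type*} [Field K] [Ring R] [Algebra K R] [Ring R'] [Algebra K R']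
  {x : I → R} {x' : I' → R'} {w : I → ℕ} {w' : I' → ℕ}

lemma map_wordProd (f : R →ₐ[K] R') (g : I → I') (h : ∀ i, f (x i) = x' (g i)) (l : List I) :
    f (wordProd x l) = wordProd x' (l.map g) := by
  induction l with
  | nil => simp
  | cons i l ih => simp [ih, h]

lemma map_mem_lowSpan (f : R →ₐ[K] R') (g : I → I') (h : ∀ i, f (x i) = x' (g i))
    (hw : ∀ i, w' (g i) = w i) {N d : ℕ} {a : R} (ha : a ∈ lowSpan K x w N d) :
    f a ∈ lowSpan K x' w' N d := by
  induction ha using Submodule.span_induction with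
  | zero => simp
  | add a b _ _ ha hb => rw [map_add]; exact add_mem ha hb
  | smul c a _ ha => rw [map_smul]; exact Submodule.smul_mem _ _ ha
  | mem a ha =>
    obtain ⟨l, h1, h2, rfl⟩ := ha
    rw [map_wordProd f g h]
    refine wordProd_mem_lowSpan (by simpa using h1) ?_
    simpa [wordWt, Function.comp_def, hw] using h2

lemma QComm.map (hx : QComm K x w) (f : R →ₐ[K] R') (g : I → I') (h : ∀ i, f (x i) = x' (g i))
    (hw : ∀ i, w' (g i) = w i) (i j : I) :
    ∃ c : K, c ≠ 0 ∧ x' (g i) * x' (g j) - c • (x' (g j) * x' (g i)) ∈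
      lowSpan K x' w' 2 (w' (g i) + w' (g j)) := by
  obtain ⟨c, hc, hm⟩ := hx i j
  refine ⟨c, hc, ?_⟩
  have := map_mem_lowSpan f g h hw hm
  simpa only [map_sub, map_mul, map_smul, h, hw] using this

lemma exists_isWordBasis (hx : QComm K x w) (h : Algebra.adjoin K (Set.range x) = ⊤)
    (rep : Multiset I → List I) (hrep : ∀ s, (rep s : Multiset I) = s)
    (hli : LinearIndependent K fun s => wordProd x (rep s)) :
    ∃ b : Module.Basis (Multiset I) K R, IsWordBasis x b :=
  ⟨Module.Basis.mk hli (span_rep_eq_top hx h rep hrep).ge, fun s =>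
    ⟨rep s, hrep s, Module.Basis.mk_apply _ _ _⟩⟩

end WordMap

section Tensor

open Multiset in
lemma sumMultiset_bijective (α β : Type*) : Function.Bijective fun p : Multiset α × Multiset β =>
    (p.1.map Sum.inl + p.2.map Sum.inr : Multiset (α ⊕ β)) := by
  classical
  constructor
  · rintro ⟨a, b⟩ ⟨a', b'⟩ h
    simp only at h
    refine Prod.ext ?_ ?_
    · ext x
      have := congrArg (count (Sum.inl x)) h
      simpa [count_map_eq_count' _ _ Sum.inl_injective, count_eq_zero_of_notMem] using this
    · ext x
      have := congrArg (count (Sum.inr x)) h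
      simpa [count_map_eq_count' _ _ Sum.inr_injective, count_eq_zero_of_notMem] using this
  · intro s
    induction s using Multiset.induction with
    | empty => exact ⟨(0, 0), rfl⟩
    | cons c s ih =>
      obtain ⟨⟨a, b⟩, rfl⟩ := ih
      rcases c with c | c
      · exact ⟨(c ::ₘ a, b), by simp⟩
      · exact ⟨(a, c ::ₘ b), by simp⟩

variable {K B C I J : Type*} [Field K] [Ring B] [Algebra K B] [Ring C] [Algebra K C]
  {x : I → B} {y : J → C} {w : I → ℕ} {w' : J → ℕ}

variable (K) in
/-- The generators of a tensor product. -/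
def tensorGen (x : I → B) (y : J → C) : I ⊕ J → B ⊗[K] C :=
  Sum.elim (fun i => x i ⊗ₜ 1) fun j => 1 ⊗ₜ y j

lemma QComm.tensor (hx : QComm K x w) (hy : QComm K y w') :
    QComm K (tensorGen K x y) (Sum.elim w w') := by
  rintro (i | i) (j | j)
  · exact hx.map (x' := tensorGen K x y) (w' := Sum.elim w w') Algebra.TensorProduct.includeLeft
      Sum.inl
      (fun _ => rfl) (fun _ => rfl) i j
  · refine ⟨1, one_ne_zero, ?_⟩
    simp [tensorGen]
  · refine ⟨1, one_ne_zero, ?_⟩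
    simp [tensorGen]
  · exact hy.map (x' := tensorGen K x y) (w' := Sum.elim w w') Algebra.TensorProduct.includeRight
      Sum.inr
      (fun _ => rfl) (fun _ => rfl) i j

lemma wordProd_tensorGen (l : List I) (l' : List J) :
    wordProd (tensorGen K x y) (l.map Sum.inl ++ l'.map Sum.inr) =
      wordProd x l ⊗ₜ wordProd y l' := by
  rw [wordProd_append,
    ← map_wordProd (x := x) (Algebra.TensorProduct.includeLeft (R := K) (S := K) (B := C)) Sum.inl
      (fun _ => rfl),
    ← map_wordProd (x := y) (Algebra.TensorProduct.includeRight (R := K) (A := B)) Sum.inr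
      (fun _ => rfl)]
  simp

lemma exists_isWordBasis_tensor {b : Module.Basis (Multiset I) K B}
    {c : Module.Basis (Multiset J) K C} (hb : IsWordBasis x b) (hc : IsWordBasis y c) :
    ∃ d : Module.Basis (Multiset (I ⊕ J)) K (B ⊗[K] C), IsWordBasis (tensorGen K x y) d := by
  let e := Equiv.ofBijective _ (sumMultiset_bijective I J)
  refine ⟨(b.tensorProduct c).reindex e, fun s => ?_⟩
  obtain ⟨⟨a, a'⟩, rfl⟩ := e.surjective s
  obtain ⟨l, hl, h⟩ := hb a
  obtain ⟨l', hl', h'⟩ := hc a'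
  refine ⟨l.map Sum.inl ++ l'.map Sum.inr, ?_, ?_⟩
  · rw [← Multiset.coe_add, ← Multiset.map_coe, ← Multiset.map_coe, hl, hl']; rfl
  · rw [Module.Basis.reindex_apply, Equiv.symm_apply_apply, Module.Basis.tensorProduct_apply, h, h',
      wordProd_tensorGen]

end Tensor

section QuantumMatrix

variable {K : Type} [Field K] {q : K} {u v : ℕ}

lemma Xg_row {i : Fin u} {j k : Fin v} (h : j < k) :
    Xg K q i j * Xg K q i k = q • (Xg K q i k * Xg K q i j) := by
  simpa [Xg] using RingQuot.mkAlgHom_rel K (QMRel.row (K := K) (q := q) (i := i) h)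

lemma Xg_col {i k : Fin u} {j : Fin v} (h : i < k) :
    Xg K q i j * Xg K q k j = q • (Xg K q k j * Xg K q i j) := by
  simpa [Xg] using RingQuot.mkAlgHom_rel K (QMRel.col (K := K) (q := q) (j := j) h)

lemma Xg_comm {i k : Fin u} {j l : Fin v} (h : i < k) (h' : l < j) :
    Xg K q i j * Xg K q k l = Xg K q k l * Xg K q i j := by
  simpa [Xg] using RingQuot.mkAlgHom_rel K (QMRel.comm (K := K) (q := q) h h')

lemma Xg_quantum {i k : Fin u} {j l : Fin v} (h : i < k) (h' : j < l) :
    Xg K q i j * Xg K q k l = Xg K q k l * Xg K q i j +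
      (q - q⁻¹) • (Xg K q i l * Xg K q k j) := by
  simpa [Xg] using RingQuot.mkAlgHom_rel K (QMRel.quantum (K := K) (q := q) h h')

variable (K q u v) in
/-- The generators of the quantum matrix algebra, indexed by cells. -/
def cellVar (c : Fin u × Fin v) : OqM K q u v := Xg K q c.1 c.2

/-- The weight of a cell. -/
def cellWt (c : Fin u × Fin v) : ℕ := (u - c.1) * (v - c.2)

lemma cellWt_cross_lt {i k : Fin u} {j l : Fin v} (h : i < k) (h' : j < l) :
    cellWt (i, l) + cellWt (k, j) < cellWt (i, j) + cellWt (k, l) := by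
  unfold cellWt
  simp only
  obtain ⟨a, ha⟩ : ∃ a, u - i.1 = (u - k.1) + (a + 1) := ⟨k - i - 1, by omega⟩
  obtain ⟨b, hb⟩ : ∃ b, v - j.1 = (v - l.1) + (b + 1) := ⟨l - j - 1, by omega⟩
  rw [ha, hb]
  nlinarith

lemma cross_mem_lowSpan {i k : Fin u} {j l : Fin v} (h : i < k) (h' : j < l) :
    Xg K q i l * Xg K q k j ∈
      lowSpan K (cellVar K q u v) cellWt 2 (cellWt (i, j) + cellWt (k, l)) := by
  have : Xg K q i l * Xg K q k j = wordProd (cellVar K q u v) [(i, l), (k, j)] := by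
    simp [cellVar]
  rw [this]
  refine wordProd_mem_lowSpan rfl ?_
  simpa [wordWt] using cellWt_cross_lt h h'

lemma qComm_cellVar (hq : q ≠ 0) : QComm K (cellVar K q u v) cellWt := by
  rintro ⟨i, j⟩ ⟨k, l⟩
  simp only [cellVar]
  have hq' := inv_ne_zero hq
  rcases lt_trichotomy i k with h | rfl | h <;> rcases lt_trichotomy j l with h' | rfl | h'
  · refine ⟨1, one_ne_zero, ?_⟩
    rw [Xg_quantum h h', one_smul, add_sub_cancel_left]
    exact Submodule.smul_mem _ _ (cross_mem_lowSpan h h')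
  · exact ⟨q, hq, by rw [Xg_col h, sub_self]; exact zero_mem _⟩
  · exact ⟨1, one_ne_zero, by rw [Xg_comm h h', one_smul, sub_self]; exact zero_mem _⟩
  · exact ⟨q, hq, by rw [Xg_row h', sub_self]; exact zero_mem _⟩
  · exact ⟨1, one_ne_zero, by rw [one_smul, sub_self]; exact zero_mem _⟩
  · exact ⟨q⁻¹, hq',
      by rw [Xg_row h', smul_smul, inv_mul_cancel₀ hq, one_smul, sub_self]; exact zero_mem _⟩
  · exact ⟨1, one_ne_zero, by rw [Xg_comm h h', one_smul, sub_self]; exact zero_mem _⟩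
  · exact ⟨q⁻¹, hq',
      by rw [Xg_col h, smul_smul, inv_mul_cancel₀ hq, one_smul, sub_self]; exact zero_mem _⟩
  · refine ⟨1, one_ne_zero, ?_⟩
    rw [Xg_quantum h h', one_smul, sub_add_cancel_left, add_comm]
    exact neg_mem (Submodule.smul_mem _ _ (cross_mem_lowSpan h h'))

lemma adjoin_cellVar : Algebra.adjoin K (Set.range (cellVar K q u v)) = ⊤ := by
  have := congrArg (Subalgebra.map (RingQuot.mkAlgHom K (QMRel K q u v)))
    (FreeAlgebra.adjoin_range_ι K (Fin u × Fin v))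
  rw [AlgHom.map_adjoin, Algebra.map_top, (AlgHom.range_eq_top _).mpr
    (RingQuot.mkAlgHom_surjective K _), ← Set.range_comp] at this
  exact this

lemma exists_isWordBasis_cellVar (hq : q ≠ 0) :
    ∃ b : Module.Basis (Multiset (Fin u × Fin v)) K (OqM K q u v),
      IsWordBasis (cellVar K q u v) b := by
  obtain ⟨rep, hrep, h⟩ := exists_linearIndependent_wordProd_Xg (K := K) hq u v
  exact exists_isWordBasis (qComm_cellVar hq) adjoin_cellVar rep hrep h

end QuantumMatrix

section Inversions

variable {α β : Type*} [LinearOrder α] [LinearOrder β] {l : ℕ}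

/-- The number of inversions of a tuple. -/
def invNum (f : Fin l → α) : ℕ :=
  (Finset.univ.filter fun p : Fin l × Fin l => p.1 < p.2 ∧ f p.2 < f p.1).card

lemma invNum_succ (f : Fin (l + 1) → α) :
    invNum f = (Finset.univ.filter fun j : Fin l => f j.succ < f 0).card +
      invNum fun j => f j.succ := by
  simp only [invNum, Finset.card_filter, Fintype.sum_prod_type, Fin.sum_univ_succ]
  simp [Fin.succ_lt_succ_iff]

lemma invNum_comp_strictMono {g : α → β} (hg : StrictMono g) (f : Fin l → α) :
    invNum (g ∘ f) = invNum f := by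
  simp [invNum, hg.lt_iff_lt]

lemma invNum_strictMono {f : Fin l → α} (hf : StrictMono f) : invNum f = 0 := by
  rw [invNum, Finset.card_eq_zero, Finset.filter_eq_empty_iff]
  rintro ⟨i, j⟩ - ⟨h, h'⟩
  exact (hf h).asymm h'

lemma card_filter_succAbove_lt (c : Fin (l + 1)) :
    (Finset.univ.filter fun j : Fin l => c.succAbove j < c).card = c := by
  have : (Finset.univ.filter fun j : Fin l => c.succAbove j < c) =
      (Finset.univ.filter fun j : Fin l => j.val < c.val) := by
    ext j
    simp only [Finset.mem_filter, Finset.mem_univ, true_and]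
    rw [Fin.succAbove_lt_iff_castSucc_lt]
    simp [Fin.lt_def]
  rw [this, Fin.card_filter_val_lt]
  omega

lemma invNum_cons_succAbove {f : Fin (l + 1) → α} (hf : StrictMono f) (p : Fin (l + 1)) :
    invNum (Fin.cons (f p) (f ∘ p.succAbove) : Fin (l + 1) → α) = p := by
  rw [invNum_succ]
  simp only [Fin.cons_succ, Fin.cons_zero, Function.comp_apply, hf.lt_iff_lt]
  rw [card_filter_succAbove_lt]
  have := invNum_strictMono (hf.comp (Fin.strictMono_succAbove p))
  simpa [Function.comp_def] using this

/-- The number of inversions of a list. -/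
def listInv : List α → ℕ
  | [] => 0
  | a :: L => L.countP (· < a) + listInv L

lemma listInv_ofFn (f : Fin l → α) : listInv (List.ofFn f) = invNum f := by
  induction l with
  | zero => simp [listInv, invNum]
  | succ l ih =>
    rw [List.ofFn_succ, listInv, ih, invNum_succ, List.ofFn_eq_map, List.countP_map]
    congr 1
    rw [Finset.card_def, Finset.filter_val, ← Multiset.countP_eq_card_filter]
    rfl

/-- The permutation with given first value and given relative order of the other values. -/
def consPerm (p : Fin (l + 1) × Equiv.Perm (Fin l)) : Equiv.Perm (Fin (l + 1)) :=
  Equiv.ofBijective (Fin.cons p.1 (p.1.succAbove ∘ p.2)) (by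
    rw [Fintype.bijective_iff_injective_and_card]
    refine ⟨Fin.cons_injective_iff.mpr ⟨?_, Fin.succAbove_right_injective.comp p.2.injective⟩, rfl⟩
    rintro ⟨i, hi⟩
    exact Fin.succAbove_ne _ _ hi)

@[simp] lemma consPerm_zero (p : Fin (l + 1) × Equiv.Perm (Fin l)) : consPerm p 0 = p.1 := rfl

@[simp] lemma consPerm_succ (p : Fin (l + 1) × Equiv.Perm (Fin l)) (i : Fin l) :
    consPerm p i.succ = p.1.succAbove (p.2 i) := rfl

lemma consPerm_bijective : Function.Bijective (consPerm (l := l)) := by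
  rw [Fintype.bijective_iff_injective_and_card]
  constructor
  · rintro ⟨c, σ⟩ ⟨c', σ'⟩ h
    have h0 : c = c' := by simpa using congrArg (fun π => π 0) h
    subst h0
    refine Prod.ext rfl (Equiv.ext fun i => ?_)
    have := congrArg (fun π => π i.succ) h
    simpa using this
  · simp [Fintype.card_perm, Nat.factorial_succ]

lemma invNum_consPerm (p : Fin (l + 1) × Equiv.Perm (Fin l)) :
    invNum (consPerm p) = p.1 + invNum p.2 := by
  rw [invNum_succ]
  congr 1
  · simp only [consPerm_succ, consPerm_zero]
    rw [← card_filter_succAbove_lt p.1]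
    refine Finset.card_bij (fun j _ => p.2 j) (fun j hj => ?_) (by simp)
      fun j hj => ⟨p.2.symm j, ?_, by simp⟩
    · exact Finset.mem_filter.mpr ⟨Finset.mem_univ _, (Finset.mem_filter.mp hj).2⟩
    · refine Finset.mem_filter.mpr ⟨Finset.mem_univ _, ?_⟩
      rw [Equiv.apply_symm_apply]
      exact (Finset.mem_filter.mp hj).2
  · exact invNum_comp_strictMono (Fin.strictMono_succAbove p.1) p.2

lemma invNum_inv (σ : Equiv.Perm (Fin l)) : invNum (σ⁻¹ : Equiv.Perm (Fin l)) = invNum σ := by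
  refine Finset.card_bij (fun p _ => (σ⁻¹ p.2, σ⁻¹ p.1)) ?_ ?_ ?_
  · rintro ⟨i, j⟩ h; simpa [and_comm] using h
  · rintro ⟨i, j⟩ - ⟨i', j'⟩ - h; simpa [and_comm] using h
  · rintro ⟨i, j⟩ h
    exact ⟨(σ j, σ i), by simpa [and_comm] using h, by simp⟩

lemma invNum_rev (σ : Equiv.Perm (Fin l)) :
    invNum (Fin.revPerm * σ * Fin.revPerm : Equiv.Perm (Fin l)) = invNum σ := by
  refine Finset.card_bij (fun p _ => (p.2.rev, p.1.rev)) ?_ ?_ ?_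
  · rintro ⟨i, j⟩ h; simpa using h
  · rintro ⟨i, j⟩ - ⟨i', j'⟩ - h; simpa [and_comm] using h
  · rintro ⟨i, j⟩ h
    exact ⟨(j.rev, i.rev), by simpa using h, by simp⟩

end Inversions

section QMat

variable {K R α β : Type*} [Field K] [Ring R] [Algebra K R] [LinearOrder α] [LinearOrder β]

/-- The entries of `x` satisfy the quantum matrix relations. -/
structure IsQMat (q : K) (x : α → β → R) : Prop where
  row : ∀ {i j k}, j < k → x i j * x i k = q • (x i k * x i j)
  col : ∀ {i j k}, i < k → x i j * x k j = q • (x k j * x i j)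
  comm : ∀ {i j k l}, i < k → l < j → x i j * x k l = x k l * x i j
  quantum : ∀ {i j k l}, i < k → j < l →
    x i j * x k l = x k l * x i j + (q - q⁻¹) • (x i l * x k j)

variable {q : K} {x : α → β → R}

open MulOpposite in
/-- The anti-transpose of a quantum matrix. -/
def antiT (x : α → β → R) : βᵒᵈ → αᵒᵈ → Rᵐᵒᵖ :=
  fun b a => op (x (OrderDual.ofDual a) (OrderDual.ofDual b))

lemma IsQMat.antiT (hx : IsQMat q x) : IsQMat q (antiT x) where
  row {i j k} h := congrArg MulOpposite.op (hx.col (OrderDual.ofDual_lt_ofDual.mpr h))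
  col {i j k} h := congrArg MulOpposite.op (hx.row (OrderDual.ofDual_lt_ofDual.mpr h))
  comm {i j k l} h h' := congrArg MulOpposite.op (hx.comm (OrderDual.ofDual_lt_ofDual.mpr h')
    (OrderDual.ofDual_lt_ofDual.mpr h)).symm
  quantum {i j k l} h h' := by
    have := hx.quantum (OrderDual.ofDual_lt_ofDual.mpr h') (OrderDual.ofDual_lt_ofDual.mpr h)
    rw [hx.comm (OrderDual.ofDual_lt_ofDual.mpr h') (OrderDual.ofDual_lt_ofDual.mpr h)] at this
    exact congrArg MulOpposite.op this

variable (q) in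
/-- A quantum minor, as a sum over permutations. -/
def qm {l : ℕ} (x : α → β → R) (r : Fin l → α) (c : Fin l → β) : R :=
  ∑ σ : Equiv.Perm (Fin l), (-q) ^ invNum σ • (List.ofFn fun i => x (r i) (c (σ i))).prod

lemma qm_zero (r : Fin 0 → α) (c : Fin 0 → β) : qm q x r c = 1 := by
  simp [qm, invNum]

/-- Expansion along the first row. -/
lemma qm_succ {l : ℕ} (r : Fin (l + 1) → α) (c : Fin (l + 1) → β) :
    qm q x r c = ∑ j : Fin (l + 1), (-q) ^ (j : ℕ) •
      (x (r 0) (c j) * qm q x (r ∘ Fin.succ) (c ∘ j.succAbove)) := by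
  rw [qm, ← consPerm_bijective.sum_comp, Fintype.sum_prod_type]
  refine Finset.sum_congr rfl fun j _ => ?_
  rw [qm, Finset.mul_sum, Finset.smul_sum]
  refine Finset.sum_congr rfl fun σ _ => ?_
  rw [invNum_consPerm, List.ofFn_succ, List.prod_cons, mul_smul_comm, smul_smul, pow_add]
  simp

variable (q x) in
/-- Left multiplication by a row on the quantum exterior algebra. -/
def rowOp (k : α) : Module.End K (Finset β → R) where
  toFun f S := ∑ c ∈ S, (-q) ^ (S.filter (· < c)).card • (x k c * f (S.erase c))
  map_add' f g := by
    ext S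
    simp [mul_add, Finset.sum_add_distrib]
  map_smul' a f := by
    ext S
    simp [Finset.smul_sum, smul_comm a]

lemma rowOp_apply (k : α) (f : Finset β → R) (S : Finset β) : rowOp q x k f S =
    ∑ c ∈ S, (-q) ^ (S.filter (· < c)).card • (x k c * f (S.erase c)) := rfl

lemma sum_erase_eq_sum_lt {M : Type*} [AddCommMonoid M] (S : Finset β) (F : β → β → M) :
    ∑ c ∈ S, ∑ d ∈ S.erase c, F c d = ∑ c ∈ S, ∑ d ∈ S.filter (c < ·), (F c d + F d c) := by
  have h1 : ∀ c, S.erase c = S.filter (c < ·) ∪ S.filter (· < c) := by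
    intro c; ext d; simp only [Finset.mem_erase, Finset.mem_union, Finset.mem_filter]
    rw [ne_iff_lt_or_gt]; tauto
  have h2 : ∀ c, Disjoint (S.filter (c < ·)) (S.filter (· < c)) := by
    intro c
    rw [Finset.disjoint_filter]
    exact fun d _ h => h.asymm
  simp only [h1, Finset.sum_union (h2 _), Finset.sum_add_distrib]
  congr 1
  simp only [Finset.sum_filter]
  rw [Finset.sum_comm]

lemma rowOp_mul_apply (k i : α) (f : Finset β → R) (S : Finset β) :
    (rowOp q x k * rowOp q x i) f S = ∑ c ∈ S, ∑ d ∈ S.filter (c < ·),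
      (-q) ^ ((S.filter (· < c)).card + ((S.filter (· < d)).card - 1)) •
        ((x k c * x i d - q • (x k d * x i c)) * f ((S.erase c).erase d)) := by
  rw [Module.End.mul_apply, rowOp_apply]
  simp only [rowOp_apply, Finset.mul_sum, Finset.smul_sum]
  rw [sum_erase_eq_sum_lt]
  refine Finset.sum_congr rfl fun c hc => Finset.sum_congr rfl fun d hd => ?_
  simp only [Finset.mem_filter] at hd
  have h1 : (S.erase c).filter (· < d) = (S.filter (· < d)).erase c := by
    ext; simp; tauto
  have h2 : (S.erase d).filter (· < c) = S.filter (· < c) := by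
    ext e; simp only [Finset.mem_filter, Finset.mem_erase]
    exact ⟨fun h => ⟨h.1.2, h.2⟩, fun h => ⟨⟨(h.2.trans hd.2).ne, h.1⟩, h.2⟩⟩
  have h3 : c ∈ S.filter (· < d) := by simp [hc, hd]
  rw [h1, h2, Finset.card_erase_of_mem h3, Finset.erase_right_comm (a := d)]
  obtain ⟨m, hm⟩ : ∃ m, (S.filter (· < d)).card = m + 1 :=
    ⟨_, (Nat.succ_pred_eq_of_pos (Finset.card_pos.mpr ⟨c, h3⟩)).symm⟩
  rw [hm, Nat.add_sub_cancel]
  simp only [mul_smul_comm, smul_smul, sub_mul, smul_sub, smul_mul_assoc, mul_assoc]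
  module

lemma IsQMat.rowOp_mul_self (hx : IsQMat q x) (k : α) : rowOp q x k * rowOp q x k = 0 := by
  ext f S
  rw [rowOp_mul_apply]
  refine Finset.sum_eq_zero fun c _ => Finset.sum_eq_zero fun d hd => ?_
  rw [hx.row (Finset.mem_filter.mp hd).2, sub_self, zero_mul, smul_zero]

lemma IsQMat.rowOp_mul (hx : IsQMat q x) (hq : q ≠ 0) {i k : α} (h : i < k) :
    rowOp q x k * rowOp q x i = (-q) • (rowOp q x i * rowOp q x k) := by
  ext f S
  rw [LinearMap.smul_apply, Pi.smul_apply, rowOp_mul_apply, rowOp_mul_apply, Finset.smul_sum]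
  refine Finset.sum_congr rfl fun c _ => ?_
  rw [Finset.smul_sum]
  refine Finset.sum_congr rfl fun d hd => ?_
  have hcd := (Finset.mem_filter.mp hd).2
  have key : x k c * x i d - q • (x k d * x i c) =
      (-q) • (x i c * x k d - q • (x i d * x k c)) := by
    rw [hx.quantum h hcd, hx.comm h hcd]
    match_scalars <;> field_simp
    ring
  rw [key, smul_mul_assoc, smul_comm]

lemma IsQMat.rowOp_mul_prod_eq_zero (hx : IsQMat q x) (hq : q ≠ 0) {k : α} {L : List α}
    (h : k ∈ L) : rowOp q x k * (L.map (rowOp q x)).prod = 0 := by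
  induction L with
  | nil => simp at h
  | cons i L ih =>
    rw [List.map_cons, List.prod_cons, ← mul_assoc]
    rcases lt_trichotomy i k with hik | rfl | hik
    · rw [hx.rowOp_mul hq hik, smul_mul_assoc, mul_assoc,
        ih ((List.mem_cons.mp h).resolve_left hik.ne'),
        mul_zero, smul_zero]
    · rw [hx.rowOp_mul_self, zero_mul]
    · have h1 : rowOp q x k * rowOp q x i = (-q)⁻¹ • (rowOp q x i * rowOp q x k) := by
        rw [hx.rowOp_mul hq hik, smul_smul, inv_mul_cancel₀ (neg_ne_zero.mpr hq), one_smul]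
      rw [h1, smul_mul_assoc, mul_assoc, ih ((List.mem_cons.mp h).resolve_left hik.ne),
        mul_zero, smul_zero]

lemma IsQMat.prod_rowOp_eq_zero (hx : IsQMat q x) (hq : q ≠ 0) {L : List α} (h : ¬ L.Nodup) :
    (L.map (rowOp q x)).prod = 0 := by
  induction L with
  | nil => simp at h
  | cons k L ih =>
    rw [List.map_cons, List.prod_cons]
    by_cases hk : k ∈ L
    · exact hx.rowOp_mul_prod_eq_zero hq hk
    · rw [ih (fun hn => h (List.nodup_cons.mpr ⟨hk, hn⟩)), mul_zero]

lemma IsQMat.prod_orderedInsert (hx : IsQMat q x) (hq : q ≠ 0) {k : α} {L : List α}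
    (hL : L.Pairwise (· ≤ ·)) (hk : k ∉ L) :
    rowOp q x k * (L.map (rowOp q x)).prod =
      (-q) ^ L.countP (· < k) • ((L.orderedInsert (· ≤ ·) k).map (rowOp q x)).prod := by
  induction L with
  | nil => simp
  | cons i L ih =>
    simp only [List.mem_cons, not_or] at hk
    rw [List.pairwise_cons] at hL
    rcases lt_or_gt_of_ne hk.1 with h | h
    · have h0 : (i :: L).countP (· < k) = 0 := by
        rw [List.countP_eq_zero]
        intro a ha
        have : i ≤ a := by
          rcases List.mem_cons.mp ha with rfl | ha
          · rfl
          · exact hL.1 a ha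
        simpa using h.le.trans this
      rw [h0, List.orderedInsert_cons, if_pos h.le, pow_zero, one_smul, List.map_cons (a := k),
        List.prod_cons]
    · rw [List.orderedInsert_cons, if_neg (not_le.mpr h), List.map_cons, List.prod_cons,
        ← mul_assoc,
        hx.rowOp_mul hq h, smul_mul_assoc, mul_assoc, ih hL.2 hk.2,
          List.countP_cons_of_pos (by simpa using h),
        List.map_cons, List.prod_cons, mul_smul_comm, smul_smul, pow_succ']

lemma IsQMat.prod_insertionSort (hx : IsQMat q x) (hq : q ≠ 0) {L : List α} (h : L.Nodup) :
    (L.map (rowOp q x)).prod =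
      (-q) ^ listInv L • ((L.insertionSort (· ≤ ·)).map (rowOp q x)).prod := by
  induction L with
  | nil => simp [listInv]
  | cons k L ih =>
    rw [List.nodup_cons] at h
    have hp := List.perm_insertionSort (· ≤ ·) L
    rw [List.map_cons, List.prod_cons, ih h.2, mul_smul_comm,
      hx.prod_orderedInsert hq (List.pairwise_insertionSort _ _) (fun h' => h.1 (hp.mem_iff.mp h')),
      smul_smul, hp.countP_eq, listInv, List.insertionSort_cons, pow_add, mul_comm]

/-- The unit of the quantum exterior algebra. -/
def extOne : Finset β → R := fun S => if S = ∅ then 1 else 0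

lemma qm_eq_prod_rowOp {l : ℕ} (r : Fin l → α) {c : Fin l → β} (hc : StrictMono c) :
    qm q x r c = ((List.ofFn r).map (rowOp q x)).prod extOne (Finset.univ.image c) := by
  induction l with
  | zero => simp [qm_zero, extOne]
  | succ l ih =>
    rw [qm_succ, List.ofFn_succ, List.map_cons, List.prod_cons, Module.End.mul_apply, rowOp_apply,
      Finset.sum_image fun _ _ _ _ h => hc.injective h]
    refine Finset.sum_congr rfl fun j _ => ?_
    have h1 : ((Finset.univ.image c).filter (· < c j)).card = j := by
      rw [Finset.filter_image, Finset.card_image_of_injective _ hc.injective]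
      simp only [hc.lt_iff_lt]
      rw [show Finset.univ.filter (· < j) = Finset.Iio j by ext; simp, Fin.card_Iio]
    have h2 : (Finset.univ.image c).erase (c j) = Finset.univ.image (c ∘ j.succAbove) := by
      rw [← Finset.image_image, Fin.image_succAbove_univ, ← Finset.image_erase hc.injective]
      congr 1
      ext; simp
    rw [h1, h2, ih _ (hc.comp (Fin.strictMono_succAbove j))]
    rfl

lemma IsQMat.qm_eq_zero (hx : IsQMat q x) (hq : q ≠ 0) {l : ℕ} {r : Fin l → α} {c : Fin l → β}
    (hc : StrictMono c) (hr : ¬ Function.Injective r) : qm q x r c = 0 := by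
  rw [qm_eq_prod_rowOp r hc, hx.prod_rowOp_eq_zero hq (by rwa [List.nodup_ofFn])]
  rfl

lemma IsQMat.qm_comp_perm (hx : IsQMat q x) (hq : q ≠ 0) {l : ℕ} {r s : Fin l → α} {c : Fin l → β}
    (hc : StrictMono c) (hs : StrictMono s) (π : Equiv.Perm (Fin l)) (hr : ∀ i, r i = s (π i)) :
    qm q x r c = (-q) ^ invNum r • qm q x s c := by
  obtain rfl : r = s ∘ π := funext hr
  have hn : (List.ofFn (s ∘ π)).Nodup := by
    rw [List.nodup_ofFn]; exact hs.injective.comp π.injective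
  have hp : (List.ofFn (s ∘ π)).insertionSort (· ≤ ·) = List.ofFn s := by
    refine List.Perm.eq_of_pairwise' (r := (· ≤ ·)) (List.pairwise_insertionSort _ _)
      (List.pairwise_ofFn.mpr fun i j h => (hs h).le)
      ((List.perm_insertionSort _ _).trans ?_)
    exact Equiv.Perm.ofFn_comp_perm π s
  rw [qm_eq_prod_rowOp _ hc, hx.prod_insertionSort hq hn, hp, listInv_ofFn, qm_eq_prod_rowOp _ hc]
  simp

end QMat

section Normal

open OrderDual MulOpposite

variable {K R α β : Type*} [Field K] [Ring R] [Algebra K R] [LinearOrder α] [LinearOrder β]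
  {q : K} {x : α → β → R}

lemma prod_orderedInsert_snd {f : α × β → R}
    (hf : ∀ p p' : α × β, p.1 < p'.1 → p'.2 < p.2 → f p * f p' = f p' * f p)
    {p : α × β} {L : List (α × β)} (hL : ∀ p' ∈ L, p.1 < p'.1) :
    ((L.orderedInsert (fun a b => a.2 ≤ b.2) p).map f).prod = f p * (L.map f).prod := by
  induction L with
  | nil => simp
  | cons a L ih =>
    rw [List.orderedInsert_cons]
    split_ifs with h
    · simp
    · rw [List.map_cons, List.prod_cons, ih fun p' hp' => hL p' (List.mem_cons_of_mem _ hp'),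
        List.map_cons, List.prod_cons, ← mul_assoc, ← mul_assoc,
        hf p a (hL a List.mem_cons_self) (not_le.mp h)]

lemma prod_insertionSort_snd {f : α × β → R}
    (hf : ∀ p p' : α × β, p.1 < p'.1 → p'.2 < p.2 → f p * f p' = f p' * f p)
    {L : List (α × β)} (hL : L.Pairwise fun p p' => p.1 < p'.1) :
    ((L.insertionSort fun a b => a.2 ≤ b.2).map f).prod = (L.map f).prod := by
  induction L with
  | nil => simp
  | cons p L ih =>
    rw [List.pairwise_cons] at hL
    rw [List.insertionSort_cons, prod_orderedInsert_snd hf, ih hL.2, List.map_cons, List.prod_cons]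
    exact fun p' hp' => hL.1 p' ((List.mem_insertionSort _).mp hp')

lemma prod_transpose {l : ℕ} {f : Fin l → Fin l → R}
    (hf : ∀ i j i' j' : Fin l, i < i' → j' < j → f i j * f i' j' = f i' j' * f i j)
    (σ : Equiv.Perm (Fin l)) :
    (List.ofFn fun i => f i (σ i)).prod = (List.ofFn fun j => f (σ⁻¹ j) j).prod := by
  have h : (List.ofFn fun i => (i, σ i)).insertionSort (fun a b => a.2 ≤ b.2) =
      List.ofFn fun j => (σ⁻¹ j, j) := by
    have hp : (List.ofFn fun i => (i, σ i)).Perm (List.ofFn fun j => (σ⁻¹ j, j)) := by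
      have := Equiv.Perm.ofFn_comp_perm σ (fun j => (σ⁻¹ j, j))
      simpa [Function.comp_def] using this
    refine List.Perm.eq_of_pairwise ?_ (List.pairwise_insertionSort _ _)
      (List.pairwise_ofFn.mpr fun i j h => h.le) ((List.perm_insertionSort _ _).trans hp)
    rintro a b ha hb hab hba
    have ha' := (List.mem_insertionSort _).mp ha
    rw [hp.mem_iff] at ha'
    obtain ⟨j, rfl⟩ := List.mem_ofFn.mp ha'
    obtain ⟨j', rfl⟩ := List.mem_ofFn.mp hb
    obtain rfl : j = j' := le_antisymm hab hba
    rfl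
  have h2 := prod_insertionSort_snd (f := fun p : Fin l × Fin l => f p.1 p.2)
    (fun p p' h h' => hf _ _ _ _ h h') (L := List.ofFn fun i => (i, σ i))
    (List.pairwise_ofFn.mpr fun i j h => h)
  rw [h] at h2
  simpa [List.map_ofFn, Function.comp_def] using h2.symm

lemma prod_ofFn_op {l : ℕ} (f : Fin l → R) :
    (List.ofFn fun i => op (f i)).prod = op (List.ofFn fun i => f i.rev).prod := by
  rw [MulOpposite.op_list_prod, List.map_ofFn]
  congr 1
  refine List.ext_getElem (by simp) fun i h h' => ?_
  simp only [List.getElem_ofFn, List.getElem_reverse, Function.comp_apply, List.length_ofFn]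
  congr 2
  ext
  simp only [List.length_ofFn] at h
  simp only [Fin.val_rev]
  omega

/-- A quantum minor is, up to reversing the multiplication, a minor of the anti-transpose. -/
lemma IsQMat.op_qm (hx : IsQMat q x) {l : ℕ} {r : Fin l → α} {c : Fin l → β} (hr : StrictMono r)
    (hc : StrictMono c) :
    qm q (_root_.antiT x) (toDual ∘ c ∘ Fin.rev) (toDual ∘ r ∘ Fin.rev) = op (qm q x r c) := by
  have h1 : qm q x r c = ∑ σ : Equiv.Perm (Fin l), (-q) ^ invNum σ •
      (List.ofFn fun j => x (r (σ j)) (c j)).prod := by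
    rw [qm, ← Equiv.sum_comp (Equiv.inv (Equiv.Perm (Fin l)))]
    refine Finset.sum_congr rfl fun σ _ => ?_
    rw [Equiv.inv_apply, invNum_inv, prod_transpose (f := fun i j => x (r i) (c j))]
    · rfl
    · exact fun i j i' j' h h' => hx.comm (hr h) (hc h')
  have hb : Function.Bijective fun σ : Equiv.Perm (Fin l) => Fin.revPerm * σ * Fin.revPerm := by
    refine Function.Involutive.bijective fun σ => ?_
    ext i
    simp
  rw [h1, ← hb.sum_comp, Finset.op_sum, qm]
  refine Finset.sum_congr rfl fun σ _ => ?_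
  rw [invNum_rev, op_smul]
  congr 1
  simp only [_root_.antiT, Function.comp_apply, ofDual_toDual]
  rw [prod_ofFn_op fun i => x (r (σ i).rev) (c i.rev)]
  simp

/-- Expansion of a minor, or of a minor with a repeated row, along its first row. -/
lemma IsQMat.sum_row (hx : IsQMat q x) (hq : q ≠ 0) {l : ℕ} {r : Fin (l + 1) → α}
    {c : Fin (l + 1) → β} (hr : StrictMono r) (hc : StrictMono c) (p p' : Fin (l + 1)) :
    ∑ j : Fin (l + 1), (-q) ^ (j : ℕ) • (x (r p') (c j) * qm q x (r ∘ p.succAbove)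
      (c ∘ j.succAbove)) =
      if p' = p then (-q) ^ (p : ℕ) • qm q x r c else 0 := by
  have := qm_succ (q := q) (x := x) (Fin.cons (r p') (r ∘ p.succAbove) : Fin (l + 1) → α) c
  simp only [Fin.cons_zero] at this
  rw [show (Fin.cons (r p') (r ∘ p.succAbove) : Fin (l + 1) → α) ∘ Fin.succ = r ∘ p.succAbove from
    rfl] at this
  rw [← this]
  split_ifs with h
  · subst h
    rw [hx.qm_comp_perm hq hc hr (consPerm (p', 1)), invNum_cons_succAbove hr]
    intro i
    cases i using Fin.cases <;> simp
  · refine hx.qm_eq_zero hq hc fun hi => ?_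
    obtain ⟨i, hi'⟩ := Fin.exists_succAbove_eq h
    have := @hi 0 i.succ (by simp [hi'])
    exact Fin.succ_ne_zero i this.symm

lemma rev_comp_succAbove {γ : Type*} {l : ℕ} (f : Fin (l + 1) → γ) (p : Fin (l + 1)) :
    (f ∘ Fin.rev) ∘ p.rev.succAbove = (f ∘ p.succAbove) ∘ Fin.rev := by
  funext i
  simp [Fin.rev_succAbove]

lemma strictMono_dual_rev {l : ℕ} {r : Fin l → α} (hr : StrictMono r) :
    StrictMono (toDual ∘ r ∘ Fin.rev) :=
  fun _ _ h => toDual_lt_toDual.mpr (hr (Fin.rev_lt_rev.mpr h))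

/-- Expansion along the last column. -/
lemma IsQMat.sum_col (hx : IsQMat q x) (hq : q ≠ 0) {l : ℕ} {r : Fin (l + 1) → α}
    {c : Fin (l + 1) → β} (hr : StrictMono r) (hc : StrictMono c) (p p' : Fin (l + 1)) :
    ∑ j : Fin (l + 1), (-q) ^ (j.rev : ℕ) •
        (qm q x (r ∘ j.succAbove) (c ∘ p.succAbove) * x (r j) (c p')) =
      if p' = p then (-q) ^ (p.rev : ℕ) • qm q x r c else 0 := by
  have h := hx.antiT.sum_row hq (strictMono_dual_rev hc) (strictMono_dual_rev hr) p.rev p'.rev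
  rw [← Equiv.sum_comp Fin.revPerm] at h
  apply MulOpposite.op_injective
  rw [hx.op_qm hr hc] at h
  rw [Finset.op_sum]
  convert h using 1
  · refine Finset.sum_congr rfl fun j _ => ?_
    rw [op_smul, op_mul, Fin.revPerm_apply, ← hx.op_qm (hr.comp (Fin.strictMono_succAbove j))
      (hc.comp (Fin.strictMono_succAbove p))]
    congr 2
    · simp [_root_.antiT]
    · congr 1
      · exact (rev_comp_succAbove (toDual ∘ c) p).symm
      · exact (rev_comp_succAbove (toDual ∘ r) j).symm
  · simp only [Fin.rev_inj]
    split_ifs <;> simp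

lemma IsQMat.sum_row_col (hx : IsQMat q x) (hq : q ≠ 0) {l : ℕ} {r : Fin (l + 1) → α}
    {c : Fin (l + 1) → β} (hr : StrictMono r) (hc : StrictMono c) (k : α) (u : Fin (l + 1)) :
    ∑ p : Fin (l + 1), (-q) ^ (p.rev : ℕ) •
      ((∑ j : Fin (l + 1), (-q) ^ (j : ℕ) •
        (x k (c j) * qm q x (r ∘ p.succAbove) (c ∘ j.succAbove))) * x (r p) (c u)) =
      (-q) ^ l • (x k (c u) * qm q x r c) := by
  have h1 : ∀ j : Fin (l + 1), ∑ p : Fin (l + 1), (-q) ^ (p.rev : ℕ) •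
      (((-q) ^ (j : ℕ) • (x k (c j) * qm q x (r ∘ p.succAbove) (c ∘ j.succAbove))) *
        x (r p) (c u)) = if u = j then (-q) ^ l • (x k (c u) * qm q x r c) else 0 := by
    intro j
    have h := congrArg (fun z => (-q) ^ (j : ℕ) • (x k (c j) * z)) (hx.sum_col hq hr hc j u)
    simp only [Finset.mul_sum, Finset.smul_sum] at h
    convert h using 1
    · refine Finset.sum_congr rfl fun p _ => ?_
      simp only [smul_mul_assoc, mul_smul_comm, smul_smul, mul_assoc, mul_comm]
    · split_ifs with hj
      · subst hj
        rw [mul_smul_comm, smul_smul, ← pow_add, Fin.val_rev]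
        congr 2
        have := u.2
        omega
      · simp
  simp only [Finset.sum_mul, Finset.smul_sum]
  rw [Finset.sum_comm]
  simp only [h1]
  simp

/-- The entries of the rows and columns of a minor commute with it. -/
lemma IsQMat.mul_qm_of_mem (hx : IsQMat q x) (hq : q ≠ 0) {l : ℕ} {r : Fin (l + 1) → α}
    {c : Fin (l + 1) → β} (hr : StrictMono r) (hc : StrictMono c) (p u : Fin (l + 1)) :
    x (r p) (c u) * qm q x r c = qm q x r c * x (r p) (c u) := by
  have h := hx.sum_row_col hq hr hc (r p) u
  simp only [hx.sum_row hq hr hc] at h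
  have h2 : ∀ p' : Fin (l + 1), (-q) ^ (p'.rev : ℕ) •
      ((if p = p' then (-q) ^ (p' : ℕ) • qm q x r c else 0) * x (r p') (c u)) =
      if p = p' then (-q) ^ l • (qm q x r c * x (r p) (c u)) else 0 := by
    intro p'
    split_ifs with hp
    · subst hp
      rw [smul_mul_assoc, smul_smul, ← pow_add, Fin.val_rev]
      congr 2
      have := p.2
      omega
    · simp
  simp only [h2, Finset.sum_ite_eq, Finset.mem_univ, if_true] at h
  exact (smul_right_injective R (pow_ne_zero l (neg_ne_zero.mpr hq)) h).symm

/-- The entries above a minor `q`-commute with it. -/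
lemma IsQMat.mul_qm_of_lt (hx : IsQMat q x) (hq : q ≠ 0) {l : ℕ} {r : Fin (l + 1) → α}
    {c : Fin (l + 1) → β} (hr : StrictMono r) (hc : StrictMono c) {k : α} (hk : ∀ p, k < r p)
    (u : Fin (l + 1)) :
    x k (c u) * qm q x r c = q • (qm q x r c * x k (c u)) := by
  set T : Fin (l + 2) → α := Fin.cons k r with hT
  have hTm : StrictMono T := by
    intro i j hij
    cases j using Fin.cases with
    | zero => exact absurd hij (Fin.not_lt_zero _)
    | succ j =>
      cases i using Fin.cases with
      | zero => exact hk j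
      | succ i => exact hr (Fin.succ_lt_succ_iff.mp hij)
  have h0 : qm q (_root_.antiT x) (Fin.cons (toDual (c u)) (toDual ∘ c ∘ Fin.rev) :
      Fin (l + 2) → βᵒᵈ) (toDual ∘ T ∘ Fin.rev) = 0 := by
    refine hx.antiT.qm_eq_zero hq (strictMono_dual_rev hTm) fun hi => ?_
    have := @hi 0 u.rev.succ (by simp)
    exact Fin.succ_ne_zero _ this.symm
  rw [qm_succ, ← Equiv.sum_comp Fin.revPerm, Fin.sum_univ_succ] at h0
  have h1 : ∀ p : Fin (l + 2), (Fin.cons (toDual (c u)) (toDual ∘ c ∘ Fin.rev) :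
      Fin (l + 2) → βᵒᵈ) ∘ Fin.succ = toDual ∘ c ∘ Fin.rev := fun _ => rfl
  have h2 : ∀ p : Fin (l + 2), (-q) ^ (Fin.revPerm p : ℕ) •
      (_root_.antiT x ((Fin.cons (toDual (c u)) (toDual ∘ c ∘ Fin.rev) : Fin (l + 2) → βᵒᵈ) 0)
        ((toDual ∘ T ∘ Fin.rev) (Fin.revPerm p)) *
        qm q (_root_.antiT x) ((Fin.cons (toDual (c u)) (toDual ∘ c ∘ Fin.rev) :
          Fin (l + 2) → βᵒᵈ) ∘ Fin.succ) ((toDual ∘ T ∘ Fin.rev) ∘ (Fin.revPerm p).succAbove)) =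
      op ((-q) ^ (p.rev : ℕ) • (qm q x (T ∘ p.succAbove) c * x (T p) (c u))) := by
    intro p
    rw [op_smul, op_mul, Fin.revPerm_apply, h1 p,
      ← hx.op_qm (hTm.comp (Fin.strictMono_succAbove p)) hc]
    congr 2
    · simp [_root_.antiT]
    · congr 1
      exact rev_comp_succAbove (toDual ∘ T) p
  simp only [h2, ← op_add, ← Finset.op_sum] at h0
  have h3 := congrArg unop h0
  rw [unop_op, unop_zero] at h3
  have h4 := hx.sum_row_col hq hr hc k u
  have h5 : ∀ p : Fin (l + 1), qm q x (T ∘ p.succ.succAbove) c =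
      ∑ j : Fin (l + 1), (-q) ^ (j : ℕ) •
        (x k (c j) * qm q x (r ∘ p.succAbove) (c ∘ j.succAbove)) := by
    intro p
    rw [qm_succ]
    refine Finset.sum_congr rfl fun j _ => ?_
    have : (T ∘ p.succ.succAbove) ∘ Fin.succ = r ∘ p.succAbove := by
      funext i; simp [hT]; rfl
    rw [this]
    congr 3
  have h6 : ∀ p : Fin (l + 1), ((p.succ.rev : Fin (l + 2)) : ℕ) = p.rev := by
    intro p; simp [Fin.val_rev]
  simp only [h5, h6] at h3
  have h7 : ∀ p : Fin (l + 1), T p.succ = r p := fun _ => rfl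
  simp only [h7, h4] at h3
  have h8 : T ∘ (0 : Fin (l + 2)).succAbove = r := by
    funext i; simp [hT]
  rw [h8, Fin.rev_zero, Fin.val_last, pow_succ, show T 0 = k from rfl] at h3
  refine smul_right_injective R (pow_ne_zero l (neg_ne_zero.mpr hq)) ?_
  simp only
  rw [← sub_eq_zero, ← h3]
  module

end Normal

section Rearrangement

lemma sum_fin_le_sum_of_injective {l : ℕ} {κ : Fin l → ℕ} (hκ : Function.Injective κ) :
    ∑ i : Fin l, (i : ℕ) ≤ ∑ i, κ i := by
  have h : ∀ s : Finset ℕ, ∑ i ∈ Finset.range s.card, i ≤ ∑ i ∈ s, i := by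
    intro s
    induction s using Finset.induction_on_max with
    | empty => simp
    | insert a s ha ih =>
      have h1 : a ∉ s := fun h => (ha a h).false
      have h2 : s.card ≤ a := by
        have : s ⊆ Finset.range a := fun x hx => Finset.mem_range.mpr (ha x hx)
        simpa using Finset.card_le_card this
      rw [Finset.card_insert_of_notMem h1, Finset.sum_range_succ, Finset.sum_insert h1]
      omega
  have := h (Finset.univ.image κ)
  rwa [Finset.card_image_of_injective _ hκ, Finset.sum_image fun _ _ _ _ h => hκ h,
    Finset.card_fin, Finset.sum_range] at this

/-- A strict rearrangement inequality. -/
lemma sum_mul_sub_nonneg {l : ℕ} {s : Fin l → ℤ} (hs : StrictAnti s) (hs0 : ∀ i, 0 < s i)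
    {κ : Fin l → ℕ} (hκ : Function.Injective κ) :
    0 ≤ ∑ i, s i * ((κ i : ℤ) - i) ∧ (∑ i, s i * ((κ i : ℤ) - i) = 0 → ∀ i, κ i = i) := by
  induction l with
  | zero => simp
  | succ l ih =>
    have hδ : 0 ≤ ∑ i, ((κ i : ℤ) - (i : ℕ)) := by
      rw [Finset.sum_sub_distrib, sub_nonneg]
      exact_mod_cast sum_fin_le_sum_of_injective hκ
    have h1 : ∑ i, s i * ((κ i : ℤ) - (i : ℕ)) =
        ∑ i : Fin l, (s i.castSucc - s (Fin.last l)) * ((κ i.castSucc : ℤ) - (i : ℕ)) +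
          s (Fin.last l) * ∑ i, ((κ i : ℤ) - (i : ℕ)) := by
      rw [Fin.sum_univ_castSucc, Fin.sum_univ_castSucc, mul_add, Finset.mul_sum, ← add_assoc,
        ← Finset.sum_add_distrib]
      congr 1
      refine Finset.sum_congr rfl fun i _ => ?_
      simp only [Fin.val_castSucc]
      ring
    obtain ⟨h2, h3⟩ := ih (s := fun i => s i.castSucc - s (Fin.last l)) (κ := κ ∘ Fin.castSucc)
      (fun i j h => sub_lt_sub_right (hs (Fin.castSucc_lt_castSucc_iff.mpr h)) _)
      (fun i => sub_pos.mpr (hs (Fin.castSucc_lt_last i)))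
      (hκ.comp (Fin.castSucc_injective l))
    have h4 := mul_nonneg (hs0 (Fin.last l)).le hδ
    simp only [Function.comp_apply] at h2 h3
    refine ⟨by rw [h1]; exact add_nonneg h2 h4, fun h i => ?_⟩
    rw [h1] at h
    have h5 := h3 (by linarith)
    have h6 : s (Fin.last l) * ∑ i, ((κ i : ℤ) - (i : ℕ)) = 0 := by linarith
    rw [mul_eq_zero, or_iff_right (hs0 _).ne', Fin.sum_univ_castSucc] at h6
    simp only [Fin.val_castSucc, h5, sub_self, Finset.sum_const_zero, zero_add] at h6
    cases i using Fin.lastCases with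
    | last => exact_mod_cast sub_eq_zero.mp h6
    | cast i => simpa using h5 i

lemma sum_mul_le_of_injective {l n t : ℕ} (hl : l ≤ t) {r : Fin l → Fin n} (hr : StrictMono r)
    {κ : Fin l → Fin t} (hκ : Function.Injective κ) :
    ∑ i, (n - (r i : ℕ)) * (t - (κ i : ℕ)) ≤ ∑ i : Fin l, (n - (r i : ℕ)) * (t - (i : ℕ)) ∧
    (∑ i, (n - (r i : ℕ)) * (t - (κ i : ℕ)) = ∑ i : Fin l, (n - (r i : ℕ)) * (t - (i : ℕ)) →
      κ = Fin.castLE hl) := by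
  have h := sum_mul_sub_nonneg (s := fun i => (n : ℤ) - (r i : ℕ)) (κ := fun i => (κ i : ℕ))
    (fun i j h => by have := Fin.lt_def.mp (hr h); simp only; omega)
    (fun i => by have := (r i).2; omega) (Fin.val_injective.comp hκ)
  have e : ∑ i, ((n : ℤ) - (r i : ℕ)) * (((κ i : ℕ) : ℤ) - (i : ℕ)) =
      ((∑ i : Fin l, (n - (r i : ℕ)) * (t - (i : ℕ)) : ℕ) : ℤ) -
        ((∑ i, (n - (r i : ℕ)) * (t - (κ i : ℕ)) : ℕ) : ℤ) := by
    push_cast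
    rw [← Finset.sum_sub_distrib]
    refine Finset.sum_congr rfl fun i _ => ?_
    rw [Nat.cast_sub (r i).2.le, Nat.cast_sub (κ i).2.le, Nat.cast_sub (i.2.le.trans hl)]
    ring
  rw [e] at h
  refine ⟨by have := h.1; omega, fun h' => ?_⟩
  funext i
  exact Fin.ext (h.2 (by rw [h', sub_self]) i)

lemma sum_mul_perm_lt {l u v : ℕ} {r : Fin l → Fin u} (hr : StrictMono r) {c : Fin l → Fin v}
    (hc : StrictMono c) {σ : Equiv.Perm (Fin l)} (hσ : σ ≠ 1) :
    ∑ i, (u - (r i : ℕ)) * (v - (c (σ i) : ℕ)) < ∑ i, (u - (r i : ℕ)) * (v - (c i : ℕ)) := by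
  have hr' : StrictAnti fun i => u - (r i : ℕ) := fun i j h => by
    have := Fin.lt_def.mp (hr h); have := (r j).2; simp only; omega
  have hc' : StrictAnti fun i => v - (c i : ℕ) := fun i j h => by
    have := Fin.lt_def.mp (hc h); have := (c j).2; simp only; omega
  refine ((hr'.antitone.monovary hc'.antitone).sum_mul_comp_perm_lt_sum_mul_iff (σ := σ)).mpr
    fun hm => hσ ?_
  have hσm : StrictMono σ := by
    intro i j hij
    by_contra hji
    have hji' : σ j < σ i := lt_of_le_of_ne (not_lt.mp hji) fun h => hij.ne' (σ.injective h)
    exact (hm (hc' hji')).not_gt (hr' hij)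
  ext i
  have := StrictMono.range_inj (γ := Fin l) hσm strictMono_id
  exact congrArg Fin.val (congrFun (this.mp (by simp [σ.surjective.range_eq])) i)

end Rearrangement

section Lead

variable {K R I ι : Type*} [Field K] [Ring R] [Algebra K R] {x : I → R} {w : I → ℕ}

lemma hasLead_sum {S : Finset ι} {c : ι → K} {L : ι → List I} {i : ι} (hi : i ∈ S)
    (hc : c i ≠ 0) (hlen : ∀ j ∈ S, j ≠ i → (L j).length = (L i).length)
    (hlt : ∀ j ∈ S, j ≠ i → wordWt w (L j) < wordWt w (L i)) :
    HasLead K x w (∑ j ∈ S, c j • wordProd x (L j)) (L i) := by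
  classical
  refine ⟨c i, hc, L i, rfl, ?_⟩
  rw [← Finset.add_sum_erase S _ hi, add_sub_cancel_left]
  refine sum_mem fun j hj => Submodule.smul_mem _ _ ?_
  rw [Finset.mem_erase] at hj
  exact wordProd_mem_lowSpan (hlen j hj.2 hj.1) (hlt j hj.2 hj.1)

lemma wordWt_ofFn {l : ℕ} (f : Fin l → I) : wordWt w (List.ofFn f : Multiset I) = ∑ i, w (f i) := by
  simp [wordWt, List.map_ofFn, List.sum_ofFn]

lemma wordProd_ofFn {l : ℕ} (f : Fin l → I) :
    wordProd x (List.ofFn f) = (List.ofFn fun i => x (f i)).prod := by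
  simp [wordProd, List.map_ofFn, Function.comp_def]

lemma prod_ofFn_sum {κ : Type*} [Fintype κ] {l : ℕ} (f : Fin l → κ → R) :
    (List.ofFn fun i => ∑ k, f i k).prod = ∑ g : Fin l → κ,
      (List.ofFn fun i => f i (g i)).prod := by
  induction l with
  | zero => simp
  | succ l ih =>
    rw [List.ofFn_succ, List.prod_cons, ih, ← (Fin.consEquiv fun _ => κ).sum_comp,
      Fintype.sum_prod_type, Finset.sum_mul_sum]
    refine Finset.sum_congr rfl fun k _ => Finset.sum_congr rfl fun g _ => ?_
    simp [List.ofFn_succ]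

lemma prod_ofFn_tmul {B C : Type*} [Ring B] [Algebra K B] [Ring C] [Algebra K C] {l : ℕ}
    (f : Fin l → B) (g : Fin l → C) :
    (List.ofFn fun i => f i ⊗ₜ[K] g i).prod = (List.ofFn f).prod ⊗ₜ (List.ofFn g).prod := by
  induction l with
  | zero => simp [Algebra.TensorProduct.one_def]
  | succ l ih => simp [List.ofFn_succ, ih]

end Lead

lemma invNum_id {l : ℕ} : invNum (id : Fin l → Fin l) = 0 :=
  invNum_strictMono strictMono_id

section CauchyBinet

variable {K B C : Type*} [Field K] [Ring B] [Algebra K B] [Ring C] [Algebra K C]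
  {α β : Type*} [LinearOrder α] [LinearOrder β] {q : K} {t l : ℕ} {y : α → Fin t → B}
  {z : Fin t → β → C}

lemma qm_sum_tmul (r : Fin l → α) (c : Fin l → β) :
    qm q (fun i j => ∑ k, y i k ⊗ₜ[K] z k j) r c =
      ∑ κ : Fin l → Fin t, (List.ofFn fun i => y (r i) (κ i)).prod ⊗ₜ[K] qm q z κ c := by
  simp only [qm, prod_ofFn_sum, Finset.smul_sum, prod_ofFn_tmul, TensorProduct.tmul_sum,
    TensorProduct.tmul_smul]
  rw [Finset.sum_comm]

lemma IsQMat.qm_sum_tmul_eq_sum_injective (hz : IsQMat q z) (hq : q ≠ 0) (r : Fin l → α)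
    {c : Fin l → β} (hc : StrictMono c) :
    qm q (fun i j => ∑ k, y i k ⊗ₜ[K] z k j) r c =
      ∑ κ : Fin l → Fin t with Function.Injective κ, ∑ σ : Equiv.Perm (Fin l),
        (-q) ^ invNum σ • ((List.ofFn fun i => y (r i) (κ i)).prod ⊗ₜ[K]
          (List.ofFn fun i => z (κ i) (c (σ i))).prod) := by
  classical
  rw [qm_sum_tmul, ← Finset.sum_filter_add_sum_filter_not _ (fun κ => Function.Injective κ),
    Finset.sum_eq_zero (s := Finset.univ.filter fun κ => ¬ Function.Injective κ), add_zero]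
  · refine Finset.sum_congr rfl fun κ _ => ?_
    rw [qm, TensorProduct.tmul_sum]
    simp only [TensorProduct.tmul_smul]
  · intro κ hκ
    rw [hz.qm_eq_zero hq hc (Finset.mem_filter.mp hκ).2, TensorProduct.tmul_zero]

lemma IsQMat.qm_sum_tmul_top (hz : IsQMat q z) (hq : q ≠ 0) (r : Fin t → α) {c : Fin t → β}
    (hc : StrictMono c) :
    qm q (fun i j => ∑ k, y i k ⊗ₜ[K] z k j) r c = qm q y r id ⊗ₜ[K] qm q z id c := by
  classical
  rw [qm_sum_tmul, ← Finset.sum_filter_add_sum_filter_not _ (fun κ => Function.Injective κ),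
    Finset.sum_eq_zero (s := Finset.univ.filter fun κ => ¬ Function.Injective κ), add_zero]
  · rw [qm, TensorProduct.sum_tmul]
    symm
    refine Finset.sum_bij (fun σ _ => σ) (fun σ _ => by simp [σ.injective])
      (fun σ _ τ _ h => Equiv.ext (congrFun h)) (fun κ hκ => ?_) fun σ _ => ?_
    · have hκ' := (Finset.mem_filter.mp hκ).2
      exact ⟨Equiv.ofBijective κ (Finite.injective_iff_bijective.mp hκ'), Finset.mem_univ _, rfl⟩
    · rw [hz.qm_comp_perm (r := ⇑σ) hq hc strictMono_id σ (fun i => rfl), TensorProduct.tmul_smul,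
        TensorProduct.smul_tmul']
      rfl
  · intro κ hκ
    rw [hz.qm_eq_zero hq hc (Finset.mem_filter.mp hκ).2, TensorProduct.tmul_zero]

end CauchyBinet

section Generators

variable {K : Type} [Field K] {q : K} {u v l : ℕ}

lemma isQMat_Xg : IsQMat q (fun (i : Fin u) (j : Fin v) => Xg K q i j) where
  row := Xg_row
  col := Xg_col
  comm := Xg_comm
  quantum := Xg_quantum

lemma qMinor_eq_qm (r : Fin l → Fin u) (c : Fin l → Fin v) :
    qMinor K q r c = qm q (fun i j => Xg K q i j) r c := rfl

/-- The diagonal content of a quantum minor. -/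
def diagList (r : Fin l → Fin u) (c : Fin l → Fin v) : List (Fin u × Fin v) :=
  List.ofFn fun i => (r i, c i)

lemma wordWt_diagList (r : Fin l → Fin u) (c : Fin l → Fin v) :
    wordWt cellWt (diagList r c : Multiset (Fin u × Fin v)) =
      ∑ i, (u - (r i : ℕ)) * (v - (c i : ℕ)) :=
  wordWt_ofFn _

lemma wordProd_diagList (r : Fin l → Fin u) (c : Fin l → Fin v) :
    wordProd (cellVar K q u v) (diagList r c) = (List.ofFn fun i => Xg K q (r i) (c i)).prod :=
  wordProd_ofFn _

lemma hasLead_qMinor {r : Fin l → Fin u} {c : Fin l → Fin v} (hr : StrictMono r)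
    (hc : StrictMono c) :
    HasLead K (cellVar K q u v) cellWt (qMinor K q r c)
      (diagList r c : Multiset (Fin u × Fin v)) := by
  have := hasLead_sum (K := K) (x := cellVar K q u v) (w := cellWt) (S := Finset.univ)
    (c := fun σ : Equiv.Perm (Fin l) => (-q) ^ invNum σ) (L := fun σ => diagList r (c ∘ σ)) (i := 1)
    (Finset.mem_univ _) (by simp [invNum_id])
    (fun σ _ _ => by simp [diagList]) (fun σ _ hσ => by
      rw [wordWt_diagList, wordWt_diagList]
      exact sum_mul_perm_lt hr hc hσ)
  simp only [wordProd_diagList] at this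
  exact this

variable {n t : ℕ}

variable (K q n t) in
/-- The generators of `O_q(V)`. -/
def pairVar : (Fin n × Fin t) ⊕ (Fin t × Fin n) → OqM K q n t ⊗[K] OqM K q t n :=
  tensorGen K (cellVar K q n t) (cellVar K q t n)

variable (n t) in
/-- The weight on the generators of `O_q(V)`. -/
def pairWt : (Fin n × Fin t) ⊕ (Fin t × Fin n) → ℕ := Sum.elim cellWt cellWt

lemma qComm_pairVar (hq : q ≠ 0) : QComm K (pairVar K q n t) (pairWt n t) :=
  (qComm_cellVar hq).tensor (qComm_cellVar hq)

lemma exists_isWordBasis_pairVar (hq : q ≠ 0) :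
    ∃ b : Module.Basis (Multiset ((Fin n × Fin t) ⊕ (Fin t × Fin n))) K
      (OqM K q n t ⊗[K] OqM K q t n), IsWordBasis (pairVar K q n t) b := by
  obtain ⟨b, hb⟩ := exists_isWordBasis_cellVar (K := K) (u := n) (v := t) hq
  obtain ⟨c, hc⟩ := exists_isWordBasis_cellVar (K := K) (u := t) (v := n) hq
  exact exists_isWordBasis_tensor hb hc

/-- A word in the generators of `O_q(V)`. -/
def pairList (r : Fin l → Fin n) (κ κ' : Fin l → Fin t) (c : Fin l → Fin n) :
    List ((Fin n × Fin t) ⊕ (Fin t × Fin n)) :=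
  (diagList r κ).map Sum.inl ++ (diagList κ' c).map Sum.inr

lemma wordWt_pairList (r : Fin l → Fin n) (κ κ' : Fin l → Fin t) (c : Fin l → Fin n) :
    wordWt (pairWt n t) (pairList r κ κ' c : Multiset ((Fin n × Fin t) ⊕ (Fin t × Fin n))) =
      ∑ i, (n - (r i : ℕ)) * (t - (κ i : ℕ)) + ∑ i, (t - (κ' i : ℕ)) * (n - (c i : ℕ)) := by
  rw [pairList, wordWt_append, ← wordWt_diagList, ← wordWt_diagList]
  simp [wordWt, pairWt, Function.comp_def]

lemma wordProd_pairList (r : Fin l → Fin n) (κ κ' : Fin l → Fin t) (c : Fin l → Fin n) :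
    wordProd (pairVar K q n t) (pairList r κ κ' c) =
      (List.ofFn fun i => Xg K q (r i) (κ i)).prod ⊗ₜ[K]
        (List.ofFn fun i => Xg K q (κ' i) (c i)).prod := by
  rw [← wordProd_diagList, ← wordProd_diagList]
  exact wordProd_tensorGen _ _

/-- The leading content of the image in `O_q(V)` of a quantum minor. -/
def minorLead (hl : l ≤ t) (r c : Fin l → Fin n) :
    Multiset ((Fin n × Fin t) ⊕ (Fin t × Fin n)) :=
  pairList r (Fin.castLE hl) (Fin.castLE hl) c

lemma qm_tmul_eq_sum_pairList (hq : q ≠ 0) (r : Fin l → Fin n) {c : Fin l → Fin n}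
    (hc : StrictMono c) :
    qm q (fun (i : Fin n) (j : Fin n) => ∑ k : Fin t, Xg K q i k ⊗ₜ[K] Xg K q k j) r c =
      ∑ p ∈ (Finset.univ.filter fun κ : Fin l → Fin t => Function.Injective κ) ×ˢ
          (Finset.univ : Finset (Equiv.Perm (Fin l))),
        (-q) ^ invNum p.2 • wordProd (pairVar K q n t) (pairList r p.1 p.1 (c ∘ p.2)) := by
  rw [(isQMat_Xg (K := K) (q := q) (u := t) (v := n)).qm_sum_tmul_eq_sum_injective hq r hc,
    Finset.sum_product]
  refine Finset.sum_congr rfl fun κ _ => Finset.sum_congr rfl fun σ _ => ?_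
  rw [wordProd_pairList]
  rfl

lemma wordWt_pairList_lt (hl : l ≤ t) {r c : Fin l → Fin n} (hr : StrictMono r)
    (hc : StrictMono c) {κ : Fin l → Fin t} (hκ : Function.Injective κ) {σ : Equiv.Perm (Fin l)}
    (hne : (κ, σ) ≠ (Fin.castLE hl, 1)) :
    wordWt (pairWt n t) (pairList r κ κ (c ∘ σ) : Multiset ((Fin n × Fin t) ⊕ (Fin t × Fin n))) <
      wordWt (pairWt n t) (minorLead hl r c) := by
  rw [minorLead, wordWt_pairList, wordWt_pairList]
  obtain ⟨h1, h2⟩ := sum_mul_le_of_injective hl hr hκ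
  obtain ⟨h3, h4⟩ := sum_mul_le_of_injective hl hc (hκ.comp σ.symm.injective)
  have h5 : ∑ i, (t - (κ i : ℕ)) * (n - ((c ∘ σ) i : ℕ)) =
      ∑ i, (n - (c i : ℕ)) * (t - ((κ ∘ σ.symm) i : ℕ)) := by
    rw [← Equiv.sum_comp σ (fun i => (n - (c i : ℕ)) * (t - ((κ ∘ σ.symm) i : ℕ)))]
    refine Finset.sum_congr rfl fun i _ => ?_
    simp [mul_comm]
  have h6 : ∑ i, (t - (Fin.castLE hl i : ℕ)) * (n - (c i : ℕ)) =
      ∑ i : Fin l, (n - (c i : ℕ)) * (t - (i : ℕ)) := by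
    refine Finset.sum_congr rfl fun i _ => ?_
    simp [mul_comm]
  rw [h5, h6]
  simp only [Fin.val_castLE]
  by_contra hlt
  have h7 := h2 (by omega)
  have h8 := h4 (by omega)
  subst h7
  apply hne
  refine Prod.ext rfl (Equiv.ext fun i => ?_)
  have := congrFun h8 (σ i)
  simp only [Function.comp_apply, Equiv.symm_apply_apply] at this
  exact (Fin.castLE_injective hl this).symm

lemma hasLead_qm_tmul (hq : q ≠ 0) (hl : l ≤ t) {r c : Fin l → Fin n} (hr : StrictMono r)
    (hc : StrictMono c) :
    HasLead K (pairVar K q n t) (pairWt n t)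
      (qm q (fun (i : Fin n) (j : Fin n) => ∑ k : Fin t, Xg K q i k ⊗ₜ[K] Xg K q k j) r c)
      (minorLead hl r c) := by
  rw [qm_tmul_eq_sum_pairList hq r hc]
  have := hasLead_sum (K := K) (x := pairVar K q n t) (w := pairWt n t)
    (S := (Finset.univ.filter fun κ : Fin l → Fin t => Function.Injective κ) ×ˢ
      (Finset.univ : Finset (Equiv.Perm (Fin l))))
    (c := fun p => (-q) ^ invNum p.2) (L := fun p => pairList r p.1 p.1 (c ∘ p.2))
    (i := (Fin.castLE hl, 1)) (by simp [Fin.castLE_injective hl])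
    (by simp [invNum_id]) (fun p _ _ => by simp [pairList, diagList])
    (fun p hp hne => wordWt_pairList_lt hl hr hc (by simpa using hp) hne)
  exact this

end Generators

section Normal

variable {K : Type} [Field K]

lemma exists_mul_eq_mul {R : Type*} [Ring R] [Algebra K R] {S : Set R}
    (hS : Algebra.adjoin K S = ⊤) {d : R} (h : ∀ s ∈ S, ∃ c : K, s * d = c • (d * s)) (r : R) :
    ∃ r', r * d = d * r' := by
  have hr : r ∈ Algebra.adjoin K S := hS ▸ Algebra.mem_top
  induction hr using Algebra.adjoin_induction with
  | mem s hs =>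
    obtain ⟨c, hc⟩ := h s hs
    exact ⟨c • s, by rw [hc, mul_smul_comm]⟩
  | algebraMap c => exact ⟨algebraMap K R c, Algebra.commutes c d⟩
  | add a b _ _ ha hb =>
    obtain ⟨a', ha⟩ := ha
    obtain ⟨b', hb⟩ := hb
    exact ⟨a' + b', by rw [add_mul, ha, hb, mul_add]⟩
  | mul a b _ _ ha hb =>
    obtain ⟨a', ha⟩ := ha
    obtain ⟨b', hb⟩ := hb
    exact ⟨a' * b', by rw [mul_assoc, hb, ← mul_assoc, ha, mul_assoc]⟩

lemma exists_tmul_mul_eq_mul {B C : Type*} [Ring B] [Algebra K B] [Ring C] [Algebra K C] {d : B}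
    {e : C} (hd : ∀ r, ∃ r', r * d = d * r') (he : ∀ r, ∃ r', r * e = e * r') (r : B ⊗[K] C) :
    ∃ r', r * (d ⊗ₜ e) = (d ⊗ₜ[K] e) * r' := by
  induction r using TensorProduct.induction_on with
  | zero => exact ⟨0, by simp⟩
  | tmul a b =>
    obtain ⟨a', ha⟩ := hd a
    obtain ⟨b', hb⟩ := he b
    exact ⟨a' ⊗ₜ b', by simp [ha, hb]⟩
  | add a b ha hb =>
    obtain ⟨a', ha⟩ := ha
    obtain ⟨b', hb⟩ := hb
    exact ⟨a' + b', by rw [add_mul, ha, hb, mul_add]⟩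

lemma exists_eq_mul_of_mem_tsSpan {R : Type} [Ring R] [Algebra K R] {d : R}
    (hd : ∀ r, ∃ r', r * d = d * r') {x : R} (hx : x ∈ tsSpan K R {d}) : ∃ r, x = d * r := by
  change x ∈ Submodule.span K _ at hx
  induction hx using Submodule.span_induction with
  | zero => exact ⟨0, by simp⟩
  | mem x hx =>
    obtain ⟨a, b, s, rfl, rfl⟩ := hx
    obtain ⟨a', ha⟩ := hd a
    exact ⟨a' * b, by rw [ha, mul_assoc]⟩
  | add a b _ _ ha hb =>
    obtain ⟨a', ha⟩ := ha
    obtain ⟨b', hb⟩ := hb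
    exact ⟨a' + b', by rw [ha, hb, mul_add]⟩
  | smul c a _ ha =>
    obtain ⟨a', ha⟩ := ha
    exact ⟨c • a', by rw [ha, mul_smul_comm]⟩

variable {q : K} {n t : ℕ}

lemma rowTop_strictMono (h : t ≤ n) : StrictMono (rowTop n t h) := fun i j hij => by
  have := Fin.lt_def.mp hij
  simp only [rowTop, Fin.lt_def]
  omega

lemma colLeft_strictMono (h : t ≤ n) : StrictMono (colLeft n t h) := fun i j hij => by
  have := Fin.lt_def.mp hij
  simpa only [colLeft, Fin.lt_def]

lemma exists_mul_dY (hq : q ≠ 0) (ht : 0 < t) (h : t ≤ n) (r : OqM K q n t) :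
    ∃ r', r * dY K q n t h = dY K q n t h * r' := by
  obtain ⟨t, rfl⟩ := Nat.exists_eq_succ_of_ne_zero ht.ne'
  refine exists_mul_eq_mul (adjoin_cellVar (K := K) (q := q)) ?_ r
  rintro _ ⟨⟨k, u⟩, rfl⟩
  simp only [cellVar, dY, qMinor_eq_qm]
  by_cases hk : n - (t + 1) ≤ k
  · refine ⟨1, ?_⟩
    have hk2 := k.2
    have := isQMat_Xg.mul_qm_of_mem (K := K) hq (rowTop_strictMono h) strictMono_id
      ⟨k - (n - (t + 1)), by omega⟩ u
    have e : rowTop n (t + 1) h ⟨k - (n - (t + 1)), by omega⟩ = k :=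
      Fin.ext (by simp only [rowTop]; omega)
    rw [e] at this
    rw [one_smul]
    exact this
  · exact ⟨q, isQMat_Xg.mul_qm_of_lt hq (rowTop_strictMono h) strictMono_id
      (fun p => by simp only [rowTop, Fin.lt_def]; omega) u⟩

open OrderDual MulOpposite in
lemma exists_mul_dZ (hq : q ≠ 0) (ht : 0 < t) (h : t ≤ n) (r : OqM K q t n) :
    ∃ r', r * dZ K q n t h = dZ K q n t h * r' := by
  obtain ⟨t, rfl⟩ := Nat.exists_eq_succ_of_ne_zero ht.ne'
  refine exists_mul_eq_mul (adjoin_cellVar (K := K) (q := q)) ?_ r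
  rintro _ ⟨⟨u, k⟩, rfl⟩
  simp only [cellVar, dZ, qMinor_eq_qm]
  have hop := isQMat_Xg.op_qm (K := K) (q := q) (strictMono_id (α := Fin (t + 1)))
    (colLeft_strictMono h)
  have hr := strictMono_dual_rev (colLeft_strictMono h)
  have hc := strictMono_dual_rev (strictMono_id (α := Fin (t + 1)))
  by_cases hk : (k : ℕ) < t + 1
  · refine ⟨1, ?_⟩
    have := (isQMat_Xg (K := K) (q := q)).antiT.mul_qm_of_mem hq hr hc
      (Fin.rev ⟨k, hk⟩) u.rev
    rw [hop] at this
    have e : colLeft n (t + 1) h ⟨k, hk⟩ = k := rfl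
    simp only [antiT, Function.comp_apply, Fin.rev_rev, ofDual_toDual, id_eq, e] at this
    rw [one_smul]
    exact (op_injective this).symm
  · refine ⟨q⁻¹, ?_⟩
    have := (isQMat_Xg (K := K) (q := q)).antiT.mul_qm_of_lt hq hr hc (k := toDual k)
      (fun p => by
        refine toDual_lt_toDual.mpr ?_
        have := p.rev.2
        simp only [Function.comp_apply, colLeft, Fin.lt_def]
        omega) u.rev
    rw [hop] at this
    simp only [antiT, Function.comp_apply, Fin.rev_rev, ofDual_toDual, id_eq] at this
    rw [eq_inv_smul_iff₀ hq]
    exact (op_injective this).symm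

end Normal

section Growth

/-- Two shapes differ by a horizontal strip. -/
def IsStrip (ρ μ : ℕ → ℕ) : Prop := ∀ k, ρ k ≤ μ k ∧ μ (k + 1) ≤ ρ k

/-- The local rule of the Burge correspondence on the rows `0, …, t`. -/
def burge (ρ μ ν : ℕ → ℕ) : ℕ → ℕ → ℕ → ℕ
  | 0, m, k => if k = 0 then max (μ 0) (ν 0) + m else 0
  | t + 1, m, k =>
    if k = t + 1 then min (ρ t) (max (μ (t + 1)) (ν (t + 1)) + m)
    else burge ρ μ ν t (m + max (μ (t + 1)) (ν (t + 1)) + min (μ t) (ν t) -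
      min (ρ t) (max (μ (t + 1)) (ν (t + 1)) + m) - ρ t) k

variable {ρ μ ν : ℕ → ℕ}

lemma burge_eq_zero {t m k : ℕ} (h : t < k) : burge ρ μ ν t m k = 0 := by
  induction t generalizing m with
  | zero => simp [burge]; omega
  | succ t ih => rw [burge, if_neg h.ne', ih (by omega)]

lemma burge_succ_le {t m k : ℕ} : burge ρ μ ν t m (k + 1) ≤ ρ k := by
  induction t generalizing m with
  | zero => simp [burge]
  | succ t ih =>
    rw [burge]
    split_ifs with h
    · obtain rfl : k = t := by omega
      exact min_le_left _ _
    · exact ih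

lemma max_le_burge (hμ : IsStrip ρ μ) (hν : IsStrip ρ ν) {t m k : ℕ} (hk : k ≤ t) :
    max (μ k) (ν k) ≤ burge ρ μ ν t m k := by
  induction t generalizing m with
  | zero =>
    obtain rfl : k = 0 := by omega
    simp [burge]
  | succ t ih =>
    rw [burge]
    split_ifs with h
    · subst h
      have := (hμ t).2
      have := (hν t).2
      omega
    · exact ih (by omega)

lemma sum_burge (hμ : IsStrip ρ μ) (hν : IsStrip ρ ν) (t m : ℕ) :
    ∑ k ∈ Finset.range (t + 1), burge ρ μ ν t m k + ∑ k ∈ Finset.range t, ρ k =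
      ∑ k ∈ Finset.range (t + 1), max (μ k) (ν k) + ∑ k ∈ Finset.range t, min (μ k) (ν k) + m := by
  induction t generalizing m with
  | zero => simp [burge]
  | succ t ih =>
    have h : ∀ k ∈ Finset.range (t + 1), burge ρ μ ν (t + 1) m k =
        burge ρ μ ν t (m + max (μ (t + 1)) (ν (t + 1)) + min (μ t) (ν t) -
          min (ρ t) (max (μ (t + 1)) (ν (t + 1)) + m) - ρ t) k := by
      intro k hk
      rw [burge, if_neg (Finset.mem_range.mp hk).ne]
    have ih' := ih (m + max (μ (t + 1)) (ν (t + 1)) + min (μ t) (ν t) -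
          min (ρ t) (max (μ (t + 1)) (ν (t + 1)) + m) - ρ t)
    rw [Finset.sum_range_succ, Finset.sum_congr rfl h, Finset.sum_range_succ ρ,
      Finset.sum_range_succ (fun k => max (μ k) (ν k)) (t + 1),
      Finset.sum_range_succ (fun k => min (μ k) (ν k)) t, burge, if_pos rfl]
    have h1 := (hμ t).1
    have h2 := (hν t).1
    clear ih h
    generalize burge ρ μ ν t _ = g at ih' ⊢
    generalize (∑ k ∈ Finset.range (t + 1), g k) = s at ih' ⊢
    omega

/-- The local rule is reversible. -/
lemma burge_injective {ρ' : ℕ → ℕ} (hμ : IsStrip ρ μ) (hν : IsStrip ρ ν) (hμ' : IsStrip ρ' μ)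
    (hν' : IsStrip ρ' ν) {t m m' : ℕ} (h : ∀ k ≤ t, burge ρ μ ν t m k = burge ρ' μ ν t m' k) :
    m = m' ∧ ∀ k < t, ρ k = ρ' k := by
  induction t generalizing m m' with
  | zero =>
    have := h 0 le_rfl
    simpa [burge] using this
  | succ t ih =>
    have h1 := h (t + 1) le_rfl
    simp only [burge, if_true] at h1
    obtain ⟨h2, h3⟩ := ih fun k hk => by
      have := h k (by omega)
      simpa only [burge, if_neg (show k ≠ t + 1 by omega)] using this
    have := hμ t
    have := hν t
    have := hμ' t
    have := hν' t
    have h4 : m = m' ∧ ρ t = ρ' t := by omega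
    refine ⟨h4.1, fun k hk => ?_⟩
    rcases Nat.lt_succ_iff_lt_or_eq.mp hk with hk | rfl
    · exact h3 k hk
    · exact h4.2

lemma burge_pos (hμ : IsStrip ρ μ) (hν : IsStrip ρ ν) {t m k : ℕ}
    (h : 0 < burge ρ μ ν t m k) :
    0 < max (μ k) (ν k) ∨ 0 < m ∧ ∀ k', k = k' + 1 → 0 < ρ k' := by
  have hanti : ∀ a b, a ≤ b → max (μ b) (ν b) ≤ max (μ a) (ν a) := fun a b hab =>
    antitone_nat_of_succ_le (f := fun k => max (μ k) (ν k)) (fun k => by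
      have := hμ k
      have := hν k
      show max (μ (k + 1)) (ν (k + 1)) ≤ max (μ k) (ν k)
      omega) hab
  refine or_iff_not_imp_left.mpr fun hB => ⟨?_, fun k' hk' => ?_⟩
  · induction t generalizing m with
    | zero =>
      rw [burge] at h
      split_ifs at h with hk
      · subst hk; omega
      · exact absurd h (lt_irrefl _)
    | succ t ih =>
      rw [burge] at h
      split_ifs at h with hk
      · subst hk; omega
      · have hkt : k ≤ t := by
          by_contra hkt
          rw [burge_eq_zero (by omega)] at h
          exact lt_irrefl _ h
        have h1 := ih h
        have h2 := hanti k t hkt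
        have h3 := hanti k (t + 1) (by omega)
        omega
  · subst hk'
    exact h.trans_le burge_succ_le

/-- The growth diagram of a matrix of natural numbers, truncated to the rows `0, …, t`. -/
def growth (t : ℕ) (M : ℕ → ℕ → ℕ) : ℕ → ℕ → ℕ → ℕ
  | 0, _ => fun _ => 0
  | _ + 1, 0 => fun _ => 0
  | i + 1, j + 1 =>
    burge (growth t M i j) (growth t M i (j + 1)) (growth t M (i + 1) j) t (M i j)
termination_by i j => (i, j)

variable {t : ℕ} {M : ℕ → ℕ → ℕ}

@[simp] lemma growth_zero_left (j : ℕ) : growth t M 0 j = fun _ => 0 := by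
  cases j <;> rw [growth]

@[simp] lemma growth_zero_right (i : ℕ) : growth t M i 0 = fun _ => 0 := by
  cases i <;> rw [growth]

lemma growth_succ (i j : ℕ) : growth t M (i + 1) (j + 1) =
    burge (growth t M i j) (growth t M i (j + 1)) (growth t M (i + 1) j) t (M i j) := by
  rw [growth]

lemma growth_eq_zero (i j : ℕ) {k : ℕ} (h : t < k) : growth t M i j k = 0 := by
  cases i with
  | zero => simp
  | succ i =>
    cases j with
    | zero => simp
    | succ j => rw [growth_succ, burge_eq_zero h]

lemma isStrip_growth_succ {i j : ℕ} (hμ : IsStrip (growth t M i j) (growth t M i (j + 1)))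
    (hν : IsStrip (growth t M i j) (growth t M (i + 1) j)) :
    IsStrip (growth t M i (j + 1)) (growth t M (i + 1) (j + 1)) ∧
      IsStrip (growth t M (i + 1) j) (growth t M (i + 1) (j + 1)) := by
  have h1 : ∀ k, growth t M (i + 1) (j + 1) (k + 1) ≤ growth t M i j k := fun k => by
    rw [growth_succ]; exact burge_succ_le
  have h2 : ∀ k, max (growth t M i (j + 1) k) (growth t M (i + 1) j k) ≤
      growth t M (i + 1) (j + 1) k := fun k => by
    by_cases hk : k ≤ t
    · rw [growth_succ]; exact max_le_burge hμ hν hk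
    · rw [growth_eq_zero _ _ (by omega), growth_eq_zero _ _ (by omega)]
      simp
  exact ⟨fun k => ⟨(le_max_left _ _).trans (h2 k), (h1 k).trans (hμ k).1⟩,
    fun k => ⟨(le_max_right _ _).trans (h2 k), (h1 k).trans (hν k).1⟩⟩

lemma isStrip_growth (i j : ℕ) : IsStrip (growth t M i j) (growth t M i (j + 1)) ∧
    IsStrip (growth t M i j) (growth t M (i + 1) j) := by
  have key : ∀ i, (∀ j, IsStrip (growth t M i j) (growth t M i (j + 1))) →
      ∀ j, IsStrip (growth t M i j) (growth t M (i + 1) j) := by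
    intro i h j
    induction j with
    | zero => intro k; simp
    | succ j ih => exact (isStrip_growth_succ (h j) ih).1
  have hor : ∀ j, IsStrip (growth t M i j) (growth t M i (j + 1)) := by
    induction i with
    | zero => intro j k; simp
    | succ i ih => exact fun j => (isStrip_growth_succ (ih j) (key i ih j)).2
  exact ⟨hor j, key i hor j⟩

lemma exists_chain_of_growth_pos {i j k : ℕ} (h : 0 < growth t M i j k) :
    ∃ r c : Fin (k + 1) → ℕ, StrictMono r ∧ StrictMono c ∧
      ∀ p, r p < i ∧ c p < j ∧ 0 < M (r p) (c p) := by
  induction i generalizing j k with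
  | zero => simp at h
  | succ i ihi =>
    induction j generalizing k with
    | zero => simp at h
    | succ j ihj =>
      rw [growth_succ] at h
      rcases burge_pos (isStrip_growth i j).1 (isStrip_growth i j).2 h with h | ⟨hm, h⟩
      · rcases lt_max_iff.mp h with h | h
        · obtain ⟨r, c, hr, hc, h⟩ := ihi h
          exact ⟨r, c, hr, hc, fun p => ⟨(h p).1.trans (Nat.lt_succ_self i), (h p).2⟩⟩
        · obtain ⟨r, c, hr, hc, h⟩ := ihj h
          exact ⟨r, c, hr, hc, fun p => ⟨(h p).1, (h p).2.1.trans (Nat.lt_succ_self j), (h p).2.2⟩⟩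
      · cases k with
        | zero =>
          exact ⟨fun _ => i, fun _ => j, fun a b h => by omega, fun a b h => by omega,
            fun p => ⟨Nat.lt_succ_self i, Nat.lt_succ_self j, hm⟩⟩
        | succ k =>
          obtain ⟨r, c, hr, hc, h⟩ := ihi (h k rfl)
          have snoc : ∀ {f : Fin (k + 1) → ℕ} {a : ℕ}, StrictMono f → (∀ p, f p < a) →
              StrictMono (Fin.snoc f a : Fin (k + 2) → ℕ) := by
            intro f a hf ha x y hxy
            cases x using Fin.lastCases with
            | last => exact absurd hxy (Fin.le_last y).not_gt
            | cast x =>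
              cases y using Fin.lastCases with
              | last => simpa using ha x
              | cast y => simpa using hf (Fin.castSucc_lt_castSucc_iff.mp hxy)
          refine ⟨Fin.snoc r i, Fin.snoc c j, snoc hr fun p => (h p).1,
            snoc hc fun p => (h p).2.1, fun p => ?_⟩
          cases p using Fin.lastCases with
          | last => simpa using hm
          | cast p =>
            have := h p
            simp only [Fin.snoc_castSucc]
            exact ⟨by omega, by omega, this.2.2⟩

lemma sum_growth (h : ∀ i j, growth t M i j t = 0) (i j : ℕ) :
    ∑ k ∈ Finset.range t, growth t M i j k =
      ∑ a ∈ Finset.range i, ∑ b ∈ Finset.range j, M a b := by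
  have key : ∀ i j, ∑ k ∈ Finset.range t, growth t M (i + 1) (j + 1) k +
      ∑ k ∈ Finset.range t, growth t M i j k = ∑ k ∈ Finset.range t, growth t M i (j + 1) k +
        ∑ k ∈ Finset.range t, growth t M (i + 1) j k + M i j := by
    intro i j
    have := sum_burge (isStrip_growth (t := t) (M := M) i j).1 (isStrip_growth i j).2 t (M i j)
    rw [← growth_succ, Finset.sum_range_succ, Finset.sum_range_succ, h, h, h, max_self, add_zero,
      add_zero] at this
    rw [this, ← Finset.sum_add_distrib, ← Finset.sum_add_distrib]
    exact congrArg (· + M i j) (Finset.sum_congr rfl fun k _ => max_add_min _ _)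
  induction i generalizing j with
  | zero => simp
  | succ i ih =>
    induction j with
    | zero => simp
    | succ j ihj =>
      have h1 := key i j
      rw [ih, ih, ihj] at h1
      rw [Finset.sum_range_succ _ i, Finset.sum_range_succ _ j]
      rw [Finset.sum_range_succ _ i] at h1
      omega

/-- A matrix is determined by the boundary of its growth diagram. -/
lemma eq_of_growth_eq {M' : ℕ → ℕ → ℕ} (h : ∀ i j, growth t M i j t = 0)
    (h' : ∀ i j, growth t M' i j t = 0) {m n : ℕ}
    (hr : ∀ i ≤ m, growth t M i n = growth t M' i n)
    (hc : ∀ j ≤ n, growth t M m j = growth t M' m j) :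
    ∀ i < m, ∀ j < n, M i j = M' i j := by
  have hz : ∀ i j k, t ≤ k → growth t M i j k = growth t M' i j k := by
    intro i j k hk
    rcases hk.eq_or_lt with rfl | hk
    · rw [h, h']
    · rw [growth_eq_zero _ _ hk, growth_eq_zero _ _ hk]
  have key : ∀ i j, growth t M i (j + 1) = growth t M' i (j + 1) →
      growth t M (i + 1) j = growth t M' (i + 1) j →
      growth t M (i + 1) (j + 1) = growth t M' (i + 1) (j + 1) →
      M i j = M' i j ∧ growth t M i j = growth t M' i j := by
    intro i j h1 h2 h3
    have hs := isStrip_growth (t := t) (M := M) i j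
    have hs' := isStrip_growth (t := t) (M := M') i j
    rw [h1, h2] at hs
    rw [growth_succ, growth_succ, h1, h2] at h3
    obtain ⟨e1, e2⟩ := burge_injective hs.1 hs.2 hs'.1 hs'.2 fun k _ => congrFun h3 k
    refine ⟨e1, funext fun k => ?_⟩
    by_cases hk : k < t
    · exact e2 k hk
    · exact hz _ _ _ (not_lt.mp hk)
  have main : ∀ d e, d ≤ m → e ≤ n → growth t M (m - d) (n - e) = growth t M' (m - d) (n - e) := by
    intro d
    induction d with
    | zero => exact fun e _ _ => hc _ (Nat.sub_le _ _)
    | succ d ihd =>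
      intro e hd
      induction e with
      | zero => exact fun _ => hr _ (Nat.sub_le _ _)
      | succ e ihe =>
        intro he
        have h1 := ihe (by omega)
        have h2 := ihd (e + 1) (by omega) he
        have h3 := ihd e (by omega) (by omega)
        rw [show m - d = m - (d + 1) + 1 by omega] at h2 h3
        rw [show n - e = n - (e + 1) + 1 by omega] at h1 h3
        exact (key _ _ h1 h2 h3).2
  have main' : ∀ i ≤ m, ∀ j ≤ n, growth t M i j = growth t M' i j := fun i hi j hj => by
    have := main (m - i) (n - j) (Nat.sub_le _ _) (Nat.sub_le _ _)
    rwa [Nat.sub_sub_self hi, Nat.sub_sub_self hj] at this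
  exact fun i hi j hj => (key i j (main' _ hi.le _ hj) (main' _ hi _ hj.le) (main' _ hi _ hj)).1

end Growth

section Patterns

/-- An increasing sequence of shapes with fewer than `t + 1` rows, starting at the empty shape, in
which consecutive shapes differ by a horizontal strip. -/
structure IsGT (t : ℕ) (f : ℕ → ℕ → ℕ) : Prop where
  zero : ∀ k, f 0 k = 0
  strip : ∀ i, IsStrip (f i) (f (i + 1))
  trunc : ∀ i k, t ≤ k → f i k = 0

variable {n t : ℕ} {f g : ℕ → ℕ → ℕ}

lemma IsGT.mono (hf : IsGT t f) (k : ℕ) : Monotone fun i => f i k :=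
  monotone_nat_of_le_succ fun i => (hf.strip i k).1

lemma IsGT.succ_le (hf : IsGT t f) (i k : ℕ) : f i (k + 1) ≤ f i k := by
  cases i with
  | zero => rw [hf.zero, hf.zero]
  | succ i => exact (hf.strip i k).2.trans (hf.strip i k).1

lemma IsGT.anti (hf : IsGT t f) (i : ℕ) : Antitone (f i) :=
  antitone_nat_of_succ_le (hf.succ_le i)

lemma IsGT.pred (hf : IsGT t f) : IsGT t fun i k => f i k - 1 where
  zero k := by rw [hf.zero]
  strip i k := by
    have := hf.strip i k
    constructor <;> dsimp only <;> omega
  trunc i k h := by rw [hf.trunc i k h]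

lemma IsGT.exists_first_column (hf : IsGT t f) {l : ℕ} (h : ∀ k < l, 0 < f n k) :
    ∃ r : Fin l → Fin n, StrictMono r ∧ ∀ p, f (r p) p = 0 ∧ 0 < f (r p + 1) p := by
  have key : ∀ p : Fin l, ∃ r : Fin n, f r p = 0 ∧ 0 < f (r + 1) p := by
    intro p
    have hp := h p p.2
    classical
    have hex : ∃ i, 0 < f i p := ⟨n, hp⟩
    have hm := Nat.find_spec hex
    have hle := Nat.find_le (h := hex) hp
    have hlt : ∀ i < Nat.find hex, f i p = 0 := fun i hi => by
      have := Nat.find_min hex hi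
      omega
    generalize Nat.find hex = m at hm hle hlt
    cases m with
    | zero => rw [hf.zero] at hm; exact absurd hm (lt_irrefl _)
    | succ m => exact ⟨⟨m, by omega⟩, hlt m (by omega), hm⟩
  choose r hr using key
  refine ⟨r, ?_, hr⟩
  have hstep : ∀ (p p' : Fin l), (p' : ℕ) = p + 1 → r p < r p' := by
    intro p p' hp
    by_contra hlt
    have h1 : f (r p') p ≤ f (r p) p := hf.mono p (not_lt.mp hlt)
    have h2 := (hf.strip (r p') p).2
    have h3 := (hr p').2
    rw [hp] at h3
    have h4 := (hr p).1
    omega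
  cases l with
  | zero => exact fun a => a.elim0
  | succ l => exact Fin.strictMono_iff_lt_succ.mpr fun p => hstep _ _ (by simp)

lemma IsGT.pred_content (hf : IsGT t f) {l : ℕ} (h : ∀ k, l ≤ k → f n k = 0) {r : Fin l → Fin n}
    (hr : ∀ p, f (r p) p = 0 ∧ 0 < f (r p + 1) p) (i : Fin n) (k : ℕ) {a : ℕ}
    (ha : f (i + 1) k = f i k + a) [Decidable (∃ p, r p = i ∧ (p : ℕ) = k)] :
    f (i + 1) k - 1 = f i k - 1 + (a - if ∃ p, r p = i ∧ (p : ℕ) = k then 1 else 0) ∧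
      (if ∃ p, r p = i ∧ (p : ℕ) = k then 1 else 0) ≤ a := by
  split_ifs with hp
  · obtain ⟨p, rfl, rfl⟩ := hp
    have := hr p
    omega
  · suffices f (i + 1) k = 0 ∨ 0 < f i k by omega
    by_cases hk : l ≤ k
    · have h1 : f (i + 1) k ≤ f n k := hf.mono k (by omega)
      have := h k hk
      omega
    · push Not at hk hp
      have hne := hp ⟨k, hk⟩
      have h1 := hr ⟨k, hk⟩
      have hne' : r ⟨k, hk⟩ ≠ i := fun h => hne h rfl
      rcases lt_or_gt_of_ne hne' with hlt | hlt
      · have h2 : f (r ⟨k, hk⟩ + 1) k ≤ f i k := hf.mono k (Nat.succ_le_of_lt hlt)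
        dsimp only at h1
        omega
      · have h2 : f (i + 1) k ≤ f (r ⟨k, hk⟩) k := hf.mono k (Nat.succ_le_of_lt hlt)
        dsimp only at h1
        omega

/-- Removing one full column, whose entries are as large as possible. -/
def removeColumn (t m : ℕ) (f : ℕ → ℕ → ℕ) : ℕ → ℕ → ℕ :=
  fun i k => f i k - if m + k < i ∧ k < t then 1 else 0

lemma IsGT.removeColumn {m : ℕ} (hf : IsGT t f) (h : ∀ k < t, f (m + k) k < f (m + k + 1) k) :
    IsGT t (removeColumn t m f) where
  zero k := by simp [_root_.removeColumn, hf.zero]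
  strip i k := by
    have h1 := hf.strip i k
    unfold _root_.removeColumn
    refine ⟨?_, ?_⟩
    · by_cases hk : k < t
      · have h2 := h k hk
        rcases lt_trichotomy i (m + k) with h3 | rfl | h3
        · split_ifs <;> omega
        · split_ifs <;> omega
        · split_ifs <;> omega
      · split_ifs <;> omega
    · by_cases hk : k + 1 < t
      · split_ifs <;> omega
      · rw [hf.trunc _ _ (not_lt.mp hk)]
        omega
  trunc i k hk := by simp [_root_.removeColumn, hf.trunc i k hk]

lemma IsGT.removeColumn_content {m : ℕ} (hf : IsGT t f)
    (h : ∀ k < t, f (m + k) k < f (m + k + 1) k) {r : Fin t → Fin n} (hr : ∀ p, (r p : ℕ) = m + p)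
    (i : Fin n) {k : ℕ} (hk : k < t) {a : ℕ}
    (ha : f (i + 1) k = f i k + a) [Decidable (∃ p, r p = i ∧ (p : ℕ) = k)] :
    _root_.removeColumn t m f (i + 1) k = _root_.removeColumn t m f i k +
      (a - if ∃ p, r p = i ∧ (p : ℕ) = k then 1 else 0) := by
  have hiff : (∃ p, r p = i ∧ (p : ℕ) = k) ↔ (i : ℕ) = m + k := by
    constructor
    · rintro ⟨p, rfl, rfl⟩
      exact hr p
    · exact fun h => ⟨⟨k, hk⟩, Fin.ext ((hr _).trans h.symm), rfl⟩
  rw [if_congr hiff rfl rfl]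
  unfold _root_.removeColumn
  generalize (i : ℕ) = i at ha ⊢
  have h1 := h k hk
  have h2 : m + k < i → f (m + k + 1) k ≤ f i k := fun h => hf.mono k h
  by_cases h3 : i = m + k
  · subst h3
    simp [hk]
    omega
  · split_ifs <;> omega

/-- `e` records the successive differences of the two sequences of shapes `f` and `g`. -/
structure GTContent (e : Multiset ((Fin n × Fin t) ⊕ (Fin t × Fin n))) (f g : ℕ → ℕ → ℕ) :
    Prop where
  left : ∀ (i : Fin n) (k : Fin t), f (i + 1) k = f i k + e.count (Sum.inl (i, k))
  right : ∀ (k : Fin t) (j : Fin n), g (j + 1) k = g j k + e.count (Sum.inr (k, j))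

lemma count_minorLead_inl {l : ℕ} (hl : l ≤ t) (r c : Fin l → Fin n) (i : Fin n) (k : Fin t)
    [Decidable (∃ p, r p = i ∧ (p : ℕ) = k)] :
    (minorLead hl r c).count (Sum.inl (i, k)) = if ∃ p, r p = i ∧ (p : ℕ) = k then 1 else 0 := by
  have hnd : (diagList r (Fin.castLE hl)).Nodup := List.nodup_ofFn.mpr fun a b h =>
    Fin.castLE_injective hl (Prod.ext_iff.mp h).2
  rw [show minorLead hl r c = Multiset.map Sum.inl (diagList r (Fin.castLE hl) : Multiset _) +
      Multiset.map Sum.inr (diagList (Fin.castLE hl) c : Multiset _) from rfl, Multiset.count_add,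
    Multiset.count_map_eq_count' _ _ Sum.inl_injective,
    Multiset.count_eq_zero (s := Multiset.map Sum.inr _).mpr (by simp), add_zero,
    Multiset.count_eq_of_nodup (Multiset.coe_nodup.mpr hnd)]
  simp [diagList, Fin.ext_iff]

lemma count_minorLead_inr {l : ℕ} (hl : l ≤ t) (r c : Fin l → Fin n) (k : Fin t) (j : Fin n)
    [Decidable (∃ p, c p = j ∧ (p : ℕ) = k)] :
    (minorLead hl r c).count (Sum.inr (k, j)) = if ∃ p, c p = j ∧ (p : ℕ) = k then 1 else 0 := by
  have hnd : (diagList (Fin.castLE hl) c).Nodup := List.nodup_ofFn.mpr fun a b h =>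
    Fin.castLE_injective hl (Prod.ext_iff.mp h).1
  rw [show minorLead hl r c = Multiset.map Sum.inl (diagList r (Fin.castLE hl) : Multiset _) +
      Multiset.map Sum.inr (diagList (Fin.castLE hl) c : Multiset _) from rfl, Multiset.count_add,
    Multiset.count_map_eq_count' _ _ Sum.inr_injective,
    Multiset.count_eq_zero.mpr (by simp), zero_add,
    Multiset.count_eq_of_nodup (Multiset.coe_nodup.mpr hnd)]
  simp [diagList, Fin.ext_iff, and_comm]

variable {e : Multiset ((Fin n × Fin t) ⊕ (Fin t × Fin n))}

/-- Pairs of sequences of shapes ending in the same shape are built by adding columns. -/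
lemma GTContent.induction {P : Multiset ((Fin n × Fin t) ⊕ (Fin t × Fin n)) → ℕ → Prop}
    (h0 : P 0 0) (hadd : ∀ (l : ℕ) (hl : l ≤ t) (r c : Fin l → Fin n), StrictMono r →
      StrictMono c → ∀ e N, P e N → P (e + minorLead hl r c) (N + l))
    (hf : IsGT t f) (hg : IsGT t g) (hfg : f n = g n) (he : GTContent e f g) :
    P e (∑ k ∈ Finset.range t, f n k) := by
  classical
  induction hm : f n 0 generalizing f g e with
  | zero =>
    have hf0 : ∀ i ≤ n, ∀ k, f i k = 0 := fun i hi k => by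
      have h1 : f i k ≤ f n k := hf.mono k hi
      have h2 := hf.anti n (Nat.zero_le k)
      omega
    have hg0 : ∀ i ≤ n, ∀ k, g i k = 0 := fun i hi k => by
      have h1 : g i k ≤ g n k := hg.mono k hi
      rw [← hfg, hf0 n le_rfl] at h1
      omega
    have : e = 0 := Multiset.ext' fun a => by
      rw [Multiset.count_zero]
      rcases a with ⟨i, k⟩ | ⟨k, j⟩
      · have := he.left i k
        rw [hf0 _ (by omega)] at this
        omega
      · have := he.right k j
        rw [hg0 _ (by omega)] at this
        omega
    rw [this, Finset.sum_eq_zero fun k _ => hf0 n le_rfl k]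
    exact h0
  | succ m ih =>
    have hex : ∃ l, f n l = 0 := ⟨t, hf.trunc n t le_rfl⟩
    set l := Nat.find hex with hl_def
    have hl0 : f n l = 0 := Nat.find_spec hex
    have hlt : l ≤ t := Nat.find_le (hf.trunc n t le_rfl)
    have hpos : ∀ k < l, 0 < f n k := fun k hk => Nat.pos_of_ne_zero (Nat.find_min hex hk)
    have hz : ∀ k, l ≤ k → f n k = 0 := fun k hk => by
      have := hf.anti n hk
      omega
    clear_value l
    obtain ⟨r, hr, hr'⟩ := hf.exists_first_column hpos
    obtain ⟨c, hc, hc'⟩ := hg.exists_first_column (hfg ▸ hpos)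
    have hle : minorLead hlt r c ≤ e := Multiset.le_iff_count.mpr fun a => by
      rcases a with ⟨i, k⟩ | ⟨k, j⟩
      · rw [count_minorLead_inl]
        exact (hf.pred_content hz hr' i k (he.left i k)).2
      · rw [count_minorLead_inr]
        exact (hg.pred_content (hfg ▸ hz) hc' j k (he.right k j)).2
    have he' : GTContent (e - minorLead hlt r c) (fun i k => f i k - 1) fun i k => g i k - 1 := by
      constructor
      · intro i k
        rw [Multiset.count_sub, count_minorLead_inl]
        exact (hf.pred_content hz hr' i k (he.left i k)).1
      · intro k j
        rw [Multiset.count_sub, count_minorLead_inr]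
        exact (hg.pred_content (hfg ▸ hz) hc' j k (he.right k j)).1
    have := hadd l hlt r c hr hc _ _ (ih hf.pred hg.pred (by rw [hfg]) he' (by omega))
    rw [Multiset.sub_add_cancel hle] at this
    convert this using 1
    have hsum : ∀ k, f n k = (f n k - 1) + if k < l then 1 else 0 := fun k => by
      split_ifs with hk
      · have := hpos k hk
        omega
      · have := hz k (not_lt.mp hk)
        omega
    conv_lhs => rw [Finset.sum_congr rfl fun k _ => hsum k, Finset.sum_add_distrib]
    congr 1
    rw [Finset.sum_boole, show (Finset.range t).filter (· < l) = Finset.range l by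
      ext k; simp; omega]
    simp

lemma GTContent.removeColumn (htn : t ≤ n) (hf : IsGT t f) (hg : IsGT t g) (hfg : f n = g n)
    (he : GTContent e f g)
    (hle : minorLead le_rfl (rowTop n t htn) (colLeft n t htn) ≤ e) :
    ∃ f' g', IsGT t f' ∧ IsGT t g' ∧ f' n = g' n ∧
      GTContent (e - minorLead le_rfl (rowTop n t htn) (colLeft n t htn)) f' g' := by
  classical
  have hle' := Multiset.le_iff_count.mp hle
  have h1 : ∀ k < t, f (n - t + k) k < f (n - t + k + 1) k := fun k hk => by
    have h2 := hle' (Sum.inl (rowTop n t htn ⟨k, hk⟩, ⟨k, hk⟩))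
    rw [count_minorLead_inl, if_pos ⟨⟨k, hk⟩, rfl, rfl⟩] at h2
    have h3 := he.left (rowTop n t htn ⟨k, hk⟩) ⟨k, hk⟩
    simp only [rowTop] at h2 h3
    omega
  have h2 : ∀ k < t, g (0 + k) k < g (0 + k + 1) k := fun k hk => by
    have h2 := hle' (Sum.inr (⟨k, hk⟩, colLeft n t htn ⟨k, hk⟩))
    rw [count_minorLead_inr, if_pos ⟨⟨k, hk⟩, rfl, rfl⟩] at h2
    have h3 := he.right ⟨k, hk⟩ (colLeft n t htn ⟨k, hk⟩)
    simp only [colLeft] at h2 h3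
    rw [zero_add]
    omega
  refine ⟨_, _, hf.removeColumn h1, hg.removeColumn h2, ?_, ?_, ?_⟩
  · funext k
    unfold _root_.removeColumn
    rw [hfg]
    congr 1
    refine if_congr ?_ rfl rfl
    omega
  · intro i k
    rw [Multiset.count_sub, count_minorLead_inl]
    exact hf.removeColumn_content h1 (fun p => rfl) i k.2 (he.left i k)
  · intro k j
    rw [Multiset.count_sub, count_minorLead_inr]
    exact hg.removeColumn_content (r := colLeft n t htn) h2 (fun p => (zero_add _).symm) j k.2
      (he.right k j)

end Patterns

section Comparison

variable {K R I : Type*} [Field K] [Ring R] [Algebra K R] {x : I → R} {w : I → ℕ}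

lemma HasLead.mem_lowSpan {f : R} {a : Multiset I} (h : HasLead K x w f a) :
    f ∈ lowSpan K x w a.card (wordWt w a + 1) := by
  obtain ⟨c, -, l, hl, h⟩ := h
  rw [← sub_add_cancel f (c • wordProd x l)]
  refine add_mem (lowSpan_mono (Nat.le_succ _) h) (Submodule.smul_mem _ _ ?_)
  subst hl
  exact wordProd_mem_lowSpan (by simp) (Nat.lt_succ_self _)

lemma wordProd_mem_lowSpan_of_hasLead_zero (hx : QComm K x w) {l : List I}
    (h : HasLead K x w (0 : R) l) : wordProd x l ∈ lowSpan K x w l.length (wordWt w l) := by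
  obtain ⟨a, ha, hl⟩ := h.word hx rfl
  rw [zero_sub, Submodule.neg_mem_iff, Submodule.smul_mem_iff _ ha] at hl
  exact hl

/-- If every multiset violating `P` contains the content of a word that can be rewritten in smaller
terms, then the words whose content satisfies `P` span. -/
lemma lowSpan_le_span (hx : QComm K x w) {P : Multiset I → Prop}
    (hP : ∀ s, ¬ P s → ∃ l : List I, (l : Multiset I) ≤ s ∧
      wordProd x l ∈ lowSpan K x w l.length (wordWt w l)) (N d : ℕ) :
    lowSpan K x w N d ≤ Submodule.span K
      (Set.range fun s : {s : Multiset I // P s ∧ s.card = N} => wordProd x s.1.toList) := by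
  induction d with
  | zero => exact Submodule.span_le.mpr fun _ ⟨_, _, h, _⟩ => absurd h (Nat.not_lt_zero _)
  | succ d ih =>
    refine Submodule.span_le.mpr ?_
    rintro _ ⟨l, hl, hd, rfl⟩
    have hd' : wordWt w l ≤ d := Nat.le_of_lt_succ hd
    have key : ∀ l' : List I, l.Perm l' → wordProd x l' ∈ Submodule.span K (Set.range
        fun s : {s : Multiset I // P s ∧ s.card = N} => wordProd x s.1.toList) →
        wordProd x l ∈ Submodule.span K (Set.range
          fun s : {s : Multiset I // P s ∧ s.card = N} => wordProd x s.1.toList) := by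
      intro l' hp hl'
      obtain ⟨c, -, h⟩ := wordProd_perm hx hp
      rw [← sub_add_cancel (wordProd x l) (c • wordProd x l')]
      rw [hl] at h
      exact add_mem (ih (lowSpan_mono hd' h)) (Submodule.smul_mem _ _ hl')
    by_cases hPl : P l
    · refine key (l : Multiset I).toList (Multiset.coe_eq_coe.mp (by simp)) ?_
      exact Submodule.subset_span ⟨⟨l, hPl, by simpa using hl⟩, rfl⟩
    · obtain ⟨l₁, hle, hlow⟩ := hP _ hPl
      obtain ⟨s, hs⟩ := Multiset.le_iff_exists_add.mp hle
      have hs' : (l : Multiset I) = (l₁ ++ s.toList : List I) := by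
        rw [hs, ← Multiset.coe_add, Multiset.coe_toList]
      refine key (l₁ ++ s.toList) (Multiset.coe_eq_coe.mp hs') (ih ?_)
      have h1 := mul_mem_lowSpan' hlow
        (wordProd_mem_lowSpan (x := x) (l := s.toList) rfl (Nat.lt_succ_self (wordWt w _)))
      rw [← wordProd_append, ← wordWt_append, ← hs', ← List.length_append,
        ← (Multiset.coe_eq_coe.mp hs').length_eq, hl] at h1
      exact lowSpan_mono hd' h1

lemma span_range_eq_of_linearIndependent {V ι : Type*} [AddCommGroup V] [Module K V] [Finite ι]
    {a g : ι → V} (hg : LinearIndependent K g)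
    (h : ∀ i, g i ∈ Submodule.span K (Set.range a)) :
    Submodule.span K (Set.range g) = Submodule.span K (Set.range a) := by
  cases nonempty_fintype ι
  have := FiniteDimensional.span_of_finite K (Set.finite_range a)
  refine Submodule.eq_of_le_of_finrank_le (Submodule.span_le.mpr ?_) ?_
  · rintro _ ⟨i, rfl⟩
    exact h i
  · rw [finrank_span_eq_card hg]
    exact finrank_range_le_card a

variable {A U : Type*} [Ring A] [Algebra K A] {b : Module.Basis (Multiset I) K R}

/-- A leading term argument: if the leading contents of `μ (g u)` that are divisible by the leading
content of `μ d` come from multiples of `d`, then elements mapped to multiples of `μ d` are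
multiples of `d`. -/
lemma exists_eq_mul_of_map_eq_mul (hx : QComm K x w) (hb : IsWordBasis x b) (μ : A →ₐ[K] R)
    {g : U → A} {e : U → Multiset I} (hg : Submodule.span K (Set.range g) = ⊤)
    (he : Function.Injective e) (hlead : ∀ u, HasLead K x w (μ (g u)) (e u))
    {d : A} {δ : Multiset I} (hd : HasLead K x w (μ d) δ)
    (hδ : ∀ u s, e u = δ + s → ∃ h : A, HasLead K x w (μ h) s) {z : A} {r : R}
    (hz : μ z = μ d * r) : ∃ y, z = d * y := by
  have hspan : ∀ z, μ z ∈ Submodule.span K (Set.range fun u => μ (g u)) := fun z => by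
    have : z ∈ Submodule.span K (Set.range g) := hg ▸ Submodule.mem_top
    have h1 := Submodule.mem_map_of_mem (f := μ.toLinearMap) this
    rw [Submodule.map_span, ← Set.range_comp] at h1
    exact h1
  have hinj : ∀ z, μ z = 0 → z = 0 := fun z hz0 => by
    have : z ∈ Submodule.span K (Set.range g) := hg ▸ Submodule.mem_top
    obtain ⟨c, rfl⟩ := Finsupp.mem_span_range_iff_exists_finsupp.mp this
    have hli := linearIndependent_of_hasLead hx hb he hlead
    have hc : c = 0 := linearIndependent_iff.mp hli c (by
      rw [Finsupp.linearCombination_apply, ← hz0, Finsupp.sum, Finsupp.sum, map_sum]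
      simp)
    simp [hc]
  have hspan' : ∀ r, μ d * r ∈ Submodule.span K (Set.range fun s => μ d * b s) := fun r => by
    have h1 := Submodule.mem_map_of_mem (f := LinearMap.mulLeft K (μ d)) (b.mem_span r)
    rw [Submodule.map_span, ← Set.range_comp] at h1
    exact h1
  have hlead' : ∀ s, HasLead K x w (μ d * b s) (δ + s) := fun s => by
    obtain ⟨l, hl, hbl⟩ := hb s
    rw [hbl, ← hl]
    exact hd.mul (hasLead_wordProd l)
  have main : ∀ N : ℕ, ∀ z r, μ z = μ d * r →
      (∀ s, N ≤ wordWt w s → b.repr (μ z) s = 0) → ∃ y, z = d * y := by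
    classical
    intro N
    induction N with
    | zero =>
      intro z r _ h
      have h0 : b.repr (μ z) = 0 := Finsupp.ext fun s => h s (Nat.zero_le _)
      exact ⟨0, (hinj z (b.repr.map_eq_zero_iff.mp h0)).trans (mul_zero d).symm⟩
    | succ N ihN =>
      intro z r hz h
      induction hk : ((b.repr (μ z)).support.filter fun s => wordWt w s = N).card
        generalizing z r with
      | zero =>
        refine ihN z r hz fun s hs => ?_
        by_contra hne
        rcases hs.eq_or_lt with hs | hs
        · rw [Finset.card_eq_zero] at hk
          have : s ∈ (b.repr (μ z)).support.filter fun s => wordWt w s = N :=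
            Finset.mem_filter.mpr ⟨Finsupp.mem_support_iff.mpr hne, hs.symm⟩
          rw [hk] at this
          exact Finset.notMem_empty _ this
        · exact hne (h s hs)
      | succ k ihk =>
        obtain ⟨s, hs⟩ := Finset.card_pos.mp (lt_of_lt_of_eq (Nat.succ_pos k) hk.symm)
        obtain ⟨hs1, hs2⟩ := Finset.mem_filter.mp hs
        have hs1 := Finsupp.mem_support_iff.mp hs1
        have hmax : ∀ s', wordWt w s < wordWt w s' → b.repr (μ z) s' = 0 := fun s' hs' =>
          h s' (by omega)
        obtain ⟨u, hu⟩ := exists_eq_of_repr_ne_zero hx hb he hlead (hspan z) hmax hs1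
        obtain ⟨s₀, hs₀⟩ := exists_eq_of_repr_ne_zero hx hb (add_right_injective δ) hlead'
          (hz ▸ hspan' r) hmax hs1
        obtain ⟨y, hy⟩ := hδ u s₀ (hu.trans hs₀.symm)
        have hdy : HasLead K x w (μ (d * y)) s := by
          rw [map_mul, ← hs₀]
          exact hd.mul hy
        have hne := hdy.repr_ne_zero hx hb
        set c := b.repr (μ z) s / b.repr (μ (d * y)) s with hc
        have hrepr : ∀ s', b.repr (μ (z - d * (c • y))) s' =
            b.repr (μ z) s' - c * b.repr (μ (d * y)) s' := fun s' => by
          rw [mul_smul_comm, map_sub, map_smul, map_sub, map_smul, Finsupp.sub_apply,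
            Finsupp.smul_apply, smul_eq_mul]
        have hrepr_of_ne : ∀ s', s' ≠ s → wordWt w s ≤ wordWt w s' →
            b.repr (μ (z - d * (c • y))) s' = b.repr (μ z) s' := fun s' h1 h2 => by
          rw [hrepr, hdy.repr_eq_zero hx hb h1 h2, mul_zero, sub_zero]
        have hrepr_self : b.repr (μ (z - d * (c • y))) s = 0 := by
          rw [hrepr, hc, div_mul_cancel₀ _ hne, sub_self]
        obtain ⟨y', hy'⟩ := ihk (z - d * (c • y)) (r - μ (c • y))
          (by rw [map_sub, hz, map_mul, mul_sub])
          (fun s' hs' => by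
            rw [hrepr_of_ne s' (by rintro rfl; omega) (by omega)]
            exact h s' hs')
          (by
            have : ((b.repr (μ (z - d * (c • y)))).support.filter fun s => wordWt w s = N) =
                ((b.repr (μ z)).support.filter fun s => wordWt w s = N).erase s := by
              ext s'
              simp only [Finset.mem_filter, Finsupp.mem_support_iff, Finset.mem_erase]
              by_cases hss : s' = s
              · subst hss
                simp only [hrepr_self, ne_eq, not_true_eq_false, false_and]
              · by_cases hw : wordWt w s' = N
                · rw [hrepr_of_ne s' hss (by omega)]
                  tauto
                · tauto
            rw [this, Finset.card_erase_of_mem hs, hk, Nat.add_sub_cancel])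
        exact ⟨y' + c • y, by rw [mul_add, ← hy', sub_add_cancel]⟩
  obtain ⟨N, hN⟩ : ∃ N, ∀ s ∈ (b.repr (μ z)).support, wordWt w s < N :=
    ⟨(b.repr (μ z)).support.sup (wordWt w) + 1, fun s hs =>
      Nat.lt_succ_of_le (Finset.le_sup (f := wordWt w) hs)⟩
  refine main N z r hz fun s hs => ?_
  by_contra hne
  exact absurd (hN s (Finsupp.mem_support_iff.mpr hne)) (not_lt.mpr hs)

end Comparison

section Tableaux

variable {n t : ℕ}

/-- The multiset of cells contains no strictly increasing chain of `t + 1` cells. -/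
def NoChain (t : ℕ) (s : Multiset (Fin n × Fin n)) : Prop :=
  ¬ ∃ r c : Fin (t + 1) → Fin n, StrictMono r ∧ StrictMono c ∧ ∀ p, (r p, c p) ∈ s

/-- The matrix of multiplicities of a multiset of cells. -/
def entries (s : Multiset (Fin n × Fin n)) (a b : ℕ) : ℕ :=
  if h : a < n ∧ b < n then s.count (⟨a, h.1⟩, ⟨b, h.2⟩) else 0

lemma entries_val (s : Multiset (Fin n × Fin n)) (a b : Fin n) :
    entries s a b = s.count (a, b) := by
  simp [entries]

lemma sum_entries (s : Multiset (Fin n × Fin n)) :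
    ∑ a ∈ Finset.range n, ∑ b ∈ Finset.range n, entries s a b = s.card := by
  rw [← Multiset.sum_count_eq_card (s := Finset.univ) fun a _ => Finset.mem_univ a,
    Fintype.sum_prod_type, Finset.sum_range]
  refine Finset.sum_congr rfl fun a _ => ?_
  rw [Finset.sum_range]
  exact Finset.sum_congr rfl fun b _ => entries_val s a b

lemma NoChain.growth_eq_zero {s : Multiset (Fin n × Fin n)} (h : NoChain t s) (i j : ℕ) :
    growth t (entries s) i j t = 0 := by
  by_contra hne
  obtain ⟨r, c, hr, hc, hrc⟩ := exists_chain_of_growth_pos (Nat.pos_of_ne_zero hne)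
  have hlt : ∀ p, r p < n ∧ c p < n := fun p => by
    by_contra hn
    have := (hrc p).2.2
    rw [entries, dif_neg hn] at this
    exact lt_irrefl _ this
  refine h ⟨fun p => ⟨r p, (hlt p).1⟩, fun p => ⟨c p, (hlt p).2⟩, fun a b h => hr h,
    fun a b h => hc h, fun p => ?_⟩
  have := (hrc p).2.2
  rw [entries, dif_pos (hlt p)] at this
  exact Multiset.count_pos.mp this

lemma NoChain.isGT_left {s : Multiset (Fin n × Fin n)} (h : NoChain t s) (j : ℕ) :
    IsGT t fun i => growth t (entries s) i j where
  zero k := by simp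
  strip i := (isStrip_growth i j).2
  trunc i k hk := by
    rcases hk.eq_or_lt with rfl | hk
    · exact h.growth_eq_zero i j
    · exact _root_.growth_eq_zero i j hk

lemma NoChain.isGT_right {s : Multiset (Fin n × Fin n)} (h : NoChain t s) (i : ℕ) :
    IsGT t fun j => growth t (entries s) i j where
  zero k := by simp
  strip j := (isStrip_growth i j).1
  trunc j k hk := by
    rcases hk.eq_or_lt with rfl | hk
    · exact h.growth_eq_zero i j
    · exact _root_.growth_eq_zero i j hk

lemma exists_gtContent {f g : ℕ → ℕ → ℕ} (hf : IsGT t f) (hg : IsGT t g) :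
    ∃ e : Multiset ((Fin n × Fin t) ⊕ (Fin t × Fin n)), GTContent e f g := by
  classical
  refine ⟨Multiset.toFinsupp.symm (Finsupp.equivFunOnFinite.symm (Sum.elim
    (fun a => f (a.1 + 1) a.2 - f a.1 a.2) fun a => g (a.2 + 1) a.1 - g a.2 a.1)), ?_, ?_⟩
  · intro i k
    rw [← Multiset.toFinsupp_apply, AddEquiv.apply_symm_apply]
    have := (hf.strip i k).1
    simp
    omega
  · intro k j
    rw [← Multiset.toFinsupp_apply, AddEquiv.apply_symm_apply]
    have := (hg.strip j k).1
    simp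
    omega

lemma IsGT.eq_of_content {f f' : ℕ → ℕ → ℕ} (hf : IsGT t f) (hf' : IsGT t f')
    {a : Fin n → Fin t → ℕ} (h : ∀ (i : Fin n) (k : Fin t), f (i + 1) k = f i k + a i k)
    (h' : ∀ (i : Fin n) (k : Fin t), f' (i + 1) k = f' i k + a i k) :
    ∀ i ≤ n, f i = f' i := by
  intro i
  induction i with
  | zero => exact fun _ => funext fun k => by rw [hf.zero, hf'.zero]
  | succ i ih =>
    intro hi
    funext k
    by_cases hk : k < t
    · have h1 := h ⟨i, hi⟩ ⟨k, hk⟩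
      have h2 := h' ⟨i, hi⟩ ⟨k, hk⟩
      dsimp only at h1 h2
      rw [h1, h2, ih (by omega)]
    · rw [hf.trunc _ _ (not_lt.mp hk), hf'.trunc _ _ (not_lt.mp hk)]

variable (n t) in
/-- The multiset of cells without long chains, as an index type. -/
abbrev ChainFree : Type := {s : Multiset (Fin n × Fin n) // NoChain t s}

lemma exists_rsk (s : ChainFree n t) : ∃ e : Multiset ((Fin n × Fin t) ⊕ (Fin t × Fin n)),
    GTContent e (fun i => growth t (entries s.1) i n) fun j => growth t (entries s.1) n j :=
  exists_gtContent (s.2.isGT_left n) (s.2.isGT_right n)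

/-- The content of the pair of sequences of shapes attached to a multiset of cells. -/
def rsk (s : ChainFree n t) : Multiset ((Fin n × Fin t) ⊕ (Fin t × Fin n)) := (exists_rsk s).choose

lemma gtContent_rsk (s : ChainFree n t) : GTContent (rsk s)
    (fun i => growth t (entries s.1) i n) fun j => growth t (entries s.1) n j :=
  (exists_rsk s).choose_spec

lemma rsk_injective : Function.Injective (rsk (n := n) (t := t)) := fun s s' h => by
  have h1 := gtContent_rsk s
  have h2 := gtContent_rsk s'
  rw [← h] at h2
  have hl := (s.2.isGT_left n).eq_of_content (s'.2.isGT_left n) h1.left h2.left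
  have hr := (s.2.isGT_right n).eq_of_content (s'.2.isGT_right n)
    (a := fun j k => (rsk s).count (Sum.inr (k, j))) (fun j k => h1.right k j)
    fun j k => h2.right k j
  have := eq_of_growth_eq s.2.growth_eq_zero s'.2.growth_eq_zero hl hr
  refine Subtype.ext (Multiset.ext' fun ⟨a, b⟩ => ?_)
  rw [← entries_val, ← entries_val]
  exact this a a.2 b b.2

end Tableaux

section Standard

variable {K A T : Type*} [Field K] [Ring A] [Algebra K A] [Ring T] [Algebra K T] {n t : ℕ}
  {x : Fin n × Fin n → A} {y : (Fin n × Fin t) ⊕ (Fin t × Fin n) → T} {μ : A →ₐ[K] T}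
  {D : ∀ l : ℕ, (Fin l → Fin n) → (Fin l → Fin n) → A}

lemma exists_hasLead_of_gtContent
    (hD : ∀ (l : ℕ) (r c : Fin l → Fin n), StrictMono r → StrictMono c →
      HasLead K x cellWt (D l r c) (diagList r c : Multiset (Fin n × Fin n)))
    (hμ : ∀ (l : ℕ) (hl : l ≤ t) (r c : Fin l → Fin n), StrictMono r → StrictMono c →
      HasLead K y (pairWt n t) (μ (D l r c)) (minorLead hl r c)) {f g : ℕ → ℕ → ℕ}
    (hf : IsGT t f) (hg : IsGT t g) (hfg : f n = g n)
    {e : Multiset ((Fin n × Fin t) ⊕ (Fin t × Fin n))} (he : GTContent e f g) :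
    ∃ z : A, (∃ d, z ∈ lowSpan K x cellWt (∑ k ∈ Finset.range t, f n k) d) ∧
      HasLead K y (pairWt n t) (μ z) e := by
  refine GTContent.induction (P := fun e N => ∃ z : A, (∃ d, z ∈ lowSpan K x cellWt N d) ∧
      HasLead K y (pairWt n t) (μ z) e) ?_ ?_ hf hg hfg he
  · refine ⟨1, ⟨1, ?_⟩, ?_⟩
    · exact wordProd_mem_lowSpan (l := []) rfl (by simp)
    · rw [map_one]
      exact hasLead_wordProd []
  · rintro l hl r c hr hc e N ⟨z, ⟨d, hz⟩, hlead⟩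
    refine ⟨z * D l r c, ?_, ?_⟩
    · have h1 := (hD l r c hr hc).mem_lowSpan
      rw [Multiset.coe_card, diagList, List.length_ofFn] at h1
      exact ⟨_, mul_mem_lowSpan' hz h1⟩
    · rw [map_mul]
      exact hlead.mul (hμ l hl r c hr hc)

lemma finite_card_eq (α : Type*) [Finite α] (P : Multiset α → Prop) (N : ℕ) :
    Finite {s : Multiset α // P s ∧ s.card = N} := by
  cases nonempty_fintype α
  classical
  exact Finite.of_injective (β := Sym α N) (fun s => ⟨s.1, s.2.2⟩) fun s s' h =>
    Subtype.ext (Subtype.mk.inj h)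

lemma span_eq_top_of_hasLead (hx : QComm K x cellWt) (hgen : Algebra.adjoin K (Set.range x) = ⊤)
    (hred : ∀ s, ¬ NoChain t s → ∃ l : List (Fin n × Fin n), (l : Multiset (Fin n × Fin n)) ≤ s ∧
      wordProd x l ∈ lowSpan K x cellWt l.length (wordWt cellWt (l : Multiset (Fin n × Fin n))))
    (hy : QComm K y (pairWt n t))
    {b : Module.Basis (Multiset ((Fin n × Fin t) ⊕ (Fin t × Fin n))) K T} (hb : IsWordBasis y b)
    {z : ChainFree n t → A} (hz : ∀ s, ∃ d, z s ∈ lowSpan K x cellWt s.1.card d)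
    (hlead : ∀ s, HasLead K y (pairWt n t) (μ (z s)) (rsk s)) :
    Submodule.span K (Set.range z) = ⊤ := by
  have hli : LinearIndependent K z := LinearIndependent.of_comp μ.toLinearMap
    (linearIndependent_of_hasLead hy hb rsk_injective hlead)
  rw [eq_top_iff, ← span_words_eq_top hgen, Submodule.span_le]
  rintro _ ⟨l, rfl⟩
  have hfin := finite_card_eq (Fin n × Fin n) (NoChain t) l.length
  have hle := lowSpan_le_span hx hred l.length
  have hspan := span_range_eq_of_linearIndependent
    (g := fun s : {s : Multiset (Fin n × Fin n) // NoChain t s ∧ s.card = l.length} =>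
      z ⟨s.1, s.2.1⟩) (a := fun s => wordProd x s.1.toList)
    (hli.comp (fun s => ⟨s.1, s.2.1⟩) fun s s' h => Subtype.ext (Subtype.mk.inj h))
    (fun s => by
      obtain ⟨d, hd⟩ := hz ⟨s.1, s.2.1⟩
      have hcard : lowSpan K x cellWt s.1.card d = lowSpan K x cellWt l.length d :=
        congrArg (fun m => lowSpan K x cellWt m d) s.2.2
      exact hle d (hcard ▸ hd))
  have hl := hle _ (wordProd_mem_lowSpan rfl (Nat.lt_succ_self _))
  rw [← hspan] at hl
  refine Submodule.span_mono ?_ hl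
  rintro _ ⟨s, rfl⟩
  exact ⟨_, rfl⟩

/-- Elements mapped to multiples of the image of the extreme maximal minor are multiples of it. -/
lemma exists_eq_minor_mul (hx : QComm K x cellWt) (hgen : Algebra.adjoin K (Set.range x) = ⊤)
    (hred : ∀ s, ¬ NoChain t s → ∃ l : List (Fin n × Fin n), (l : Multiset (Fin n × Fin n)) ≤ s ∧
      wordProd x l ∈ lowSpan K x cellWt l.length (wordWt cellWt (l : Multiset (Fin n × Fin n))))
    (hy : QComm K y (pairWt n t))
    {b : Module.Basis (Multiset ((Fin n × Fin t) ⊕ (Fin t × Fin n))) K T} (hb : IsWordBasis y b)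
    (hD : ∀ (l : ℕ) (r c : Fin l → Fin n), StrictMono r → StrictMono c →
      HasLead K x cellWt (D l r c) (diagList r c : Multiset (Fin n × Fin n)))
    (hμ : ∀ (l : ℕ) (hl : l ≤ t) (r c : Fin l → Fin n), StrictMono r → StrictMono c →
      HasLead K y (pairWt n t) (μ (D l r c)) (minorLead hl r c)) (h : t ≤ n) {z : A} {r : T}
    (hz : μ z = μ (D t (rowTop n t h) (colLeft n t h)) * r) :
    ∃ z', z = D t (rowTop n t h) (colLeft n t h) * z' := by
  have hex : ∀ s : ChainFree n t, ∃ z : A, (∃ d, z ∈ lowSpan K x cellWt s.1.card d) ∧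
      HasLead K y (pairWt n t) (μ z) (rsk s) := fun s => by
    have := exists_hasLead_of_gtContent hD hμ (s.2.isGT_left n) (s.2.isGT_right n) rfl
      (gtContent_rsk s)
    rwa [sum_growth s.2.growth_eq_zero, sum_entries] at this
  choose g hg hlead using hex
  refine exists_eq_mul_of_map_eq_mul hy hb μ (span_eq_top_of_hasLead hx hgen hred hy hb hg hlead)
    rsk_injective hlead
    (hμ t le_rfl _ _ (rowTop_strictMono h) (colLeft_strictMono h)) ?_ hz
  intro s e he
  obtain ⟨f, g, hf, hg, hfg, hc⟩ := (gtContent_rsk s).removeColumn h (s.2.isGT_left n)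
    (s.2.isGT_right n) rfl (he ▸ Multiset.le_add_right _ _)
  rw [he, add_tsub_cancel_left] at hc
  obtain ⟨z', -, hz'⟩ := exists_hasLead_of_gtContent hD hμ hf hg hfg hc
  exact ⟨z', hz'⟩

end Standard

section Assembly

variable {K : Type} [Field K] {q : K} {n t : ℕ}

variable (K q n t) in
/-- The generators of `O_q(M_n^{≤ t})`. -/
def leVar (c : Fin n × Fin n) : OqMle K q n n t := mkle K q n n t (cellVar K q n n c)

lemma qComm_leVar (hq : q ≠ 0) : QComm K (leVar K q n t) cellWt := fun i j =>
  (qComm_cellVar hq).map (mkle K q n n t) id (fun _ => rfl) (fun _ => rfl) i j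

lemma adjoin_leVar : Algebra.adjoin K (Set.range (leVar K q n t)) = ⊤ := by
  have := congrArg (Subalgebra.map (mkle K q n n t))
    (adjoin_cellVar (K := K) (q := q) (u := n) (v := n))
  rw [AlgHom.map_adjoin, Algebra.map_top, (AlgHom.range_eq_top (mkle K q n n t)).mpr
    (RingQuot.mkAlgHom_surjective K _), ← Set.range_comp] at this
  exact this

lemma hasLead_mkle {f : OqM K q n n} {a : Multiset (Fin n × Fin n)}
    (h : HasLead K (cellVar K q n n) cellWt f a) :
    HasLead K (leVar K q n t) cellWt (mkle K q n n t f) a := by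
  obtain ⟨c, hc, l, hl, h⟩ := h
  refine ⟨c, hc, l, hl, ?_⟩
  have h1 := map_mem_lowSpan (x' := leVar K q n t) (mkle K q n n t) id (fun _ => rfl)
    (fun _ => rfl) h
  rwa [map_sub, map_smul, map_wordProd (x := cellVar K q n n) (x' := leVar K q n t)
    (mkle K q n n t) id fun _ => rfl,
    List.map_id] at h1

lemma mkle_qMinor_eq_zero {r c : Fin (t + 1) → Fin n} (hr : StrictMono r) (hc : StrictMono c) :
    mkle K q n n t (qMinor K q r c) = 0 := by
  have := RingQuot.mkAlgHom_rel K (DetRel.minor (K := K) (q := q) r c hr hc)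
  rw [mkle, this, map_zero]

lemma exists_word_mem_lowSpan (hq : q ≠ 0) {s : Multiset (Fin n × Fin n)} (hs : ¬ NoChain t s) :
    ∃ l : List (Fin n × Fin n), (l : Multiset (Fin n × Fin n)) ≤ s ∧
      wordProd (leVar K q n t) l ∈ lowSpan K (leVar K q n t) cellWt l.length
        (wordWt cellWt (l : Multiset (Fin n × Fin n))) := by
  obtain ⟨r, c, hr, hc, h⟩ := not_not.mp hs
  refine ⟨diagList r c, ?_, ?_⟩
  · have hnd : (diagList r c).Nodup := List.nodup_ofFn.mpr fun a b h =>
      hr.injective (Prod.ext_iff.mp h).1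
    refine (Multiset.le_iff_subset (Multiset.coe_nodup.mpr hnd)).mpr fun a ha => ?_
    obtain ⟨p, rfl⟩ := List.mem_ofFn.mp (Multiset.mem_coe.mp ha)
    exact h p
  · have h0 := hasLead_mkle (t := t) (hasLead_qMinor (K := K) (q := q) hr hc)
    rw [mkle_qMinor_eq_zero hr hc] at h0
    exact wordProd_mem_lowSpan_of_hasLead_zero (qComm_leVar hq) h0

lemma map_mkle_qMinor {R : Type*} [Ring R] [Algebra K R] (μ : OqMle K q n n t →ₐ[K] R)
    {y : Fin n → Fin n → R} (hμ : ∀ i j, μ (mkle K q n n t (Xg K q i j)) = y i j) {l : ℕ}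
    (r c : Fin l → Fin n) : μ (mkle K q n n t (qMinor K q r c)) = qm q y r c := by
  rw [qMinor_eq_qm, qm, qm, map_sum, map_sum]
  refine Finset.sum_congr rfl fun σ _ => ?_
  rw [map_smul, map_smul, map_list_prod, map_list_prod, List.map_ofFn, List.map_ofFn]
  congr 3
  funext i
  exact hμ _ _

variable {μ : OqMle K q n n t →ₐ[K] OqM K q n t ⊗[K] OqM K q t n}

lemma hasLead_map_mkle_qMinor (hq : q ≠ 0)
    (hμ : ∀ i j : Fin n, μ (mkle K q n n t (Xg K q i j)) =
      ∑ k : Fin t, Xg K q i k ⊗ₜ[K] Xg K q k j) (l : ℕ) (hl : l ≤ t)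
    (r c : Fin l → Fin n) (hr : StrictMono r) (hc : StrictMono c) :
    HasLead K (pairVar K q n t) (pairWt n t) (μ (mkle K q n n t (qMinor K q r c)))
      (minorLead hl r c) :=
  have h : μ (mkle K q n n t (qMinor K q r c)) =
      qm q (fun i j => ∑ k : Fin t, Xg K q i k ⊗ₜ[K] Xg K q k j) r c :=
    map_mkle_qMinor (R := OqM K q n t ⊗[K] OqM K q t n) μ
      (y := fun i j => ∑ k : Fin t, Xg K q i k ⊗ₜ[K] Xg K q k j) hμ r c
  h.symm ▸ hasLead_qm_tmul hq hl hr hc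

lemma map_dx (hq : q ≠ 0)
    (hμ : ∀ i j : Fin n, μ (mkle K q n n t (Xg K q i j)) =
      ∑ k : Fin t, Xg K q i k ⊗ₜ[K] Xg K q k j) (h : t ≤ n) :
    μ (dx K q n t h) = dY K q n t h ⊗ₜ[K] dZ K q n t h :=
  (map_mkle_qMinor (R := OqM K q n t ⊗[K] OqM K q t n) μ
    (y := fun i j => ∑ k : Fin t, Xg K q i k ⊗ₜ[K] Xg K q k j) hμ _ _).trans
      (isQMat_Xg.qm_sum_tmul_top hq _ (colLeft_strictMono h))

lemma exists_eq_dx_mul (hq : q ≠ 0)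
    (hμ : ∀ i j : Fin n, μ (mkle K q n n t (Xg K q i j)) =
      ∑ k : Fin t, Xg K q i k ⊗ₜ[K] Xg K q k j) (h : t ≤ n)
    {x : OqMle K q n n t} {r : OqM K q n t ⊗[K] OqM K q t n} (hx : μ x = μ (dx K q n t h) * r) :
    ∃ y, x = dx K q n t h * y := by
  obtain ⟨b, hb⟩ := exists_isWordBasis_pairVar (K := K) (n := n) (t := t) hq
  exact exists_eq_minor_mul (D := fun _ r c => mkle K q n n t (qMinor K q r c)) (qComm_leVar hq)
    adjoin_leVar (fun s hs => exists_word_mem_lowSpan hq hs) (qComm_pairVar hq) hb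
    (fun l r c hr hc => hasLead_mkle (hasLead_qMinor hr hc)) (hasLead_map_mkle_qMinor hq hμ) h hx

lemma mul_mul_mem_tsSpan {R : Type} [Ring R] [Algebra K R] {S : Set R} {s : R} (hs : s ∈ S)
    (a b : R) : a * s * b ∈ tsSpan K R S :=
  Submodule.subset_span ⟨a, b, s, hs, rfl⟩

lemma map_mem_tsSpan {R R' : Type} [Ring R] [Algebra K R] [Ring R'] [Algebra K R'] (f : R →ₐ[K] R')
    {d x : R} (hx : x ∈ tsSpan K R {d}) : f x ∈ tsSpan K R' {f d} := by
  change x ∈ Submodule.span K _ at hx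
  change f x ∈ Submodule.span K _
  induction hx using Submodule.span_induction with
  | zero => rw [map_zero]; exact zero_mem _
  | add a b _ _ ha hb => rw [map_add]; exact add_mem ha hb
  | smul c a _ ha => rw [map_smul]; exact Submodule.smul_mem _ _ ha
  | mem a ha =>
    obtain ⟨a, b, s, rfl, rfl⟩ := ha
    rw [map_mul, map_mul]
    exact Submodule.subset_span ⟨f a, f b, f s, rfl, rfl⟩

lemma map_mem_tsSpan_iff {A T : Type} [Ring A] [Algebra K A] [Ring T] [Algebra K T] (f : A →ₐ[K] T)
    {d : A} {D : T} (hd : f d = D) (hD : ∀ r, ∃ r', r * D = D * r')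
    (hdiv : ∀ x r, f x = f d * r → ∃ y, x = d * y) (x : A) :
    f x ∈ tsSpan K T {D} ↔ x ∈ tsSpan K A {d} := by
  subst hd
  constructor
  · intro h
    obtain ⟨r, hr⟩ := exists_eq_mul_of_mem_tsSpan hD h
    obtain ⟨y, rfl⟩ := hdiv x r hr
    have := mul_mul_mem_tsSpan (K := K) (Set.mem_singleton d) 1 y
    rwa [one_mul] at this
  · exact map_mem_tsSpan f

end Assembly

/-- (case `m = n > t`) the preimage under
`μ*_q : O_q(M_n^{≤t}) → O_q(V)` of the ideal `⟨d_Y ⊗ d_Z⟩` equals the ideal `⟨d_x⟩`. -/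
theorem stmt12 (K : Type) [Field K] (q : K) (hq : q ≠ 0) (n t : ℕ) (ht : 0 < t) (htn : t < n)
    -- `μ*_q`, induced by `X_{ij} ↦ Σ_k Y_{ik} ⊗ Z_{kj}`:
    (μ : OqMle K q n n t →ₐ[K] OqM K q n t ⊗[K] OqM K q t n)
    (hμ : ∀ (i j : Fin n),
      μ (mkle K q n n t (Xg K q i j)) = ∑ k : Fin t, Xg K q i k ⊗ₜ[K] Xg K q k j) :
    ∀ x : OqMle K q n n t,
      μ x ∈ tsSpan K (OqM K q n t ⊗[K] OqM K q t n)
          {dY K q n t htn.le ⊗ₜ[K] dZ K q n t htn.le} ↔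
        x ∈ tsSpan K (OqMle K q n n t) {dx K q n t htn.le} := by
  exact map_mem_tsSpan_iff (A := OqMle K q n n t) (T := OqM K q n t ⊗[K] OqM K q t n) μ
    (map_dx hq hμ htn.le)
    (exists_tmul_mul_eq_mul (exists_mul_dY hq ht htn.le) (exists_mul_dZ hq ht htn.le))
    fun _ _ => exists_eq_dx_mul hq hμ htn.le

end
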